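/- Let K be a field, q ∈ K nonzero, and n > t positive integers, and let s be any nonnegative integer. Then (μ*_q)^{−1}(⟨d_Y^s ⊗ 1⟩) = P_1^s and (μ*_q)^{−1}(⟨1 ⊗ d_Z^s⟩) = P_2^s, where ⟨d_Y^s ⊗ 1⟩ and ⟨1 ⊗ d_Z^s⟩ are the ideals of O_q(V) generated by d_Y^s ⊗ 1 and 1 ⊗ d_Z^s respectively. -/

import Mathlib

open scoped TensorProduct

noncomputable section

/-- The four defining relations of the quantized coordinate ring `O_q(M_{u,v})`, as a relation
on the free algebra on generators `X_{ij}`, `(i,j) ∈ Fin u × Fin v`. -/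
inductive QMRel (K : Type) [Field K] (q : K) (u v : ℕ) :
    FreeAlgebra K (Fin u × Fin v) → FreeAlgebra K (Fin u × Fin v) → Prop
  | row {i : Fin u} {j k : Fin v} (h : j < k) :
      QMRel K q u v (FreeAlgebra.ι K (i, j) * FreeAlgebra.ι K (i, k))
        (q • (FreeAlgebra.ι K (i, k) * FreeAlgebra.ι K (i, j)))
  | col {i k : Fin u} {j : Fin v} (h : i < k) :
      QMRel K q u v (FreeAlgebra.ι K (i, j) * FreeAlgebra.ι K (k, j))
        (q • (FreeAlgebra.ι K (k, j) * FreeAlgebra.ι K (i, j)))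
  | comm {i k : Fin u} {j l : Fin v} (h1 : i < k) (h2 : l < j) :
      QMRel K q u v (FreeAlgebra.ι K (i, j) * FreeAlgebra.ι K (k, l))
        (FreeAlgebra.ι K (k, l) * FreeAlgebra.ι K (i, j))
  | quantum {i k : Fin u} {j l : Fin v} (h1 : i < k) (h2 : j < l) :
      QMRel K q u v (FreeAlgebra.ι K (i, j) * FreeAlgebra.ι K (k, l))
        (FreeAlgebra.ι K (k, l) * FreeAlgebra.ι K (i, j) +
          (q - q⁻¹) • (FreeAlgebra.ι K (i, l) * FreeAlgebra.ι K (k, j)))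

/-- The quantized coordinate ring `O_q(M_{u,v})` of `u × v` matrices. -/
abbrev OqM (K : Type) [Field K] (q : K) (u v : ℕ) :=
  RingQuot (QMRel K q u v)

/-- The canonical generators `X_{ij}` of `O_q(M_{u,v})`. -/
def Xg (K : Type) [Field K] (q : K) {u v : ℕ} (i : Fin u) (j : Fin v) : OqM K q u v :=
  RingQuot.mkAlgHom K (QMRel K q u v) (FreeAlgebra.ι K (i, j))

/-- The number of inversions (the length) of a permutation of `Fin l`. -/
def invCount {l : ℕ} (σ : Equiv.Perm (Fin l)) : ℕ :=
  (Finset.univ.filter fun p : Fin l × Fin l => p.1 < p.2 ∧ σ p.2 < σ p.1).card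

/-- The `l × l` quantum minor of `O_q(M_{u,v})` with rows `R 0, …, R (l-1)` and columns
`C 0, …, C (l-1)`:  `[R|C] = Σ_σ (-q)^{ℓ(σ)} X_{R 0, C (σ 0)} ⋯ X_{R (l-1), C (σ (l-1))}`. -/
def qMinor (K : Type) [Field K] (q : K) {u v l : ℕ} (R : Fin l → Fin u) (C : Fin l → Fin v) :
    OqM K q u v :=
  ∑ σ : Equiv.Perm (Fin l),
    ((-q) ^ invCount σ) • (List.ofFn fun i : Fin l => Xg K q (R i) (C (σ i))).prod

/-- The relations killing all `(t+1) × (t+1)` quantum minors of `O_q(M_{m,n})`. -/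
inductive DetRel (K : Type) [Field K] (q : K) (m n t : ℕ) :
    OqM K q m n → OqM K q m n → Prop
  | minor (R : Fin (t + 1) → Fin m) (C : Fin (t + 1) → Fin n)
      (hR : StrictMono R) (hC : StrictMono C) :
      DetRel K q m n t (qMinor K q R C) 0

/-- `O_q(M_{m,n}^{≤ t}) = O_q(M_{m,n}) / I_{t+1}`, the quotient by the ideal generated by all
`(t+1) × (t+1)` quantum minors. -/
abbrev OqMle (K : Type) [Field K] (q : K) (m n t : ℕ) :=
  RingQuot (DetRel K q m n t)

/-- The quotient map `O_q(M_{m,n}) → O_q(M_{m,n}^{≤ t})`. -/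
def mkle (K : Type) [Field K] (q : K) (m n t : ℕ) :
    OqM K q m n →ₐ[K] OqMle K q m n t :=
  RingQuot.mkAlgHom K (DetRel K q m n t)

/-- The two-sided ideal of a `K`-algebra `R` generated by a subset `S`, as a set. -/
def tsSpan (K : Type) [Field K] (R : Type) [Ring R] [Algebra K R] (S : Set R) : Set R :=
  (Submodule.span K {x : R | ∃ a b : R, ∃ s ∈ S, x = a * s * b} : Submodule K R)

/-- The rows `{n-t+1, …, n}` (the lowest `t` rows). -/
def rowTop (n t : ℕ) (h : t ≤ n) : Fin t → Fin n :=
  fun i => ⟨n - t + i.1, by have := i.2; omega⟩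

/-- The columns `{1, …, t}` (the leftmost `t` columns). -/
def colLeft (n t : ℕ) (h : t ≤ n) : Fin t → Fin n :=
  fun i => ⟨i.1, by have := i.2; omega⟩

/-- `d_Y = [n,…,n-t+1 | 1,…,t] ∈ O_q(M_{n,t})`. -/
def dY (K : Type) [Field K] (q : K) (n t : ℕ) (h : t ≤ n) : OqM K q n t :=
  qMinor K q (rowTop n t h) (id : Fin t → Fin t)

/-- `d_Z = [t,…,1 | 1,…,t] ∈ O_q(M_{t,n})`. -/
def dZ (K : Type) [Field K] (q : K) (n t : ℕ) (h : t ≤ n) : OqM K q t n :=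
  qMinor K q (id : Fin t → Fin t) (colLeft n t h)

/-- `d_X = [n,…,n-t+1 | 1,…,t] ∈ O_q(M_n)`. -/
def dX (K : Type) [Field K] (q : K) (n t : ℕ) (h : t ≤ n) : OqM K q n n :=
  qMinor K q (rowTop n t h) (colLeft n t h)

/-- `d_x = d_X + I_{t+1} ∈ O_q(M_n^{≤ t})`. -/
def dx (K : Type) [Field K] (q : K) (n t : ℕ) (h : t ≤ n) : OqMle K q n n t :=
  mkle K q n n t (dX K q n t h)

/-- The quantum minor of `O_q(M_{u,v})` with row set `I` and column set `J` (interpreted as 0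
when `|I| ≠ |J|`). -/
def qMinorF (K : Type) [Field K] (q : K) {u v : ℕ} (I : Finset (Fin u)) (J : Finset (Fin v)) :
    OqM K q u v :=
  if h : I.card = J.card then
    qMinor K q (fun i => ((I.orderIsoOfFin rfl i : I) : Fin u))
      (fun i => ((J.orderIsoOfFin h.symm i : J) : Fin v))
  else 0

/-- The row set `Ĩ = {n-t+1, …, n}`. -/
def Itilde (n t : ℕ) (h : t ≤ n) : Finset (Fin n) := Finset.image (rowTop n t h) Finset.univ

/-- The column set `J̃ = {1, …, t}`. -/
def Jtilde (n t : ℕ) (h : t ≤ n) : Finset (Fin n) := Finset.image (colLeft n t h) Finset.univ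

/-- The product of two-sided ideals, as sets: the span of pairwise products. -/
def mulSet (K : Type) [Field K] (R : Type) [Ring R] [Algebra K R] (A B : Set R) : Set R :=
  (Submodule.span K {x : R | ∃ a ∈ A, ∃ b ∈ B, x = a * b} : Submodule K R)

/-- The `s`-th power of a two-sided ideal (given as a set), with `P^0 = R`. -/
def idealPow (K : Type) [Field K] (R : Type) [Ring R] [Algebra K R] (P : Set R) :
    ℕ → Set R
  | 0 => Set.univ
  | s + 1 => mulSet K R (idealPow K R P s) P

/-- The ideal `P₁` of `O_q(M_n^{≤t})`, generated by the images of the quantum minors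
`[Ĩ|J]`, `|J| = t`. -/
def Pone (K : Type) [Field K] (q : K) (n t : ℕ) (h : t ≤ n) : Set (OqMle K q n n t) :=
  tsSpan K (OqMle K q n n t)
    {x | ∃ J : Finset (Fin n), J.card = t ∧
      x = mkle K q n n t (qMinorF K q (Itilde n t h) J)}

/-- The ideal `P₂` of `O_q(M_n^{≤t})`, generated by the images of the quantum minors
`[I|J̃]`, `|I| = t`. -/
def Ptwo (K : Type) [Field K] (q : K) (n t : ℕ) (h : t ≤ n) : Set (OqMle K q n n t) :=
  tsSpan K (OqMle K q n n t)
    {x | ∃ I : Finset (Fin n), I.card = t ∧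
      x = mkle K q n n t (qMinorF K q I (Jtilde n t h))}

/-- The entries of the matrix `x` satisfy the relations of a quantum matrix. -/
structure IsQMat {K : Type} [Field K] (q : K) {E : Type} [Ring E] [Algebra K E] {u v : ℕ}
    (x : Fin u → Fin v → E) : Prop where
  row : ∀ {i j k}, j < k → x i j * x i k = q • (x i k * x i j)
  col : ∀ {i k j}, i < k → x i j * x k j = q • (x k j * x i j)
  comm : ∀ {i k j l}, i < k → l < j → x i j * x k l = x k l * x i j
  quantum : ∀ {i k j l}, i < k → j < l →
    x i j * x k l = x k l * x i j + (q - q⁻¹) • (x i l * x k j)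

section QMat

variable {K : Type} [Field K] {q : K} {E : Type} [Ring E] [Algebra K E] {u v w : ℕ}

theorem isQMat_Xg : IsQMat q (fun (i : Fin u) (j : Fin v) => Xg K q i j) where
  row h := by
    simpa [Xg] using RingQuot.mkAlgHom_rel K (QMRel.row (K := K) (q := q) (u := u) (v := v) h)
  col h := by
    simpa [Xg] using RingQuot.mkAlgHom_rel K (QMRel.col (K := K) (q := q) (u := u) (v := v) h)
  comm h h' := by
    simpa [Xg] using
      RingQuot.mkAlgHom_rel K (QMRel.comm (K := K) (q := q) (u := u) (v := v) h h')
  quantum h h' := by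
    simpa [Xg] using
      RingQuot.mkAlgHom_rel K (QMRel.quantum (K := K) (q := q) (u := u) (v := v) h h')

/-- The algebra morphism out of `O_q(M_{u,v})` determined by a quantum matrix. -/
def qmLift {x : Fin u → Fin v → E} (hx : IsQMat q x) : OqM K q u v →ₐ[K] E :=
  RingQuot.liftAlgHom K ⟨FreeAlgebra.lift K fun p => x p.1 p.2, by
    intro a b h
    induction h with
    | row h => simpa using hx.row h
    | col h => simpa using hx.col h
    | comm h h' => simpa using hx.comm h h'
    | quantum h h' => simpa using hx.quantum h h'⟩

@[simp] theorem qmLift_Xg {x : Fin u → Fin v → E} (hx : IsQMat q x) (i : Fin u) (j : Fin v) :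
    qmLift hx (Xg K q i j) = x i j := by
  simp [qmLift, Xg]

theorem oqM_hom_ext {f g : OqM K q u v →ₐ[K] E} (h : ∀ i j, f (Xg K q i j) = g (Xg K q i j)) :
    f = g := by
  apply RingQuot.ringQuot_ext'
  apply FreeAlgebra.hom_ext
  funext p
  exact h p.1 p.2

theorem oqM_induction {p : OqM K q u v → Prop} (hs : ∀ c : K, p (algebraMap K _ c))
    (hX : ∀ i j, p (Xg K q i j)) (hm : ∀ a b, p a → p b → p (a * b))
    (ha : ∀ a b, p a → p b → p (a + b)) (x : OqM K q u v) : p x := by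
  obtain ⟨y, rfl⟩ := RingQuot.mkAlgHom_surjective K (QMRel K q u v) x
  induction y using FreeAlgebra.induction with
  | grade0 r => simpa using hs r
  | grade1 a => exact hX a.1 a.2
  | mul a b h1 h2 => rw [map_mul]; exact hm _ _ h1 h2
  | add a b h1 h2 => rw [map_add]; exact ha _ _ h1 h2

theorem IsQMat.map {E' : Type} [Ring E'] [Algebra K E'] {x : Fin u → Fin v → E}
    (hx : IsQMat q x) (f : E →ₐ[K] E') : IsQMat q (fun i j => f (x i j)) where
  row h := by rw [← map_mul, hx.row h, map_smul, map_mul]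
  col h := by rw [← map_mul, hx.col h, map_smul, map_mul]
  comm h h' := by rw [← map_mul, hx.comm h h', map_mul]
  quantum h h' := by
    rw [← map_mul, hx.quantum h h', map_add, map_smul, map_mul, map_mul]

theorem IsQMat.transpose {x : Fin u → Fin v → E} (hx : IsQMat q x) :
    IsQMat q (fun j i => x i j) where
  row h := hx.col h
  col h := hx.row h
  comm h h' := (hx.comm h' h).symm
  quantum {i k j l} h h' := by
    show x j i * x l k = x l k * x j i + (q - q⁻¹) • (x l i * x j k)
    rw [hx.quantum h' h, hx.comm h' h]

theorem sum_sum_eq_zero_of_pair {M : Type} [AddCommGroup M] {n : ℕ} (F : Fin n → Fin n → M)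
    (hd : ∀ k, F k k = 0) (hp : ∀ k l, k < l → F k l + F l k = 0) : ∑ k, ∑ l, F k l = 0 := by
  rw [← Finset.sum_product']
  refine Finset.sum_involution (fun p _ => p.swap) ?_ ?_ (by simp) (by simp)
  · rintro ⟨k, l⟩ -
    rcases lt_trichotomy k l with h | rfl | h
    · exact hp k l h
    · simp [hd]
    · rw [add_comm]; exact hp l k h
  · rintro ⟨k, l⟩ - hne heq
    obtain rfl : l = k := congrArg Prod.fst heq
    exact hne (hd _)

theorem IsQMat.mul (hq : q ≠ 0) {x : Fin u → Fin v → E} {z : Fin v → Fin w → E}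
    (hx : IsQMat q x) (hz : IsQMat q z) (hc : ∀ i k l j, Commute (x i k) (z l j)) :
    IsQMat q (fun i j => ∑ k, x i k * z k j) := by
  have key : ∀ i k i' l j j', (x i k * z k j) * (x i' l * z l j') =
      (x i k * x i' l) * (z k j * z l j') := by
    intro i k i' l j j'
    rw [mul_assoc, ← mul_assoc (z k j), ← (hc i' l k j).eq]
    simp only [mul_assoc]
  have hexp : ∀ i i' j j', (∑ k, x i k * z k j) * (∑ k, x i' k * z k j') =
      ∑ k, ∑ l, (x i k * x i' l) * (z k j * z l j') := by
    intro i i' j j'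
    simp only [Finset.sum_mul_sum, key]
  constructor
  · intro i j k h
    rw [hexp, hexp, ← sub_eq_zero, Finset.smul_sum, ← Finset.sum_sub_distrib]
    simp only [Finset.smul_sum, ← Finset.sum_sub_distrib]
    apply sum_sum_eq_zero_of_pair
    · intro a; rw [hz.row h]; simp
    · intro a b hab
      rw [hx.row (i := i) hab, hz.quantum hab h, hz.comm hab h]
      simp only [mul_add, smul_mul_assoc, mul_smul_comm, smul_smul]
      match_scalars <;> field_simp <;> ring
  · intro i k j h
    rw [hexp, hexp, ← sub_eq_zero, Finset.smul_sum, ← Finset.sum_sub_distrib]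
    simp only [Finset.smul_sum, ← Finset.sum_sub_distrib]
    apply sum_sum_eq_zero_of_pair
    · intro a; rw [hx.col h]; simp
    · intro a b hab
      rw [hz.col (j := j) hab, hx.quantum h hab, hx.comm h hab]
      simp only [add_mul, smul_mul_assoc, mul_smul_comm, smul_add, smul_smul]
      match_scalars <;> field_simp <;> ring
  · intro i k j l h h'
    rw [hexp, hexp, ← sub_eq_zero, ← Finset.sum_sub_distrib]
    simp only [← Finset.sum_sub_distrib]
    apply sum_sum_eq_zero_of_pair
    · intro a; rw [hx.col h, hz.row h']; simp
    · intro a b hab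
      rw [hx.quantum h hab, hx.comm h hab, hz.quantum hab h', hz.comm hab h']
      simp only [add_mul, mul_add, smul_mul_assoc, mul_smul_comm]
      module
  · intro i k j l h h'
    rw [hexp, hexp, hexp, ← sub_eq_zero, Finset.smul_sum, ← Finset.sum_add_distrib,
      ← Finset.sum_sub_distrib]
    simp only [Finset.smul_sum, ← Finset.sum_add_distrib, ← Finset.sum_sub_distrib]
    apply sum_sum_eq_zero_of_pair
    · intro a; rw [hx.col h, hz.row h']
      simp only [smul_mul_assoc, mul_smul_comm, smul_smul]
      match_scalars
      field_simp
      ring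
    · intro a b hab
      rw [hx.quantum h hab, hx.comm h hab, hz.quantum hab h', hz.comm hab h']
      simp only [add_mul, mul_add, smul_mul_assoc, mul_smul_comm, smul_add, smul_smul]
      module

end QMat

section QDet

theorem invCount_mul_swap {l : ℕ} (σ : Equiv.Perm (Fin l)) {r r' : Fin l}
    (hr : r'.val = r.val + 1) (h : σ r < σ r') :
    invCount (σ * Equiv.swap r r') = invCount σ + 1 := by
  classical
  have hs : ∀ x, (x = r ∧ Equiv.swap r r' x = r') ∨ (x = r' ∧ Equiv.swap r r' x = r) ∨
      (x ≠ r ∧ x ≠ r' ∧ Equiv.swap r r' x = x) := by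
    intro x
    by_cases h1 : x = r
    · left; subst h1; simp
    · by_cases h2 : x = r'
      · right; left; subst h2; simp
      · right; right; exact ⟨h1, h2, Equiv.swap_apply_of_ne_of_ne h1 h2⟩
  have hset : (Finset.univ.filter fun p : Fin l × Fin l =>
        p.1 < p.2 ∧ (σ * Equiv.swap r r') p.2 < (σ * Equiv.swap r r') p.1) =
      insert (r, r') ((Finset.univ.filter fun p : Fin l × Fin l =>
        p.1 < p.2 ∧ σ p.2 < σ p.1).map
          ((Equiv.swap r r').prodCongr (Equiv.swap r r')).toEmbedding) := by
    ext ⟨a, b⟩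
    rw [Finset.mem_filter]
    simp only [Finset.mem_filter, Finset.mem_univ, true_and, Finset.mem_insert, Prod.mk.injEq,
      Finset.mem_map_equiv, Equiv.prodCongr_symm, Equiv.symm_swap, Equiv.prodCongr_apply,
      Prod.map_apply, Equiv.Perm.mul_apply]
    have h' := Fin.lt_def.1 h
    rcases hs a with ⟨ha, ha'⟩ | ⟨ha, ha'⟩ | ⟨ha, ha2, ha'⟩ <;>
    rcases hs b with ⟨hb, hb'⟩ | ⟨hb, hb'⟩ | ⟨hb, hb2, hb'⟩ <;>
    rw [ha', hb'] <;> clear ha' hb' hs h <;> (try subst ha) <;> (try subst hb) <;>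
    simp only [Fin.ext_iff, Fin.lt_def, ne_eq] at * <;>
      first | omega | (simp only [hr]; omega) | grind
  rw [invCount, hset, Finset.card_insert_of_notMem, Finset.card_map]
  · rfl
  · simp only [Finset.mem_map_equiv, Equiv.prodCongr_symm, Equiv.symm_swap,
      Equiv.prodCongr_apply, Prod.map_apply, Equiv.swap_apply_left, Equiv.swap_apply_right,
      Finset.mem_filter, Fin.lt_def]
    omega

theorem prod_ofFn_adjacent {M : Type} [Monoid M] {l : ℕ} (f : Fin l → M) {r r' : Fin l}
    (hr : r'.val = r.val + 1) :
    ∃ A B : M, ∀ g : Fin l → M, (∀ i, i ≠ r → i ≠ r' → g i = f i) →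
      (List.ofFn g).prod = A * (g r * g r') * B := by
  induction l with
  | zero => exact r.elim0
  | succ l ih =>
    induction r using Fin.cases with
    | zero =>
      obtain ⟨l, rfl⟩ : ∃ m, l = m + 1 := ⟨l - 1, by have := r'.2; simp at hr; omega⟩
      obtain rfl : r' = Fin.succ 0 := by ext; simpa using hr
      refine ⟨1, (List.ofFn fun i : Fin l => f i.succ.succ).prod, fun g hg => ?_⟩
      rw [List.ofFn_succ, List.ofFn_succ, List.prod_cons, List.prod_cons, one_mul, mul_assoc]
      congr 4
      funext i
      apply hg
      · exact Fin.succ_ne_zero _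
      · intro h; exact Fin.succ_ne_zero _ (Fin.succ_injective _ h)
    | succ r =>
      induction r' using Fin.cases with
      | zero => simp at hr
      | succ r' =>
        obtain ⟨A, B, h⟩ := ih (fun i => f i.succ) (r := r) (r' := r') (by simpa using hr)
        refine ⟨f 0 * A, B, fun g hg => ?_⟩
        rw [List.ofFn_succ, List.prod_cons, h (fun i => g i.succ), hg 0]
        · simp only [mul_assoc]
        · exact (Fin.succ_ne_zero _).symm
        · exact (Fin.succ_ne_zero _).symm
        · intro i h1 h2
          exact hg _ (fun h => h1 (Fin.succ_injective _ h)) (fun h => h2 (Fin.succ_injective _ h))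

variable {K : Type} [Field K] {q : K} {E : Type} [Ring E] [Algebra K E] {u v w l : ℕ}

/-- The quantum minor of an arbitrary matrix `x`, with row list `R` and column list `C`. -/
def qdet (q : K) (x : Fin u → Fin v → E) (R : Fin l → Fin u) (C : Fin l → Fin v) : E :=
  ∑ σ : Equiv.Perm (Fin l), ((-q) ^ invCount σ) • (List.ofFn fun i => x (R i) (C (σ i))).prod

theorem qMinor_eq_qdet (R : Fin l → Fin u) (C : Fin l → Fin v) :
    qMinor K q R C = qdet q (fun i j => Xg K q i j) R C := rfl

theorem map_qdet {E' : Type} [Ring E'] [Algebra K E'] (f : E →ₐ[K] E')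
    (x : Fin u → Fin v → E) (R : Fin l → Fin u) (C : Fin l → Fin v) :
    f (qdet q x R C) = qdet q (fun i j => f (x i j)) R C := by
  simp only [qdet, map_sum, map_smul, map_list_prod, List.map_ofFn, Function.comp_def]

theorem qdet_eq_zero_of_adjacent {x : Fin u → Fin v → E} (hx : IsQMat q x) {R : Fin l → Fin u}
    {C : Fin l → Fin v} (hC : StrictMono C) {r r' : Fin l} (hr : r'.val = r.val + 1)
    (h : R r = R r') : qdet q x R C = 0 := by
  classical
  have hne : r ≠ r' := by rintro rfl; omega
  have hpair : ∀ σ : Equiv.Perm (Fin l), σ r < σ r' →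
      ((-q) ^ invCount σ) • (List.ofFn fun i => x (R i) (C (σ i))).prod +
      ((-q) ^ invCount (σ * Equiv.swap r r')) •
        (List.ofFn fun i => x (R i) (C ((σ * Equiv.swap r r') i))).prod = 0 := by
    intro σ hσ
    obtain ⟨A, B, hAB⟩ := prod_ofFn_adjacent (fun i => x (R i) (C (σ i))) hr
    rw [hAB _ (fun _ _ _ => rfl), hAB _ (fun i h1 h2 => by
      rw [Equiv.Perm.mul_apply, Equiv.swap_apply_of_ne_of_ne h1 h2]), invCount_mul_swap σ hr hσ]
    simp only [Equiv.Perm.mul_apply, Equiv.swap_apply_left, Equiv.swap_apply_right, h]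
    rw [hx.row (hC hσ), pow_succ]
    simp only [mul_smul_comm, smul_mul_assoc, smul_smul]
    rw [← add_smul]
    simp
  refine Finset.sum_involution (fun σ _ => σ * Equiv.swap r r') ?_ ?_ (by simp) ?_
  · intro σ _
    rcases lt_or_gt_of_ne (σ.injective.ne hne) with h1 | h1
    · exact hpair σ h1
    · have := hpair (σ * Equiv.swap r r') (by simpa using h1)
      rw [mul_assoc, Equiv.swap_mul_self, mul_one] at this
      rw [add_comm]; exact this
  · intro σ _ _ h2
    have := congrArg (fun τ : Equiv.Perm (Fin l) => τ r) h2
    simp only [Equiv.Perm.mul_apply, Equiv.swap_apply_left] at this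
    exact hne (σ.injective this.symm)
  · intro σ _; rw [mul_assoc, Equiv.swap_mul_self, mul_one]

theorem qdet_swap (hq : q ≠ 0) {x : Fin u → Fin v → E} (hx : IsQMat q x) {R : Fin l → Fin u}
    {C : Fin l → Fin v} (hC : StrictMono C) {r r' : Fin l} (hr : r'.val = r.val + 1)
    (h : R r < R r') : qdet q x (R ∘ Equiv.swap r r') C = (-q) • qdet q x R C := by
  classical
  have hne : r ≠ r' := by rintro rfl; omega
  have hpair : ∀ σ : Equiv.Perm (Fin l), σ r < σ r' →
      (((-q) ^ invCount σ) •
          (List.ofFn fun i => x ((R ∘ Equiv.swap r r') i) (C (σ i))).prod -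
        (-q) • (((-q) ^ invCount σ) • (List.ofFn fun i => x (R i) (C (σ i))).prod)) +
      (((-q) ^ invCount (σ * Equiv.swap r r')) •
          (List.ofFn fun i => x ((R ∘ Equiv.swap r r') i) (C ((σ * Equiv.swap r r') i))).prod -
        (-q) • (((-q) ^ invCount (σ * Equiv.swap r r')) •
          (List.ofFn fun i => x (R i) (C ((σ * Equiv.swap r r') i))).prod)) = 0 := by
    intro σ hσ
    obtain ⟨A, B, hAB⟩ := prod_ofFn_adjacent (fun i => x (R i) (C (σ i))) hr
    have hsw : ∀ i, i ≠ r → i ≠ r' → Equiv.swap r r' i = i := fun i h1 h2 =>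
      Equiv.swap_apply_of_ne_of_ne h1 h2
    rw [hAB _ (fun _ _ _ => rfl), hAB _ (fun i h1 h2 => by
      rw [Function.comp_apply, hsw i h1 h2]), hAB _ (fun i h1 h2 => by
      rw [Function.comp_apply, Equiv.Perm.mul_apply, hsw i h1 h2]), hAB _ (fun i h1 h2 => by
      rw [Equiv.Perm.mul_apply, hsw i h1 h2]), invCount_mul_swap σ hr hσ]
    simp only [Equiv.Perm.mul_apply, Equiv.swap_apply_left, Equiv.swap_apply_right,
      Function.comp_apply]
    rw [hx.quantum h (hC hσ), hx.comm h (hC hσ), pow_succ]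
    simp only [mul_add, add_mul, mul_smul_comm, smul_mul_assoc, smul_smul, smul_add]
    match_scalars <;> field_simp <;> ring
  rw [← sub_eq_zero, qdet, qdet, Finset.smul_sum, ← Finset.sum_sub_distrib]
  refine Finset.sum_involution (fun σ _ => σ * Equiv.swap r r') ?_ ?_ (by simp) ?_
  · intro σ _
    rcases lt_or_gt_of_ne (σ.injective.ne hne) with h1 | h1
    · exact hpair σ h1
    · have := hpair (σ * Equiv.swap r r') (by simpa using h1)
      rw [mul_assoc, Equiv.swap_mul_self, mul_one] at this
      rw [add_comm]; exact this
  · intro σ _ _ h2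
    have := congrArg (fun τ : Equiv.Perm (Fin l) => τ r) h2
    simp only [Equiv.Perm.mul_apply, Equiv.swap_apply_left] at this
    exact hne (σ.injective this.symm)
  · intro σ _; rw [mul_assoc, Equiv.swap_mul_self, mul_one]

theorem qdet_eq_zero_of_eq (hq : q ≠ 0) {x : Fin u → Fin v → E} (hx : IsQMat q x)
    {C : Fin l → Fin v} (hC : StrictMono C) (d : ℕ) :
    ∀ (R : Fin l → Fin u) (a b : Fin l), b.val = a.val + d + 1 → R a = R b →
      qdet q x R C = 0 := by
  induction d with
  | zero => intro R a b hab h; exact qdet_eq_zero_of_adjacent hx hC (by omega) h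
  | succ d ih =>
    intro R a b hab h
    let c : Fin l := ⟨a.val + d + 1, by omega⟩
    have hcb : b.val = c.val + 1 := by simp only [c]; omega
    have hac : a ≠ c := by intro h; have := congrArg Fin.val h; simp only [c] at this; omega
    have hab' : a ≠ b := by rintro rfl; omega
    have h0 : qdet q x (R ∘ Equiv.swap c b) C = 0 := by
      apply ih _ a c (by simp only [c])
      simp [Equiv.swap_apply_of_ne_of_ne hac hab', h]
    rcases lt_trichotomy (R c) (R b) with hlt | heq | hlt
    · rw [qdet_swap hq hx hC hcb hlt] at h0
      exact (smul_eq_zero.1 h0).resolve_left (neg_ne_zero.2 hq)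
    · exact qdet_eq_zero_of_adjacent hx hC hcb heq
    · have := qdet_swap hq hx hC (R := R ∘ Equiv.swap c b) hcb (by simpa using hlt)
      rw [h0, smul_zero] at this
      convert this using 2
      funext i; simp

theorem qdet_eq_zero_of_not_injective (hq : q ≠ 0) {x : Fin u → Fin v → E} (hx : IsQMat q x)
    {R : Fin l → Fin u} {C : Fin l → Fin v} (hC : StrictMono C) (hR : ¬ Function.Injective R) :
    qdet q x R C = 0 := by
  simp only [Function.Injective, not_forall] at hR
  obtain ⟨a, b, h, hne⟩ := hR
  rcases lt_or_gt_of_ne hne with h1 | h1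
  · exact qdet_eq_zero_of_eq hq hx hC (b.val - a.val - 1) R a b (by omega) h
  · exact qdet_eq_zero_of_eq hq hx hC (a.val - b.val - 1) R b a (by omega) h.symm

theorem perm_eq_one_of_strictMono {σ : Equiv.Perm (Fin l)} (h : StrictMono σ) : σ = 1 := by
  have := (StrictMono.range_inj h strictMono_id).1 (by simp [σ.surjective.range_eq])
  ext i
  simp [this]

theorem exists_descent {σ : Equiv.Perm (Fin l)} (h : σ ≠ 1) :
    ∃ r r' : Fin l, r'.val = r.val + 1 ∧ σ r' < σ r := by
  by_contra hc
  push Not at hc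
  apply h
  apply perm_eq_one_of_strictMono
  cases l with
  | zero => intro a; exact a.elim0
  | succ l =>
    rw [Fin.strictMono_iff_lt_succ]
    intro i
    refine lt_of_le_of_ne (hc i.castSucc i.succ (by simp)) (σ.injective.ne ?_)
    exact (Fin.castSucc_lt_succ).ne

theorem qdet_perm (hq : q ≠ 0) {x : Fin l → Fin v → E} (hx : IsQMat q x)
    {C : Fin l → Fin v} (hC : StrictMono C) (σ : Equiv.Perm (Fin l)) :
    qdet q x σ C = (-q) ^ invCount σ • qdet q x id C := by
  classical
  induction hN : invCount σ using Nat.strong_induction_on generalizing σ with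
  | _ N ih =>
    by_cases h1 : σ = 1
    · subst h1
      have : invCount (1 : Equiv.Perm (Fin l)) = 0 := by
        rw [invCount, Finset.card_eq_zero, Finset.filter_eq_empty_iff]
        rintro ⟨a, b⟩ - ⟨h, h'⟩
        exact absurd h (not_lt.2 (le_of_lt h'))
      rw [← hN, this, pow_zero, one_smul]
      rfl
    · obtain ⟨r, r', hr, hd⟩ := exists_descent h1
      set τ := σ * Equiv.swap r r' with hτ
      have hστ : σ = τ * Equiv.swap r r' := by
        rw [hτ, mul_assoc, Equiv.swap_mul_self, mul_one]
      have hlt : τ r < τ r' := by simpa [hτ] using hd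
      have hinv := invCount_mul_swap τ hr hlt
      rw [← hστ] at hinv
      have := qdet_swap hq hx hC (R := τ) hr hlt
      rw [ih (invCount τ) (by omega) τ rfl, smul_smul, ← pow_succ', ← hinv, hN] at this
      rw [← this]
      congr 1
      rw [hστ]; rfl

theorem prod_ofFn_mul {M : Type} [Monoid M] {l : ℕ} (f g : Fin l → M)
    (h : ∀ i j, Commute (f i) (g j)) :
    (List.ofFn fun i => f i * g i).prod = (List.ofFn f).prod * (List.ofFn g).prod := by
  induction l with
  | zero => simp
  | succ l ih =>
    simp only [List.ofFn_succ, List.prod_cons]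
    rw [ih _ _ fun i j => h _ _]
    have : Commute (List.ofFn fun i => f i.succ).prod (g 0) := by
      apply Commute.symm
      apply Commute.list_prod_right
      intro y hy
      obtain ⟨i, rfl⟩ := List.mem_ofFn.1 hy
      exact (h _ _).symm
    rw [mul_assoc, mul_assoc, ← mul_assoc (g 0), ← this.eq, mul_assoc]

theorem prod_ofFn_sum {l p : ℕ} (f : Fin l → Fin p → E) :
    (List.ofFn fun i => ∑ k, f i k).prod =
      ∑ κ : Fin l → Fin p, (List.ofFn fun i => f i (κ i)).prod := by
  induction l with
  | zero => simp
  | succ l ih =>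
    rw [List.ofFn_succ, List.prod_cons, ih, Finset.sum_mul_sum, ← Finset.sum_product',
      ← (Fin.consEquiv fun _ => Fin p).sum_comp]
    simp [List.ofFn_succ, Fin.consEquiv]

theorem qdet_matMul {x : Fin u → Fin v → E} {z : Fin v → Fin w → E}
    (hc : ∀ i k l j, Commute (x i k) (z l j)) (R : Fin l → Fin u) (C : Fin l → Fin w) :
    qdet q (fun i j => ∑ k, x i k * z k j) R C =
      ∑ κ : Fin l → Fin v, (List.ofFn fun i => x (R i) (κ i)).prod * qdet q z κ C := by
  simp only [qdet, prod_ofFn_sum, Finset.smul_sum, Finset.mul_sum]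
  rw [Finset.sum_comm]
  refine Finset.sum_congr rfl fun κ _ => Finset.sum_congr rfl fun σ _ => ?_
  rw [prod_ofFn_mul _ _ fun i j => hc _ _ _ _, mul_smul_comm]

theorem qdet_matMul_square (hq : q ≠ 0) {x : Fin u → Fin l → E} {z : Fin l → Fin w → E}
    (hz : IsQMat q z)
    (hc : ∀ i k l j, Commute (x i k) (z l j)) (R : Fin l → Fin u) {C : Fin l → Fin w}
    (hC : StrictMono C) :
    qdet q (fun i j => ∑ k, x i k * z k j) R C = qdet q x R id * qdet q z id C := by
  classical
  rw [qdet_matMul hc]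
  have : ∀ κ : Fin l → Fin l, κ ∉ Set.range (fun σ : Equiv.Perm (Fin l) => (σ : Fin l → Fin l)) →
      (List.ofFn fun i => x (R i) (κ i)).prod * qdet q z κ C = 0 := by
    intro κ hκ
    rw [qdet_eq_zero_of_not_injective hq hz hC, mul_zero]
    intro hinj
    exact hκ ⟨Equiv.ofBijective κ (Finite.injective_iff_bijective.1 hinj), rfl⟩
  symm
  rw [qdet, Finset.sum_mul]
  refine Finset.sum_of_injOn (fun σ : Equiv.Perm (Fin l) => (σ : Fin l → Fin l))
    (DFunLike.coe_injective.injOn) (by simp) (fun κ _ h => this κ (by simpa using h)) ?_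
  intro σ _
  rw [qdet_perm hq hz hC, mul_smul_comm, smul_mul_assoc]
  rfl

end QDet

section Laplace

theorem invCount_eq_sum {l : ℕ} (σ : Equiv.Perm (Fin l)) :
    invCount σ = ∑ i, ∑ j, if i < j ∧ σ j < σ i then 1 else 0 := by
  rw [invCount, Finset.card_filter, ← Finset.univ_product_univ, Finset.sum_product]

/-- The permutation of `Fin (l + 1)` sending `0` to `c` and acting as `τ` on the rest. -/
def permCons {l : ℕ} (p : Fin (l + 1) × Equiv.Perm (Fin l)) : Equiv.Perm (Fin (l + 1)) :=
  p.1.cycleRange.symm * Equiv.Perm.decomposeFin.symm (0, p.2)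

@[simp] theorem permCons_zero {l : ℕ} (p : Fin (l + 1) × Equiv.Perm (Fin l)) :
    permCons p 0 = p.1 := by
  simp [permCons]

@[simp] theorem permCons_succ {l : ℕ} (p : Fin (l + 1) × Equiv.Perm (Fin l)) (i : Fin l) :
    permCons p i.succ = p.1.succAbove (p.2 i) := by
  simp [permCons]

theorem permCons_bijective (l : ℕ) :
    Function.Bijective (permCons : Fin (l + 1) × Equiv.Perm (Fin l) → _) := by
  rw [Fintype.bijective_iff_injective_and_card]
  constructor
  · rintro ⟨c, τ⟩ ⟨c', τ'⟩ h
    obtain rfl : c = c' := by simpa using DFunLike.congr_fun h 0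
    congr 1
    ext1 i
    have := DFunLike.congr_fun h i.succ
    simpa using this
  · simp [Fintype.card_perm, Nat.factorial_succ]

theorem invCount_permCons {l : ℕ} (c : Fin (l + 1)) (τ : Equiv.Perm (Fin l)) :
    invCount (permCons (c, τ)) = c.val + invCount τ := by
  rw [invCount_eq_sum, Fin.sum_univ_succ, Fin.sum_univ_succ, invCount_eq_sum]
  simp only [Fin.sum_univ_succ (n := l), permCons_zero, permCons_succ, Fin.succ_pos, true_and,
    lt_irrefl, false_and, if_false, zero_add, Fin.succ_lt_succ_iff, Fin.not_lt_zero,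
    Fin.succAbove_lt_succAbove_iff, Fin.succAbove_lt_iff_castSucc_lt]
  congr 1
  rw [Equiv.sum_comp τ (fun j => if j.castSucc < c then 1 else 0), ← Finset.card_filter]
  have : (Finset.univ.filter fun j : Fin l => j.castSucc < c).map
      ⟨Fin.val, Fin.val_injective⟩ = Finset.range c.val := by
    ext a
    simp only [Finset.mem_map, Finset.mem_filter, Finset.mem_univ, true_and, Finset.mem_range,
      Function.Embedding.coeFn_mk, Fin.lt_def, Fin.val_castSucc]
    constructor
    · rintro ⟨j, h, rfl⟩; exact h
    · intro h; exact ⟨⟨a, by omega⟩, h, rfl⟩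
  rw [← Finset.card_map, this, Finset.card_range]

variable {K : Type} [Field K] {q : K} {E : Type} [Ring E] [Algebra K E] {u v w l : ℕ}

theorem qdet_succ (x : Fin u → Fin v → E) (R : Fin (l + 1) → Fin u) (C : Fin (l + 1) → Fin v) :
    qdet q x R C = ∑ c : Fin (l + 1), (-q) ^ c.val •
      (x (R 0) (C c) * qdet q x (R ∘ Fin.succ) (C ∘ c.succAbove)) := by
  rw [qdet, ← (permCons_bijective l).sum_comp, Fintype.sum_prod_type]
  refine Finset.sum_congr rfl fun c _ => ?_
  rw [qdet, Finset.mul_sum, Finset.smul_sum]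
  refine Finset.sum_congr rfl fun τ _ => ?_
  rw [invCount_permCons, List.ofFn_succ, List.prod_cons, pow_add, mul_smul, mul_smul_comm]
  simp

theorem mkle_qMinor_eq_zero {m n t : ℕ} (d : ℕ) (R : Fin (t + 1 + d) → Fin m)
    (C : Fin (t + 1 + d) → Fin n) (hR : StrictMono R) (hC : StrictMono C) :
    mkle K q m n t (qMinor K q R C) = 0 := by
  induction d with
  | zero => simpa [mkle] using RingQuot.mkAlgHom_rel K (DetRel.minor (K := K) (q := q) R C hR hC)
  | succ d ih =>
    rw [qMinor_eq_qdet, qdet_succ (l := t + 1 + d), map_sum]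
    refine Finset.sum_eq_zero fun c _ => ?_
    rw [map_smul, map_mul, ← qMinor_eq_qdet, ih, mul_zero, smul_zero]
    · exact hR.comp (Fin.strictMono_succ)
    · exact hC.comp (Fin.strictMono_succAbove c)

end Laplace

section Lead

variable {K : Type} [Field K] {ι : Type}

/-- The weighted shift operator `e_a ↦ q ^ (L a) e_{a + v}` on the span of Laurent monomials. -/
def shiftOp (q : K) (v : ι → ℤ) (L : (ι → ℤ) →+ ℤ) : Module.End K ((ι → ℤ) →₀ K) :=
  Finsupp.lsum K fun a => (q ^ L a) • Finsupp.lsingle (a + v)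

@[simp] theorem shiftOp_single (q : K) (v : ι → ℤ) (L : (ι → ℤ) →+ ℤ) (a : ι → ℤ) (c : K) :
    shiftOp q v L (Finsupp.single a c) = Finsupp.single (a + v) (q ^ L a * c) := by
  simp [shiftOp]

theorem shiftOp_mul {q : K} (hq : q ≠ 0) (v v' : ι → ℤ) (L L' : (ι → ℤ) →+ ℤ) :
    shiftOp q v L * shiftOp q v' L' =
      q ^ (L v' - L' v) • (shiftOp q v' L' * shiftOp q v L) := by
  apply Finsupp.lhom_ext
  intro a c
  simp only [Module.End.mul_apply, LinearMap.smul_apply, shiftOp_single, map_add,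
    Finsupp.smul_single, smul_eq_mul]
  rw [add_right_comm a v' v, zpow_add₀ hq, zpow_add₀ hq, zpow_sub₀ hq]
  congr 1
  have := zpow_ne_zero (L' v) hq
  field_simp

/-- The span of the Laurent monomials of weight less than `c`. -/
abbrev filtLT (K : Type) [Field K] {ι : Type} (wt : (ι → ℤ) →+ ℤ) (c : ℤ) :
    Submodule K ((ι → ℤ) →₀ K) :=
  Finsupp.supported K K {a | wt a < c}

/-- The operator `φ` raises weights by less than `w`. -/
def IsLower (wt : (ι → ℤ) →+ ℤ) (φ : Module.End K ((ι → ℤ) →₀ K)) (w : ℤ) : Prop :=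
  ∀ a, φ (Finsupp.single a 1) ∈ filtLT K wt (wt a + w)

/-- Up to terms of lower weight, the operator `φ` multiplies monomials by the monomial with
exponent `v` and a nonzero scalar. -/
def IsLead (wt : (ι → ℤ) →+ ℤ) (φ : Module.End K ((ι → ℤ) →₀ K)) (v : ι → ℤ) : Prop :=
  ∀ a, ∃ c : K, c ≠ 0 ∧
    φ (Finsupp.single a 1) - Finsupp.single (a + v) c ∈ filtLT K wt (wt a + wt v)

variable {wt : (ι → ℤ) →+ ℤ} {φ ψ : Module.End K ((ι → ℤ) →₀ K)} {v v' : ι → ℤ} {w w' : ℤ}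

theorem filtLT_mono {c c' : ℤ} (h : c ≤ c') : filtLT K wt c ≤ filtLT K wt c' :=
  Finsupp.supported_mono fun _ ha => lt_of_lt_of_le ha h

theorem IsLower.mono (h : IsLower wt φ w) (hw : w ≤ w') : IsLower wt φ w' := fun a =>
  filtLT_mono (by omega) (h a)

theorem IsLower.zero : IsLower wt (0 : Module.End K ((ι → ℤ) →₀ K)) w := fun a => by
  simp

theorem IsLower.sum {α : Type} (s : Finset α) {f : α → Module.End K ((ι → ℤ) →₀ K)}
    (h : ∀ i ∈ s, IsLower wt (f i) w) : IsLower wt (∑ i ∈ s, f i) w := fun a => by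
  rw [LinearMap.sum_apply]
  exact sum_mem fun i hi => h i hi a

theorem IsLower.apply (h : IsLower wt φ w) {c : ℤ} {f : (ι → ℤ) →₀ K} (hf : f ∈ filtLT K wt c) :
    φ f ∈ filtLT K wt (c - 1 + w) := by
  rw [← Finsupp.sum_single f, Finsupp.sum, map_sum]
  refine sum_mem fun a ha => ?_
  have h1 : Finsupp.single a (f a) = f a • Finsupp.single a (1 : K) := by simp
  have h2 : wt a < c := (Finsupp.mem_supported _ _).1 hf ha
  rw [h1, map_smul]
  exact Submodule.smul_mem _ _ (filtLT_mono (by omega) (h a))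

theorem IsLower.mul (h : IsLower wt φ (w + 1)) (h' : IsLower wt ψ w') :
    IsLower wt (φ * ψ) (w + w') := fun a => by
  have := h.apply (h' a)
  exact filtLT_mono (by omega) this

theorem IsLead.lower (h : IsLead wt φ v) : IsLower wt φ (wt v + 1) := fun a => by
  obtain ⟨c, -, h⟩ := h a
  have := add_mem (filtLT_mono (c' := wt a + (wt v + 1)) (by omega) h)
    (Finsupp.single_mem_supported K c
      (show wt (a + v) < wt a + (wt v + 1) by rw [map_add]; omega))
  simpa using this

theorem IsLead.mul (h : IsLead wt φ v) (h' : IsLead wt ψ v') : IsLead wt (φ * ψ) (v + v') :=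
  fun a => by
  obtain ⟨c, hc, hf⟩ := h' a
  obtain ⟨d, hd, hg⟩ := h (a + v')
  refine ⟨c * d, mul_ne_zero hc hd, ?_⟩
  have h1 := add_mem (filtLT_mono (c' := wt a + wt (v + v')) (by rw [map_add]; omega)
    (h.lower.apply hf)) (Submodule.smul_mem (filtLT K wt (wt a + wt (v + v'))) c
      (filtLT_mono (by rw [map_add, map_add]; omega) hg))
  convert h1 using 1
  rw [map_sub, smul_sub, ← map_smul, Finsupp.smul_single, smul_eq_mul, mul_one,
    Finsupp.smul_single, smul_eq_mul, add_assoc, add_comm v' v, Module.End.mul_apply]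
  abel

theorem IsLead.add_lower (h : IsLead wt φ v) (h' : IsLower wt ψ (wt v)) :
    IsLead wt (φ + ψ) v := fun a => by
  obtain ⟨c, hc, hf⟩ := h a
  refine ⟨c, hc, ?_⟩
  convert add_mem hf (h' a) using 1
  rw [LinearMap.add_apply]
  abel

theorem IsLead.smul (h : IsLead wt φ v) {d : K} (hd : d ≠ 0) : IsLead wt (d • φ) v := fun a => by
  obtain ⟨c, hc, hf⟩ := h a
  refine ⟨d * c, mul_ne_zero hd hc, ?_⟩
  convert Submodule.smul_mem _ d hf using 1
  simp [smul_sub]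

theorem IsLead.one : IsLead wt (1 : Module.End K ((ι → ℤ) →₀ K)) 0 := fun a =>
  ⟨1, one_ne_zero, by simp⟩

theorem isLead_shiftOp {q : K} (hq : q ≠ 0) (v : ι → ℤ) (L : (ι → ℤ) →+ ℤ) :
    IsLead wt (shiftOp q v L) v := fun a =>
  ⟨q ^ L a, zpow_ne_zero _ hq, by simp⟩

theorem IsLead.sum {α : Type} [DecidableEq α] (s : Finset α)
    {f : α → Module.End K ((ι → ℤ) →₀ K)} {i : α} (hi : i ∈ s) (h : IsLead wt (f i) v)
    (h' : ∀ j ∈ s, j ≠ i → IsLower wt (f j) (wt v)) : IsLead wt (∑ j ∈ s, f j) v := by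
  rw [← Finset.add_sum_erase s f hi]
  exact h.add_lower (IsLower.sum _ fun j hj => h' j (Finset.mem_of_mem_erase hj)
    (Finset.ne_of_mem_erase hj))

theorem IsLead.prod_ofFn {l : ℕ} {f : Fin l → Module.End K ((ι → ℤ) →₀ K)} {v : Fin l → ι → ℤ}
    (h : ∀ i, IsLead wt (f i) (v i)) : IsLead wt (List.ofFn f).prod (∑ i, v i) := by
  induction l with
  | zero => simpa using IsLead.one
  | succ l ih =>
    rw [List.ofFn_succ, List.prod_cons, Fin.sum_univ_succ]
    exact (h 0).mul (ih fun i => h _)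

theorem IsLead.pow (h : IsLead wt φ v) (s : ℕ) : IsLead wt (φ ^ s) (s • v) := by
  induction s with
  | zero => simpa using IsLead.one
  | succ s ih => rw [pow_succ, succ_nsmul]; exact ih.mul h

theorem IsLead.apply_zero (h : IsLead wt φ v) : ∃ c : K, c ≠ 0 ∧
    φ (Finsupp.single 0 1) - Finsupp.single v c ∈ filtLT K wt (wt v) := by
  simpa using h 0

/-- A combination of vectors with pairwise distinct leading monomials: its top part is the
combination of the leading terms. -/
theorem triangular_support {α : Type} (s : Finset α) {g : α → (ι → ℤ) →₀ K} {v : α → ι → ℤ}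
    {κ : α → K} (hκ : ∀ j ∈ s, κ j ≠ 0) (hv : Set.InjOn v s)
    (hg : ∀ j ∈ s, g j - Finsupp.single (v j) (κ j) ∈ filtLT K wt (wt (v j)))
    {β : α → K} (hβ : ∀ j ∈ s, β j ≠ 0) (hs : s.Nonempty) :
    ∃ j ∈ s, (∑ j ∈ s, β j • g j) (v j) ≠ 0 ∧
      ∀ a, (∑ j ∈ s, β j • g j) a ≠ 0 → wt a ≤ wt (v j) ∧
        (wt a = wt (v j) → ∃ i ∈ s, a = v i) := by
  classical
  obtain ⟨j₀, hj₀, hmax⟩ := s.exists_max_image (fun j => wt (v j)) hs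
  have hval : ∀ j ∈ s, ∀ a, wt (v j) ≤ wt a → g j a = if v j = a then κ j else 0 := by
    intro j hj a ha
    have h0 : (g j - Finsupp.single (v j) (κ j)) a = 0 := by
      by_contra hne
      have := (Finsupp.mem_supported _ _).1 (hg j hj) (Finsupp.mem_support_iff.2 hne)
      exact absurd this (not_lt.2 ha)
    rw [Finsupp.sub_apply, sub_eq_zero, Finsupp.single_apply] at h0
    exact h0
  refine ⟨j₀, hj₀, ?_, fun a ha => ?_⟩
  · rw [Finsupp.finsetSum_apply, Finset.sum_eq_single j₀]
    · rw [Finsupp.smul_apply, hval j₀ hj₀ _ le_rfl, if_pos rfl]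
      exact mul_ne_zero (hβ _ hj₀) (hκ _ hj₀)
    · intro j hj hne
      rw [Finsupp.smul_apply, hval j hj _ (hmax j hj), if_neg (fun h => hne (hv hj hj₀ h)),
        smul_zero]
    · exact fun h => absurd hj₀ h
  · by_contra hc
    apply ha
    rw [Finsupp.finsetSum_apply]
    refine Finset.sum_eq_zero fun j hj => ?_
    rw [Finsupp.smul_apply]
    have hle := hmax j hj
    rcases lt_trichotomy (wt a) (wt (v j₀)) with h | h | h
    · exact absurd ⟨h.le, fun h' => absurd h' h.ne⟩ hc
    · rw [hval j hj a (by omega), if_neg, smul_zero]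
      intro h'
      exact hc ⟨h.le, fun _ => ⟨j, hj, h'.symm⟩⟩
    · rw [hval j hj a (by omega), if_neg, smul_zero]
      intro h'; subst h'; omega

theorem triangular_linearIndependent {α : Type} {g : α → (ι → ℤ) →₀ K} {v : α → ι → ℤ}
    (hv : Function.Injective v) (hg : ∀ j, ∃ c : K, c ≠ 0 ∧
      g j - Finsupp.single (v j) c ∈ filtLT K wt (wt (v j))) : LinearIndependent K g := by
  classical
  choose κ hκ hg using hg
  rw [linearIndependent_iff']
  intro s β h
  by_contra hc
  push Not at hc
  obtain ⟨i, hi, hne⟩ := hc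
  obtain ⟨j, hj, h1, -⟩ := triangular_support (wt := wt) (s.filter fun j => β j ≠ 0)
    (fun j _ => hκ j) hv.injOn (fun j _ => hg j) (β := β)
    (fun j hj => (Finset.mem_filter.1 hj).2) ⟨i, Finset.mem_filter.2 ⟨hi, hne⟩⟩
  apply h1
  rw [Finset.sum_filter_of_ne, h]
  · rfl
  · intro j _ hj h0; exact hj (by rw [h0, zero_smul])

end Lead

section TorusRow

variable {K : Type} [Field K] {q : K} {E : Type} [Ring E] [Algebra K E] {t : ℕ}

/-- Elements `y_k`, `u_l` of a quantum torus from which the factor `(u_l y_j)_{j ≤ l}` of a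
quantum matrix and a further row `y` are built. -/
structure IsTorusRow (q : K) (y u : Fin t → E) : Prop where
  yy : ∀ {j k}, j < k → y j * y k = q • (y k * y j)
  uu : ∀ {j k}, j < k → u j * u k = q • (u k * u j)
  uy : ∀ {l j}, j ≤ l → y j * u l = q⁻¹ • (u l * y j)
  uy' : ∀ {l j}, l < j → y j * u l = q • (u l * y j)

/-- The lower triangular quantum matrix attached to a torus row. -/
def torMat (y u : Fin t → E) (l j : Fin t) : E := if j ≤ l then u l * y j else 0

variable {y u : Fin t → E}

theorem quad_of {a b c d : E} {e : K} (h : b * c = e • (c * b)) :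
    (a * b) * (c * d) = e • (a * c * (b * d)) := by
  rw [mul_assoc, ← mul_assoc b, h]
  simp only [mul_smul_comm, smul_mul_assoc, mul_assoc]

theorem quad_swap {a b c d : E} {e e' : K} (h : c * a = e • (a * c)) (h' : d * b = e' • (b * d)) :
    c * a * (d * b) = (e * e') • (a * c * (b * d)) := by
  rw [h, h', smul_mul_smul_comm]

theorem torMat_isQMat (hq : q ≠ 0) (h : IsTorusRow q y u) : IsQMat q (torMat y u) := by
  have yy' : ∀ {j k}, j < k → y k * y j = q⁻¹ • (y j * y k) := fun hjk => by
    rw [h.yy hjk, smul_smul, inv_mul_cancel₀ hq, one_smul]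
  have uu' : ∀ {j k}, j < k → u k * u j = q⁻¹ • (u j * u k) := fun hjk => by
    rw [h.uu hjk, smul_smul, inv_mul_cancel₀ hq, one_smul]
  have one' : ∀ a b : E, a * b = (1 : K) • (a * b) := fun a b => (one_smul _ _).symm
  refine ⟨?_, ?_, ?_, ?_⟩
  · intro i j k hjk
    by_cases hk : k ≤ i
    · have hj : j ≤ i := hjk.le.trans hk
      simp only [torMat, if_pos hk, if_pos hj]
      rw [quad_of (h.uy hj), quad_of (h.uy hk), h.yy hjk]
      simp only [mul_smul_comm, smul_smul, mul_comm]
    · simp only [torMat, if_neg hk, mul_zero, zero_mul, smul_zero]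
  · intro i k j hik
    by_cases hi : j ≤ i
    · have hk : j ≤ k := hi.trans hik.le
      simp only [torMat, if_pos hk, if_pos hi]
      rw [quad_of (h.uy hk), quad_of (h.uy hi), h.uu hik]
      simp only [smul_mul_assoc, smul_smul, mul_comm]
    · simp only [torMat, if_neg hi, mul_zero, zero_mul, smul_zero]
  · intro i k j l hik hlj
    by_cases hj : j ≤ i
    · have hl : l ≤ k := hlj.le.trans (hj.trans hik.le)
      simp only [torMat, if_pos hj, if_pos hl]
      rw [quad_of (h.uy (hj.trans hik.le)), quad_of (h.uy (hlj.le.trans hj)),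
        quad_swap (uu' hik) (h.yy hlj)]
      rw [inv_mul_cancel₀ hq, one_smul]
    · simp only [torMat, if_neg hj, mul_zero, zero_mul]
  · intro i k j l hik hjl
    by_cases hj : j ≤ i
    · by_cases hl : l ≤ k
      · have hjk := hj.trans hik.le
        by_cases hli : l ≤ i
        · simp only [torMat, if_pos hj, if_pos hl, if_pos hli, if_pos hjk]
          rw [quad_of (h.uy hjk), quad_of (h.uy hli),
            quad_of (h.uy hl), quad_swap (uu' hik) (yy' hjl), yy' hjl]
          simp only [mul_smul_comm, smul_smul, ← add_smul]
          congr 1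
          field_simp
          ring
        · simp only [torMat, if_pos hj, if_pos hl, if_neg hli, if_pos hjk]
          rw [quad_of (h.uy hjk), quad_of (h.uy' (not_le.1 hli)),
            quad_swap (uu' hik) (yy' hjl)]
          simp only [zero_mul, smul_zero, add_zero, smul_smul]
          congr 1
          field_simp
      · have hli : ¬ l ≤ i := fun h' => hl (h'.trans hik.le)
        simp only [torMat, if_neg hl, if_neg hli, mul_zero, zero_mul, smul_zero, add_zero]
    · have hli : ¬ l ≤ i := fun h' => hj (hjl.le.trans h')
      simp only [torMat, if_neg hj, if_neg hli, mul_zero, zero_mul, smul_zero, add_zero]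

/-- Adding a last row to a quantum matrix multiplied by `torMat`. -/
theorem IsQMat.snoc_torMat (hq : q ≠ 0) (h : IsTorusRow q y u) {m : ℕ} {x : Fin m → Fin t → E}
    (hx : IsQMat q x) (hy : ∀ i k j, Commute (x i k) (y j)) (hu : ∀ i k j, Commute (x i k) (u j)) :
    IsQMat q (Fin.snoc (α := fun _ => Fin t → E) (fun i j => ∑ l, x i l * torMat y u l j) y :
      Fin (m + 1) → Fin t → E) := by
  have hM := hx.mul hq (torMat_isQMat hq h) (fun i k l j => by
    unfold torMat; split_ifs
    · exact (hu i k l).mul_right (hy i k j)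
    · exact Commute.zero_right _)
  have hcol : ∀ l j, torMat y u l j * y j = q • (y j * torMat y u l j) := by
    intro l j
    unfold torMat; split_ifs with hj
    · rw [← mul_assoc (y j), h.uy hj, smul_mul_assoc, smul_smul, mul_inv_cancel₀ hq, one_smul]
    · simp
  have hcomm : ∀ l {j j'}, j' < j → torMat y u l j * y j' = y j' * torMat y u l j := by
    intro l j j' hjj
    unfold torMat; split_ifs with hj
    · rw [← mul_assoc (y j'), h.uy (hjj.le.trans hj), smul_mul_assoc, mul_assoc, mul_assoc,
        h.yy hjj, mul_smul_comm, smul_smul, inv_mul_cancel₀ hq, one_smul]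
    · simp
  have hquant : ∀ l {j j'}, j < j' → torMat y u l j * y j' = y j' * torMat y u l j +
      (q - q⁻¹) • (torMat y u l j' * y j) := by
    intro l j j' hjj
    unfold torMat
    by_cases hj' : j' ≤ l
    · have hj := hjj.le.trans hj'
      rw [if_pos hj', if_pos hj, ← mul_assoc (y j'), h.uy hj', mul_assoc, h.yy hjj]
      simp only [smul_mul_assoc, mul_smul_comm, mul_assoc]
      module
    · by_cases hj : j ≤ l
      · rw [if_neg hj', if_pos hj, ← mul_assoc (y j'), h.uy' (not_le.1 hj'), mul_assoc, h.yy hjj]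
        simp only [smul_mul_assoc, mul_smul_comm, mul_assoc]
        simp
      · rw [if_neg hj', if_neg hj]; simp
  have e1 : ∀ i j j', (∑ l, x i l * torMat y u l j) * y j' =
      ∑ l, x i l * (torMat y u l j * y j') := by
    intro i j j'; rw [Finset.sum_mul]; simp only [mul_assoc]
  have e2 : ∀ i j j', y j' * (∑ l, x i l * torMat y u l j) =
      ∑ l, x i l * (y j' * torMat y u l j) := by
    intro i j j'; rw [Finset.mul_sum]
    refine Finset.sum_congr rfl fun l _ => ?_
    rw [← mul_assoc, ← (hy i l j').eq, mul_assoc]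
  refine ⟨?_, ?_, ?_, ?_⟩
  · intro i j k hjk
    induction i using Fin.lastCases with
    | last => simpa using h.yy hjk
    | cast i => simpa using hM.row hjk
  · intro i k j hik
    induction k using Fin.lastCases with
    | last =>
      induction i using Fin.lastCases with
      | last => exact absurd hik (lt_irrefl _)
      | cast i =>
        simp only [Fin.snoc_castSucc, Fin.snoc_last]
        rw [e1, e2, Finset.smul_sum]
        simp only [hcol, mul_smul_comm]
    | cast k =>
      induction i using Fin.lastCases with
      | last => exact absurd hik (not_lt.2 (Fin.castSucc_lt_last k).le)
      | cast i => simpa using hM.col (by simpa using hik)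
  · intro i k j l hik hlj
    induction k using Fin.lastCases with
    | last =>
      induction i using Fin.lastCases with
      | last => exact absurd hik (lt_irrefl _)
      | cast i =>
        simp only [Fin.snoc_castSucc, Fin.snoc_last]
        rw [e1, e2]
        simp only [hcomm _ hlj]
    | cast k =>
      induction i using Fin.lastCases with
      | last => exact absurd hik (not_lt.2 (Fin.castSucc_lt_last k).le)
      | cast i => simpa using hM.comm (by simpa using hik) hlj
  · intro i k j l hik hjl
    induction k using Fin.lastCases with
    | last =>
      induction i using Fin.lastCases with
      | last => exact absurd hik (lt_irrefl _)
      | cast i =>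
        simp only [Fin.snoc_castSucc, Fin.snoc_last]
        rw [e1, e2, e1, Finset.smul_sum, ← Finset.sum_add_distrib]
        refine Finset.sum_congr rfl fun p _ => ?_
        rw [hquant p hjl, mul_add, mul_smul_comm]
    | cast k =>
      induction i using Fin.lastCases with
      | last => exact absurd hik (not_lt.2 (Fin.castSucc_lt_last k).le)
      | cast i => simpa using hM.quantum (by simpa using hik) hjl

/-- The quantum matrix with entries in a quantum torus built from `m` torus rows. -/
def torX {t : ℕ} : (m : ℕ) → (Fin m → Fin t → E) → (Fin m → Fin t → E) → Fin m → Fin t → E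
  | 0, _, _ => Fin.elim0
  | m + 1, y, u => Fin.snoc (α := fun _ => Fin t → E)
      (fun i j => ∑ l, torX m (fun i => y i.castSucc) (fun i => u i.castSucc) i l *
        torMat (y (Fin.last m)) (u (Fin.last m)) l j) (y (Fin.last m))

theorem torX_commute {m : ℕ} {y u : Fin m → Fin t → E} {z : E} (hy : ∀ i j, Commute (y i j) z)
    (hu : ∀ i j, Commute (u i j) z) (i : Fin m) (j : Fin t) : Commute (torX m y u i j) z := by
  induction m generalizing j with
  | zero => exact i.elim0
  | succ m ih =>
    rw [torX]
    induction i using Fin.lastCases with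
    | last => simpa using hy _ _
    | cast i =>
      simp only [Fin.snoc_castSucc]
      refine Commute.sum_left _ _ _ fun l _ => Commute.mul_left (ih (fun _ _ => hy _ _)
        (fun _ _ => hu _ _) i l) ?_
      unfold torMat; split_ifs
      · exact (hu _ _).mul_left (hy _ _)
      · exact Commute.zero_left _

theorem torX_isQMat (hq : q ≠ 0) {m : ℕ} {y u : Fin m → Fin t → E}
    (h : ∀ i, IsTorusRow q (y i) (u i))
    (hyy : ∀ i k j l, i ≠ k → Commute (y i j) (y k l))
    (hyu : ∀ i k j l, i ≠ k → Commute (y i j) (u k l))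
    (huu : ∀ i k j l, i ≠ k → Commute (u i j) (u k l)) : IsQMat q (torX m y u) := by
  induction m with
  | zero => exact ⟨fun {i} => i.elim0, fun {i} => i.elim0, fun {i} => i.elim0, fun {i} => i.elim0⟩
  | succ m ih =>
    have hne : ∀ i : Fin m, i.castSucc ≠ Fin.last m := fun i => (Fin.castSucc_lt_last i).ne
    have hX := ih (fun i => h i.castSucc)
      (fun i k j l hik => hyy _ _ j l fun h => hik (Fin.castSucc_injective _ h))
      (fun i k j l hik => hyu _ _ j l fun h => hik (Fin.castSucc_injective _ h))
      (fun i k j l hik => huu _ _ j l fun h => hik (Fin.castSucc_injective _ h))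
    exact hX.snoc_torMat hq (h (Fin.last m))
      (fun i k j => torX_commute (fun i l => hyy _ _ _ _ (hne i))
        (fun i l => (hyu _ _ _ _ (hne i).symm).symm) i k)
      (fun i k j => torX_commute (fun i l => hyu _ _ _ _ (hne i))
        (fun i l => huu _ _ _ _ (hne i)) i k)

end TorusRow

section Torus

variable {K : Type} [Field K] {q : K} {ρ : Type} {t : ℕ}

/-- The sum of the entries of row `r` to the right of column `k`. -/
def rowTail (r : ρ) (k : Fin t) : (ρ × Fin t → ℤ) →+ ℤ :=
  ∑ l ∈ Finset.univ.filter (k < ·), Pi.evalAddMonoidHom (fun _ => ℤ) (r, l)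

theorem rowTail_apply (r : ρ) (k : Fin t) (a : ρ × Fin t → ℤ) :
    rowTail r k a = ∑ l, if k < l then a (r, l) else 0 := by
  rw [rowTail, AddMonoidHom.finsetSum_apply, Finset.sum_filter]
  rfl

variable [DecidableEq ρ]

/-- The exponent of the variable in row `r` and column `k`. -/
abbrev expo (r : ρ) (k : Fin t) : ρ × Fin t → ℤ := Pi.single (r, k) 1

theorem rowTail_expo (r s : ρ) (k l : Fin t) :
    rowTail r k (expo s l) = if r = s ∧ k < l then 1 else 0 := by
  rw [rowTail_apply, Finset.sum_eq_single l]
  · by_cases h : r = s <;> by_cases h' : k < l <;> simp [h, h']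
  · intro j _ hj; simp [hj]
  · simp

/-- The operator `y_{r,k}`. -/
def torY (q : K) (r : ρ) (k : Fin t) : Module.End K ((ρ × Fin t → ℤ) →₀ K) :=
  shiftOp q (expo r k) (rowTail r k)

/-- The operator `u_{r,l}`. -/
def torU (q : K) (r : ρ) (l : Fin t) : Module.End K ((ρ × Fin t → ℤ) →₀ K) :=
  shiftOp q (-expo r l) (Pi.evalAddMonoidHom (fun _ => ℤ) (r, l) - rowTail r l)

theorem isTorusRow_tor (hq : q ≠ 0) (r : ρ) : IsTorusRow (E := Module.End K _) q
    (torY q r : Fin t → Module.End K ((ρ × Fin t → ℤ) →₀ K)) (torU q r) := by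
  refine ⟨?_, ?_, ?_, ?_⟩
  · intro j k h
    rw [torY, torY, shiftOp_mul hq, rowTail_expo, rowTail_expo]
    simp [h, h.not_gt]
  · intro j k h
    rw [torU, torU, shiftOp_mul hq]
    simp only [map_neg, AddMonoidHom.sub_apply, rowTail_expo, Pi.evalAddMonoidHom_apply]
    simp [h, h.not_gt, h.ne, h.ne']
  · intro l j h
    rw [torU, torY, shiftOp_mul hq]
    simp only [map_neg, AddMonoidHom.sub_apply, rowTail_expo, Pi.evalAddMonoidHom_apply]
    rcases h.eq_or_lt with rfl | h
    · simp
    · simp [h, h.not_gt, h.ne']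
  · intro l j h
    rw [torU, torY, shiftOp_mul hq]
    simp only [map_neg, AddMonoidHom.sub_apply, rowTail_expo, Pi.evalAddMonoidHom_apply]
    simp [h, h.not_gt, h.ne]

theorem torY_commute_torY (hq : q ≠ 0) {r s : ρ} (h : r ≠ s) (k l : Fin t) :
    Commute (torY q r k) (torY q s l) := by
  rw [Commute, SemiconjBy, torY, torY, shiftOp_mul hq, rowTail_expo, rowTail_expo]
  simp [h, h.symm]

theorem torY_commute_torU (hq : q ≠ 0) {r s : ρ} (h : r ≠ s) (k l : Fin t) :
    Commute (torY q r k) (torU q s l) := by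
  rw [Commute, SemiconjBy, torY, torU, shiftOp_mul hq]
  simp only [map_neg, AddMonoidHom.sub_apply, rowTail_expo, Pi.evalAddMonoidHom_apply]
  simp [h, h.symm]

theorem torU_commute_torU (hq : q ≠ 0) {r s : ρ} (h : r ≠ s) (k l : Fin t) :
    Commute (torU q r k) (torU q s l) := by
  rw [Commute, SemiconjBy, torU, torU, shiftOp_mul hq]
  simp only [map_neg, AddMonoidHom.sub_apply, rowTail_expo, Pi.evalAddMonoidHom_apply]
  simp [h, h.symm]

/-- The quantum matrix with rows labelled by `r 0, …, r (m - 1)` in the quantum torus. -/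
def torMatrix (q : K) {m : ℕ} (r : Fin m → ρ) : Fin m → Fin t →
    Module.End K ((ρ × Fin t → ℤ) →₀ K) :=
  torX m (fun i => torY q (r i)) (fun i => torU q (r i))

theorem torMatrix_isQMat (hq : q ≠ 0) {m : ℕ} {r : Fin m → ρ} (hr : Function.Injective r) :
    IsQMat q (torMatrix (t := t) q r) :=
  torX_isQMat hq (fun _ => isTorusRow_tor hq _)
    (fun _ _ _ _ h => torY_commute_torY hq (hr.ne h) _ _)
    (fun _ _ _ _ h => torY_commute_torU hq (hr.ne h) _ _)
    (fun _ _ _ _ h => torU_commute_torU hq (hr.ne h) _ _)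

theorem torMatrix_commute (hq : q ≠ 0) {m m' : ℕ} {r : Fin m → ρ} {r' : Fin m' → ρ}
    (h : ∀ i j, r i ≠ r' j) (i : Fin m) (k : Fin t) (j : Fin m') (l : Fin t) :
    Commute (torMatrix q r i k) (torMatrix q r' j l) := by
  refine torX_commute (fun _ _ => ?_) (fun _ _ => ?_) _ _ <;> refine (torX_commute
    (fun _ _ => ?_) (fun _ _ => ?_) _ _).symm
  · exact torY_commute_torY hq (h _ _).symm _ _
  · exact (torY_commute_torU hq (h _ _) _ _).symm
  · exact torY_commute_torU hq (h _ _).symm _ _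
  · exact torU_commute_torU hq (h _ _).symm _ _

variable [Fintype ρ]

/-- The weight giving `expo r k` the value `f r * g k`. -/
def prodWt (f : ρ → ℤ) (g : Fin t → ℤ) : (ρ × Fin t → ℤ) →+ ℤ :=
  ∑ p : ρ × Fin t, (f p.1 * g p.2) • Pi.evalAddMonoidHom (fun _ => ℤ) p

@[simp] theorem prodWt_expo (f : ρ → ℤ) (g : Fin t → ℤ) (r : ρ) (k : Fin t) :
    prodWt f g (expo r k) = f r * g k := by
  simp [prodWt, Pi.single_apply]

theorem torMatrix_isLead (hq : q ≠ 0) {f : ρ → ℤ} {g : Fin t → ℤ} {m : ℕ} {r : Fin m → ρ}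
    (h : ∀ i k j l, i < k → j < l → 0 < (f (r k) - f (r i)) * (g l - g j)) (i : Fin m)
    (j : Fin t) : IsLead (prodWt f g) (torMatrix q r i j) (expo (r i) j) := by
  unfold torMatrix
  induction m generalizing j with
  | zero => exact i.elim0
  | succ m ih =>
    rw [torX]
    induction i using Fin.lastCases with
    | last => simpa [torY] using isLead_shiftOp hq _ _
    | cast i =>
      simp only [Fin.snoc_castSucc]
      have ih' := fun l => ih (r := fun i => r i.castSucc)
        (fun i k j l hik => h _ _ j l (Fin.castSucc_lt_castSucc_iff.2 hik)) i l
      have hl : ∀ l, IsLead (prodWt f g)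
          (torX m (fun i => torY q (r i.castSucc)) (fun i => torU q (r i.castSucc)) i l *
            (torU q (r (Fin.last m)) l * torY q (r (Fin.last m)) j))
          (expo (r i.castSucc) l + (-expo (r (Fin.last m)) l + expo (r (Fin.last m)) j)) :=
        fun l => (ih' l).mul ((isLead_shiftOp hq _ _).mul (isLead_shiftOp hq _ _))
      refine IsLead.sum _ (Finset.mem_univ j) ?_ ?_
      · rw [torMat, if_pos le_rfl]
        convert hl j using 1
        simp
      · intro l _ hne
        unfold torMat
        split_ifs with hjl
        · refine (hl l).lower.mono ?_
          have := h i.castSucc (Fin.last m) j l (Fin.castSucc_lt_last i)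
            (lt_of_le_of_ne hjl hne.symm)
          simp only [map_add, map_neg, prodWt_expo]
          nlinarith
        · rw [mul_zero]; exact IsLower.zero

end Torus

section Rearrangement

theorem sum_range_card_le_sum (s : Finset ℕ) : ∑ i ∈ Finset.range s.card, i ≤ ∑ i ∈ s, i := by
  induction s using Finset.induction_on_max with
  | empty => simp
  | insert m s hm ih =>
    have hnot : m ∉ s := fun h => lt_irrefl _ (hm m h)
    have hcard : s.card ≤ m := by
      simpa using Finset.card_le_card
        (show s ⊆ Finset.range m from fun x hx => by simpa using hm x hx)
    rw [Finset.card_insert_of_notMem hnot, Finset.sum_range_succ, Finset.sum_insert hnot]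
    omega

theorem sum_val_le_sum_of_injective {l : ℕ} {κ : Fin l → ℕ} (h : Function.Injective κ) :
    ∑ x : Fin l, (x : ℕ) ≤ ∑ x, κ x := by
  have := sum_range_card_le_sum (Finset.univ.image κ)
  rwa [Finset.card_image_of_injective _ h, Finset.sum_image h.injOn, Finset.card_univ,
    Fintype.card_fin, Finset.sum_range] at this

theorem sum_mul_val_le {l : ℕ} {F : Fin l → ℤ} (hF : StrictAnti F) (hpos : ∀ x, 0 ≤ F x)
    {κ : Fin l → ℕ} (hκ : Function.Injective κ) :
    ∑ x, F x * (x : ℕ) ≤ ∑ x, F x * κ x ∧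
      ((∀ x, 0 < F x) → ∑ x, F x * (x : ℕ) = ∑ x, F x * κ x → ∀ x, κ x = x) := by
  induction l with
  | zero => simp
  | succ l ih =>
    have hF' : StrictAnti fun x : Fin l => F x.castSucc - F (Fin.last l) := fun x y h => by
      have := hF (Fin.castSucc_lt_castSucc_iff.2 h)
      simp only; omega
    have hpos' : ∀ x : Fin l, 0 < F x.castSucc - F (Fin.last l) := fun x => by
      have := hF (Fin.castSucc_lt_last x); omega
    obtain ⟨h1, h2⟩ := ih hF' (fun x => (hpos' x).le) (hκ.comp (Fin.castSucc_injective l))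
    have hsum : (∑ x : Fin (l + 1), ((x : ℕ) : ℤ)) ≤ ∑ x, (κ x : ℤ) := by
      exact_mod_cast sum_val_le_sum_of_injective hκ
    have key : ∀ κ : Fin (l + 1) → ℕ, ∑ x, F x * κ x = F (Fin.last l) * (∑ x, (κ x : ℤ)) +
        ∑ x : Fin l, (F x.castSucc - F (Fin.last l)) * κ x.castSucc := by
      intro κ
      rw [Fin.sum_univ_castSucc, Fin.sum_univ_castSucc, mul_add, Finset.mul_sum, add_right_comm,
        ← Finset.sum_add_distrib]
      congr 1
      exact Finset.sum_congr rfl fun x _ => by ring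
    rw [key κ, key (fun x => x)]
    have hm := mul_le_mul_of_nonneg_left hsum (hpos (Fin.last l))
    refine ⟨add_le_add hm h1, fun hp heq => ?_⟩
    have h3 : ∀ x : Fin l, κ x.castSucc = x := h2 hpos' (le_antisymm h1 (by
      simp only [Function.comp_apply, Fin.val_castSucc] at h1 heq ⊢; linarith))
    have h4 : (∑ x : Fin (l + 1), ((x : ℕ) : ℤ)) = ∑ x, (κ x : ℤ) := by
      apply mul_left_cancel₀ (hp (Fin.last l)).ne'
      apply le_antisymm hm
      simp only [Function.comp_apply, Fin.val_castSucc] at h1 heq; linarith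
    rw [Fin.sum_univ_castSucc, Fin.sum_univ_castSucc] at h4
    simp only [h3, Fin.val_castSucc] at h4
    intro x
    induction x using Fin.lastCases with
    | last => exact_mod_cast (add_left_cancel h4).symm
    | cast x => simpa using h3 x

/-- The identity, or the order-reversing involution. -/
def fl (b : Bool) {m : ℕ} (i : Fin m) : Fin m := if b then i.rev else i

@[simp] theorem fl_fl (b : Bool) {m : ℕ} (i : Fin m) : fl b (fl b i) = i := by
  cases b <;> simp [fl]

/-- `fl` as a permutation. -/
def flEquiv (b : Bool) (m : ℕ) : Equiv.Perm (Fin m) :=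
  ⟨fl b, fl b, fl_fl b, fl_fl b⟩

theorem fl_injective (b : Bool) (m : ℕ) : Function.Injective (fl b : Fin m → Fin m) :=
  (flEquiv b m).injective

/-- The height of an index, used to weight monomials. -/
def hgt (b : Bool) {m : ℕ} (i : Fin m) : ℤ := m - (fl b i).val

theorem hgt_pos (b : Bool) {m : ℕ} (i : Fin m) : 0 < hgt b i := by
  have := (fl b i).2
  unfold hgt; omega

theorem hgt_sub_mul_pos (b : Bool) {m p : ℕ} {i k : Fin m} {j l : Fin p} (h : i < k) (h' : j < l) :
    0 < (hgt b k - hgt b i) * (hgt b l - hgt b j) := by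
  rw [Fin.lt_def] at h h'
  cases b
  · apply mul_pos_of_neg_of_neg <;> simp only [hgt, fl, Bool.false_eq_true, if_false] <;> omega
  · apply mul_pos <;> simp only [hgt, fl, if_true, Fin.val_rev] <;> omega

/-- The `l` indices of largest height, in increasing order. -/
def topIdx (b : Bool) {l t : ℕ} (h : l ≤ t) (x : Fin l) : Fin t := fl b (Fin.castLE h (fl b x))

theorem topIdx_injective (b : Bool) {l t : ℕ} (h : l ≤ t) : Function.Injective (topIdx b h) :=
  (fl_injective b t).comp ((Fin.castLE_injective h).comp (fl_injective b l))

@[simp] theorem topIdx_self (b : Bool) {t : ℕ} : topIdx b (le_refl t) = id := by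
  funext x; simp [topIdx]

theorem sum_hgt_mul_le (b : Bool) {m l t : ℕ} (h : l ≤ t) {R : Fin l → Fin m} (hR : StrictMono R)
    {κ : Fin l → Fin t} (hκ : Function.Injective κ) :
    ∑ x, hgt b (R x) * hgt b (κ x) ≤ ∑ x, hgt b (R x) * hgt b (topIdx b h x) ∧
      (∑ x, hgt b (R x) * hgt b (κ x) = ∑ x, hgt b (R x) * hgt b (topIdx b h x) →
        κ = topIdx b h) := by
  have hF : StrictAnti fun x => hgt b (R (fl b x)) := by
    intro x y hxy
    cases b
    · have := hR hxy
      rw [Fin.lt_def] at this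
      simp only [hgt, fl, Bool.false_eq_true, if_false]; omega
    · have := hR (Fin.rev_lt_rev.2 hxy)
      rw [Fin.lt_def] at this
      simp only [hgt, fl, if_true, Fin.val_rev]; omega
  have key : ∀ κ : Fin l → Fin t, ∑ x, hgt b (R x) * hgt b (κ x) =
      (∑ x, hgt b (R (fl b x)) * t) -
        ∑ x, hgt b (R (fl b x)) * ((fl b (κ (fl b x))).val : ℤ) := by
    intro κ
    rw [← Finset.sum_sub_distrib, ← Equiv.sum_comp (flEquiv b l)]
    refine Finset.sum_congr rfl fun x _ => ?_
    show hgt b (R (fl b x)) * hgt b (κ (fl b x)) = _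
    rw [hgt, hgt]; ring
  obtain ⟨h1, h2⟩ := sum_mul_val_le hF (fun x => (hgt_pos _ _).le)
    (κ := fun x => (fl b (κ (fl b x))).val)
    (Fin.val_injective.comp ((fl_injective b t).comp (hκ.comp (fl_injective b l))))
  rw [key, key]
  simp only [topIdx, fl_fl, Fin.val_castLE]
  refine ⟨sub_le_sub_left h1 _, fun heq => ?_⟩
  have h3 := h2 (fun x => hgt_pos _ _) (sub_right_injective heq).symm
  funext x
  have h4 := h3 (fl b x)
  rw [fl_fl] at h4
  rw [topIdx, ← fl_fl b (κ x)]
  congr 1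
  exact Fin.ext h4

end Rearrangement

section MinorLead

variable {K : Type} [Field K] {q : K} {n t : ℕ}

/-- The weight on exponents of the torus representation. -/
def torWt (b : Bool) (n t : ℕ) : ((Fin n ⊕ Fin n) × Fin t → ℤ) →+ ℤ :=
  prodWt (Sum.elim (hgt b) (hgt b)) (hgt b)

/-- The image of the generators `Y_{ik}` in the torus representation. -/
def repY (q : K) (n t : ℕ) : Fin n → Fin t →
    Module.End K (((Fin n ⊕ Fin n) × Fin t → ℤ) →₀ K) := torMatrix q Sum.inl

/-- The image of the generators `Z_{kj}` in the torus representation. -/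
def repZ (q : K) (n t : ℕ) : Fin t → Fin n →
    Module.End K (((Fin n ⊕ Fin n) × Fin t → ℤ) →₀ K) := fun k j => torMatrix q Sum.inr j k

theorem repY_isQMat (hq : q ≠ 0) : IsQMat q (repY q n t) := torMatrix_isQMat hq Sum.inl_injective

theorem repZ_isQMat (hq : q ≠ 0) : IsQMat q (repZ q n t) :=
  (torMatrix_isQMat hq Sum.inr_injective).transpose

theorem repY_commute_repZ (hq : q ≠ 0) (i : Fin n) (k l : Fin t) (j : Fin n) :
    Commute (repY q n t i k) (repZ q n t l j) :=
  torMatrix_commute hq (by simp) _ _ _ _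

theorem repY_isLead (hq : q ≠ 0) (b : Bool) (i : Fin n) (k : Fin t) :
    IsLead (torWt b n t) (repY q n t i k) (expo (Sum.inl i) k) :=
  torMatrix_isLead hq (f := Sum.elim (hgt b) (hgt b)) (r := Sum.inl)
    (fun _ _ _ _ h h' => hgt_sub_mul_pos b h h') i k

theorem repZ_isLead (hq : q ≠ 0) (b : Bool) (k : Fin t) (j : Fin n) :
    IsLead (torWt b n t) (repZ q n t k j) (expo (Sum.inr j) k) :=
  torMatrix_isLead hq (f := Sum.elim (hgt b) (hgt b)) (r := Sum.inr)
    (fun _ _ _ _ h h' => hgt_sub_mul_pos b h h') j k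

theorem torWt_sum_expo (b : Bool) {l : ℕ} (r : Fin l → Fin n ⊕ Fin n) (k : Fin l → Fin t) :
    torWt b n t (∑ x, expo (r x) (k x)) =
      ∑ x, Sum.elim (hgt b) (hgt b) (r x) * hgt b (k x) := by
  rw [map_sum]; simp [torWt]

variable {l : ℕ}

theorem qdet_repY_isLead (hq : q ≠ 0) (b : Bool) {R : Fin t → Fin n} (hR : StrictMono R) :
    IsLead (torWt b n t) (qdet q (repY q n t) R id) (∑ x, expo (Sum.inl (R x)) x) := by
  classical
  have hl : ∀ σ : Equiv.Perm (Fin t), IsLead (torWt b n t)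
      ((-q) ^ invCount σ • (List.ofFn fun i => repY q n t (R i) (σ i)).prod)
      (∑ x, expo (Sum.inl (R x)) (σ x)) := fun σ =>
    (IsLead.prod_ofFn fun x => repY_isLead hq b _ _).smul (pow_ne_zero _ (neg_ne_zero.2 hq))
  refine IsLead.sum _ (Finset.mem_univ (1 : Equiv.Perm (Fin t))) (hl 1) fun σ _ hσ => ?_
  refine (hl σ).lower.mono ?_
  rw [torWt_sum_expo, torWt_sum_expo]
  obtain ⟨h1, h2⟩ := sum_hgt_mul_le b (le_refl t) hR σ.injective
  rw [topIdx_self] at h1 h2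
  refine Int.add_one_le_iff.2 (lt_of_le_of_ne h1 fun h => hσ ?_)
  exact Equiv.ext fun x => congrFun (h2 h) x

theorem qdet_repZ_term (hq : q ≠ 0) (b : Bool) (κ : Fin l → Fin t) (C : Fin l → Fin n)
    (σ : Equiv.Perm (Fin l)) : IsLead (torWt b n t)
      ((-q) ^ invCount σ • (List.ofFn fun i => repZ q n t (κ i) (C (σ i))).prod)
      (∑ x, expo (Sum.inr (C x)) (κ (σ.symm x))) := by
  convert (IsLead.prod_ofFn fun x => repZ_isLead hq b (κ x) (C (σ x))).smul
    (pow_ne_zero (invCount σ) (neg_ne_zero.2 hq)) using 1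
  rw [← Equiv.sum_comp σ]
  simp

theorem qdet_repZ_isLead (hq : q ≠ 0) (b : Bool) (h : l ≤ t) {C : Fin l → Fin n}
    (hC : StrictMono C) : IsLead (torWt b n t) (qdet q (repZ q n t) (topIdx b h) C)
      (∑ x, expo (Sum.inr (C x)) (topIdx b h x)) := by
  classical
  refine IsLead.sum _ (Finset.mem_univ (1 : Equiv.Perm (Fin l)))
    (by exact qdet_repZ_term hq b (topIdx b h) C 1) fun σ _ hσ => ?_
  refine (qdet_repZ_term hq b (topIdx b h) C σ).lower.mono ?_
  rw [torWt_sum_expo, torWt_sum_expo]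
  obtain ⟨h1, h2⟩ := sum_hgt_mul_le b h hC
    (κ := fun x => topIdx b h (σ.symm x)) ((topIdx_injective b h).comp σ.symm.injective)
  refine Int.add_one_le_iff.2 (lt_of_le_of_ne h1 fun h' => hσ ?_)
  have h3 := congrFun (h2 h')
  have : σ.symm = 1 := Equiv.ext fun x => topIdx_injective b h (h3 x)
  rw [← inv_inj, inv_one, ← this]; rfl

theorem qdet_repZ_isLower (hq : q ≠ 0) (b : Bool) (h : l ≤ t) {κ : Fin l → Fin t}
    (hκ : Function.Injective κ) {C : Fin l → Fin n} (hC : StrictMono C) :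
    IsLower (torWt b n t) (qdet q (repZ q n t) κ C)
      (torWt b n t (∑ x, expo (Sum.inr (C x)) (topIdx b h x)) + 1) := by
  refine IsLower.sum _ fun σ _ => (qdet_repZ_term hq b κ C σ).lower.mono ?_
  rw [torWt_sum_expo, torWt_sum_expo]
  exact add_le_add_left (sum_hgt_mul_le b h hC (hκ.comp σ.symm.injective)).1 1

/-- The leading exponent of the minor with rows `R` and columns `C`. -/
def minorExpo (b : Bool) (h : l ≤ t) (R C : Fin l → Fin n) : (Fin n ⊕ Fin n) × Fin t → ℤ :=
  ∑ x, expo (Sum.inl (R x)) (topIdx b h x) + ∑ x, expo (Sum.inr (C x)) (topIdx b h x)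

theorem qdet_rep_isLead (hq : q ≠ 0) (b : Bool) (h : l ≤ t) {R C : Fin l → Fin n}
    (hR : StrictMono R) (hC : StrictMono C) : IsLead (torWt b n t)
      (qdet q (fun i j => ∑ k, repY q n t i k * repZ q n t k j) R C) (minorExpo b h R C) := by
  classical
  rw [qdet_matMul (repY_commute_repZ hq)]
  have hY : ∀ κ : Fin l → Fin t, IsLead (torWt b n t)
      (List.ofFn fun i => repY q n t (R i) (κ i)).prod (∑ x, expo (Sum.inl (R x)) (κ x)) :=
    fun κ => IsLead.prod_ofFn fun x => repY_isLead hq b _ _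
  refine IsLead.sum _ (Finset.mem_univ (topIdx b h))
    ((hY _).mul (qdet_repZ_isLead hq b h hC)) fun κ _ hne => ?_
  by_cases hκ : Function.Injective κ
  · have h1 := (hY κ).lower.mul (qdet_repZ_isLower hq b h hκ hC)
    refine h1.mono ?_
    rw [minorExpo, map_add, torWt_sum_expo, torWt_sum_expo (r := fun x => Sum.inl (R x))]
    obtain ⟨h2, h3⟩ := sum_hgt_mul_le b h hR hκ
    have := lt_of_le_of_ne h2 fun h' => hne (h3 h')
    simp only [Sum.elim_inl]
    omega
  · rw [qdet_eq_zero_of_not_injective hq (repZ_isQMat hq) hC hκ, mul_zero]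
    exact IsLower.zero

end MinorLead

section Normal

variable {K : Type} [Field K] {q : K} {E : Type} [Ring E] [Algebra K E] {u v t : ℕ}

theorem mul_prod_ofFn_eq {g : E} {l : ℕ} {f : Fin l → E} {c : Fin l → K}
    (h : ∀ i, g * f i = c i • (f i * g)) :
    g * (List.ofFn f).prod = (∏ i, c i) • ((List.ofFn f).prod * g) := by
  induction l with
  | zero => simp
  | succ l ih =>
    rw [List.ofFn_succ, List.prod_cons, Fin.prod_univ_succ, ← mul_assoc, h 0, smul_mul_assoc,
      mul_assoc, ih fun i => h _, mul_smul_comm, smul_smul, mul_assoc]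

theorem map_qMinor (f : OqM K q u v →ₐ[K] E) {l : ℕ} (R : Fin l → Fin u) (C : Fin l → Fin v) :
    f (qMinor K q R C) = qdet q (fun i j => f (Xg K q i j)) R C :=
  map_qdet (E := OqM K q u v) f (fun i j => Xg K q i j) R C

theorem mul_qdet_eq {g : E} {l : ℕ} {x : Fin u → Fin v → E} {R : Fin l → Fin u}
    {C : Fin l → Fin v} {e : K} (c : Equiv.Perm (Fin l) → Fin l → K)
    (h : ∀ σ i, g * x (R i) (C (σ i)) = c σ i • (x (R i) (C (σ i)) * g))
    (hc : ∀ σ, ∏ i, c σ i = e) : g * qdet q x R C = e • (qdet q x R C * g) := by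
  rw [qdet, Finset.mul_sum, Finset.sum_mul, Finset.smul_sum]
  refine Finset.sum_congr rfl fun σ _ => ?_
  rw [mul_smul_comm, mul_prod_ofFn_eq (h σ), hc, smul_mul_assoc, smul_comm]

theorem IsQMat.submatrix {u' v' : ℕ} {x : Fin u → Fin v → E} (hx : IsQMat q x)
    {r : Fin u' → Fin u} {c : Fin v' → Fin v} (hr : StrictMono r) (hc : StrictMono c) :
    IsQMat q (fun i j => x (r i) (c j)) where
  row h := hx.row (hc h)
  col h := hx.col (hr h)
  comm h h' := hx.comm (hr h) (hc h')
  quantum h h' := hx.quantum (hr h) (hc h')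

theorem IsQMat.row_inv (hq : q ≠ 0) {x : Fin u → Fin v → E} (hx : IsQMat q x) {i : Fin u}
    {j k : Fin v} (h : j < k) : x i k * x i j = q⁻¹ • (x i j * x i k) := by
  rw [hx.row h, smul_smul, inv_mul_cancel₀ hq, one_smul]

theorem corner_commute_qdet (hq : q ≠ 0) {x : Fin t → Fin t → E} (hx : IsQMat q x) {a L : Fin t}
    (ha : ∀ i, a ≤ i) (hL : ∀ j, j ≤ L) :
    x a L * qdet q x id id = (1 : K) • (qdet q x id id * x a L) := by
  refine mul_qdet_eq (fun σ i => (if i = a then (if σ a = L then 1 else q⁻¹) else 1) *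
    (if σ i = L then (if i = a then 1 else q) else 1)) (fun σ i => ?_) (fun σ => ?_)
  · simp only [id]
    by_cases hi : i = a
    · subst hi
      by_cases hs : σ i = L
      · simp [hs]
      · simp only [hs, if_true, if_false, mul_one]
        exact hx.row_inv hq (lt_of_le_of_ne (hL _) hs)
    · by_cases hs : σ i = L
      · simp only [hs, hi, if_true, if_false, one_mul]
        exact hx.col (lt_of_le_of_ne (ha _) (Ne.symm hi))
      · simp only [hs, hi, if_false, one_mul, one_smul]
        exact hx.comm (lt_of_le_of_ne (ha _) (Ne.symm hi)) (lt_of_le_of_ne (hL _) hs)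
  · rw [Finset.prod_mul_distrib]
    have h1 : ∀ i, σ i = L ↔ i = σ.symm L := fun i => by rw [Equiv.eq_symm_apply]
    simp only [h1, Finset.prod_ite_eq', Finset.mem_univ, if_true]
    by_cases h : a = σ.symm L
    · simp [← h]
    · simp [h, Ne.symm h, hq]

/-- The upper triangular quantum matrix in the quantum torus with `t` pairs of generators. -/
def triMat (q : K) (t : ℕ) : Fin t → Fin t → Module.End K ((Unit × Fin t → ℤ) →₀ K) :=
  fun l j => torMat (torY q ()) (torU q ()) j l

theorem triMat_isQMat (hq : q ≠ 0) : IsQMat q (triMat q t) :=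
  (torMat_isQMat hq (isTorusRow_tor hq ())).transpose

theorem triMat_single (hq : q ≠ 0) {l j : Fin t} (h : l ≤ j) : ∃ L : (Unit × Fin t → ℤ) → ℤ,
    ∀ a, triMat q t l j (Finsupp.single a 1) =
      Finsupp.single (a + (expo () l - expo () j)) (q ^ L a) := by
  refine ⟨fun a => rowTail () l a + (Pi.evalAddMonoidHom (fun _ => ℤ) ((), j) -
    rowTail () j) (a + expo () l), fun a => ?_⟩
  rw [triMat, torMat, if_pos h, Module.End.mul_apply, torY, torU, shiftOp_single, shiftOp_single,
    zpow_add₀ hq, mul_one, mul_comm]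
  congr 1
  abel

theorem triMat_diag_single (hq : q ≠ 0) (l : Fin t) (a : Unit × Fin t → ℤ) :
    triMat q t l l (Finsupp.single a 1) = q ^ (a ((), l) + 1) • Finsupp.single a 1 := by
  rw [triMat, torMat, if_pos le_rfl, Module.End.mul_apply, torY, torU, shiftOp_single,
    shiftOp_single, mul_one, ← zpow_add₀ hq, Finsupp.smul_single, smul_eq_mul, mul_one]
  congr 1
  · abel
  · congr 1
    simp only [map_add, AddMonoidHom.sub_apply, rowTail_expo, Pi.evalAddMonoidHom_apply]
    simp
    ring

theorem qdet_triMat_single (hq : q ≠ 0) (a : Unit × Fin t → ℤ) :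
    qdet q (triMat q t) id id (Finsupp.single a 1) =
      q ^ (∑ l, (a ((), l) + 1)) • Finsupp.single a 1 := by
  have h1 : qdet q (triMat q t) id id = (List.ofFn fun l => triMat q t l l).prod := by
    rw [qdet, Finset.sum_eq_single 1]
    · have h0 : invCount (1 : Equiv.Perm (Fin t)) = 0 := by
        rw [invCount_eq_sum]
        exact Finset.sum_eq_zero fun i _ => Finset.sum_eq_zero fun j _ =>
          if_neg fun h => lt_asymm h.1 h.2
      simp [h0]
    · intro σ _ hσ
      have : ∃ i, σ i < i := by
        by_contra hc
        push Not at hc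
        apply hσ
        by_contra hne
        obtain ⟨r, r', hr, hd⟩ := exists_descent hne
        have h2 : ∑ i, ((σ i : Fin t) : ℕ) = ∑ i : Fin t, (i : ℕ) :=
          Equiv.sum_comp σ (fun i : Fin t => (i : ℕ))
        have h3 := (Finset.sum_eq_sum_iff_of_le (s := Finset.univ)
          (f := fun i : Fin t => (i : ℕ)) (g := fun i => ((σ i : Fin t) : ℕ))
          (fun i _ => hc i)).1 h2.symm
        have h4 := h3 r (Finset.mem_univ _)
        have h5 := h3 r' (Finset.mem_univ _)
        rw [Fin.lt_def] at hd
        omega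
      obtain ⟨i, hi⟩ := this
      rw [List.prod_eq_zero, smul_zero]
      refine List.mem_ofFn.2 ⟨i, ?_⟩
      exact if_neg (not_le.2 hi)
    · simp
  rw [h1]
  have h2 : ∀ (m : ℕ) (f : Fin m → Fin t), (List.ofFn fun l => triMat q t (f l) (f l)).prod
      (Finsupp.single a 1) = q ^ (∑ l, (a ((), f l) + 1)) • Finsupp.single a 1 := by
    intro m
    induction m with
    | zero => intro f; simp
    | succ m ih =>
      intro f
      rw [List.ofFn_succ, List.prod_cons, Module.End.mul_apply, ih, map_smul,
        triMat_diag_single hq, Fin.sum_univ_succ, smul_smul, mul_comm, ← zpow_add₀ hq]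
  exact h2 t id

theorem qdet_triMat_commute (hq : q ≠ 0) {l j : Fin t} (h : l ≤ j) :
    Commute (qdet q (triMat q t) id id) (triMat q t l j) := by
  obtain ⟨L, hL⟩ := triMat_single hq h
  apply Finsupp.lhom_ext'
  intro a
  apply LinearMap.ext_ring
  simp only [LinearMap.comp_apply, Finsupp.lsingle_apply, Module.End.mul_apply]
  have hs : ∀ (b : Unit × Fin t → ℤ) (c : K), Finsupp.single b c = c • Finsupp.single b 1 := by
    intro b c; simp
  rw [qdet_triMat_single hq, map_smul, hL, hs _ (q ^ L a), map_smul, qdet_triMat_single hq,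
    smul_comm]
  have : ∑ k, ((a + (expo () l - expo () j)) ((), k) + 1) = ∑ k, (a ((), k) + 1) := by
    simp only [Pi.add_apply, Pi.sub_apply, Finset.sum_add_distrib, Finset.sum_sub_distrib,
      Pi.single_apply, Prod.mk.injEq, true_and, Finset.sum_ite_eq', Finset.mem_univ, if_true]
    ring
  rw [this]

theorem eq_zero_of_sum_tmul {A S : Type} [Ring A] [Algebra K A] [Ring S] [Algebra K S]
    {α : Type} [Fintype α] [DecidableEq α] {a : α → A} {s : α → S} {f : α → S →ₗ[K] K}
    (hf : ∀ i j, i ≠ j → f i (s j) = 0) (hf' : ∀ i, f i (s i) ≠ 0)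
    (h : ∑ i, a i ⊗ₜ[K] s i = 0) (i : α) : a i = 0 := by
  have := congrArg (TensorProduct.rid K A ∘ LinearMap.lTensor A (f i)) h
  simp only [Function.comp_apply, map_sum, LinearMap.lTensor_tmul, TensorProduct.rid_tmul,
    map_zero] at this
  rw [Finset.sum_eq_single i (fun j _ hj => by rw [hf i j hj.symm, zero_smul]) (by simp)] at this
  exact (smul_eq_zero.1 this).resolve_left (hf' i)

/-- The coefficient at `v` of the image of the basis vector of exponent `0`. -/
def coeffAt {α : Type} [Zero α] (v : α) : Module.End K (α →₀ K) →ₗ[K] K where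
  toFun φ := φ (Finsupp.single 0 1) v
  map_add' _ _ := rfl
  map_smul' _ _ := rfl

theorem coeffAt_apply {α : Type} [Zero α] (v : α) (φ : Module.End K (α →₀ K)) :
    coeffAt v φ = φ (Finsupp.single 0 1) v := rfl

theorem eq_of_sum_triMat (hq : q ≠ 0) {A : Type} [Ring A] [Algebra K A] {a a' : Fin t → A}
    {r c : Fin t → Fin t} (hrc : ∀ i, r i ≤ c i)
    (hinj : Function.Injective fun i => (expo () (r i) - expo () (c i) : Unit × Fin t → ℤ))
    (h : (∑ i, a i ⊗ₜ[K] (triMat q t (r i) (c i) * qdet q (triMat q t) id id)) =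
      ∑ i, a' i ⊗ₜ[K] (qdet q (triMat q t) id id * triMat q t (r i) (c i))) (i : Fin t) :
    a i = a' i := by
  rw [← sub_eq_zero]
  have h' : ∑ i, (a i - a' i) ⊗ₜ[K]
      (triMat q t (r i) (c i) * qdet q (triMat q t) id id) = 0 := by
    simp only [TensorProduct.sub_tmul, Finset.sum_sub_distrib]
    rw [sub_eq_zero, h]
    exact Finset.sum_congr rfl fun i _ => by rw [(qdet_triMat_commute hq (hrc i)).eq]
  have hval : ∀ j, ∃ e : K, e ≠ 0 ∧ (triMat q t (r j) (c j) * qdet q (triMat q t) id id)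
      (Finsupp.single 0 1) = Finsupp.single (expo () (r j) - expo () (c j)) e := by
    intro j
    obtain ⟨L, hL⟩ := triMat_single hq (hrc j)
    rw [Module.End.mul_apply, qdet_triMat_single hq, map_smul, hL, Finsupp.smul_single, zero_add]
    exact ⟨_, mul_ne_zero (zpow_ne_zero _ hq) (zpow_ne_zero _ hq), rfl⟩
  refine eq_zero_of_sum_tmul (S := Module.End K ((Unit × Fin t → ℤ) →₀ K))
    (f := fun i => coeffAt (expo () (r i) - expo () (c i) : Unit × Fin t → ℤ))
    (fun i j hij => ?_) (fun j => ?_) h' i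
  · obtain ⟨e, -, he⟩ := hval j
    rw [coeffAt_apply, he]
    have hne := hinj.ne hij
    rw [Finsupp.single_apply, if_neg hne.symm]
  · obtain ⟨e, he0, he⟩ := hval j
    rw [coeffAt_apply, he, Finsupp.single_eq_same]
    exact he0

theorem column_relation {S T : Type} [Ring S] [Algebra K S] [Ring T] [Algebra K T]
    (ι₁ : OqM K q u t →ₐ[K] T) (ι₂ : S →ₐ[K] T) (hι : ∀ a s, Commute (ι₁ a) (ι₂ s)) (hq : q ≠ 0)
    {z : Fin t → Fin t → S} (hz : IsQMat q z) {R : Fin t → Fin u} {i : Fin u} {L : Fin t} {e : K}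
    (h : Xg K q i L * qMinor K q R id = e • (qMinor K q R id * Xg K q i L)) :
    ∑ l, ι₁ (Xg K q i l * qMinor K q R id) * ι₂ (z l L * qdet q z id id) =
      ∑ l, ι₁ (e • (qMinor K q R id * Xg K q i l)) * ι₂ (qdet q z id id * z l L) := by
  have hx := (isQMat_Xg (K := K) (q := q) (u := u) (v := t)).map ι₁
  have hz' := hz.map ι₂
  let φ : OqM K q u t →ₐ[K] T := qmLift (hx.mul hq hz' fun i k l j => hι _ _)
  have hφ : ∀ i j, φ (Xg K q i j) = ∑ l, ι₁ (Xg K q i l) * ι₂ (z l j) := fun i j =>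
    qmLift_Xg _ i j
  have hD : φ (qMinor K q R id) = ι₁ (qMinor K q R id) * ι₂ (qdet q z id id) := by
    rw [map_qMinor φ]
    simp only [hφ]
    rw [qdet_matMul_square hq hz' (fun i k l j => hι _ _) R strictMono_id, ← map_qMinor ι₁,
      ← map_qdet ι₂]
  have h1 := congrArg φ h
  rw [map_smul, map_mul, map_mul, hD, hφ, Finset.sum_mul, Finset.mul_sum, Finset.smul_sum] at h1
  refine (Finset.sum_congr rfl fun l _ => ?_).trans (h1.trans (Finset.sum_congr rfl fun l _ => ?_))
  · rw [map_mul, map_mul, (hι _ _).mul_mul_mul_comm]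
  · rw [map_smul, map_mul, map_mul, (hι _ _).symm.mul_mul_mul_comm, smul_mul_assoc]

theorem row_relation {S T : Type} [Ring S] [Algebra K S] [Ring T] [Algebra K T]
    (ι₁ : OqM K q t v →ₐ[K] T) (ι₂ : S →ₐ[K] T) (hι : ∀ a s, Commute (ι₁ a) (ι₂ s)) (hq : q ≠ 0)
    {z : Fin t → Fin t → S} (hz : IsQMat q z) {C : Fin t → Fin v} (hC : StrictMono C) {a : Fin t}
    {j : Fin v} {e : K}
    (h : Xg K q a j * qMinor K q id C = e • (qMinor K q id C * Xg K q a j)) :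
    ∑ l, ι₁ (Xg K q l j * qMinor K q id C) * ι₂ (z a l * qdet q z id id) =
      ∑ l, ι₁ (e • (qMinor K q id C * Xg K q l j)) * ι₂ (qdet q z id id * z a l) := by
  have hx := (isQMat_Xg (K := K) (q := q) (u := t) (v := v)).map ι₁
  have hz' := hz.map ι₂
  let φ : OqM K q t v →ₐ[K] T := qmLift (hz'.mul hq hx fun i k l j => (hι _ _).symm)
  have hφ : ∀ i j, φ (Xg K q i j) = ∑ l, ι₁ (Xg K q l j) * ι₂ (z i l) := fun i j =>
    (qmLift_Xg _ i j).trans (Finset.sum_congr rfl fun l _ => (hι _ _).eq.symm)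
  have hD : φ (qMinor K q id C) = ι₁ (qMinor K q id C) * ι₂ (qdet q z id id) := by
    rw [map_qMinor φ]
    simp only [φ, qmLift_Xg]
    rw [qdet_matMul_square hq hx (fun i k l j => (hι _ _).symm) id hC, ← map_qMinor ι₁,
      ← map_qdet ι₂, (hι _ _).eq]
  have h1 := congrArg φ h
  rw [map_smul, map_mul, map_mul, hD, hφ, Finset.sum_mul, Finset.mul_sum, Finset.smul_sum] at h1
  refine (Finset.sum_congr rfl fun l _ => ?_).trans (h1.trans (Finset.sum_congr rfl fun l _ => ?_))
  · rw [map_mul, map_mul, (hι _ _).mul_mul_mul_comm]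
  · rw [map_smul, map_mul, map_mul, (hι _ _).symm.mul_mul_mul_comm, smul_mul_assoc]

theorem spread_column (hq : q ≠ 0) {R : Fin t → Fin u} {i : Fin u} {L : Fin t} (hL : ∀ j, j ≤ L)
    {e : K} (h : Xg K q i L * qMinor K q R id = e • (qMinor K q R id * Xg K q i L)) (j : Fin t) :
    Xg K q i j * qMinor K q R id = e • (qMinor K q R id * Xg K q i j) := by
  have h1 := column_relation (T := OqM K q u t ⊗[K] Module.End K ((Unit × Fin t → ℤ) →₀ K))
    Algebra.TensorProduct.includeLeft Algebra.TensorProduct.includeRight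
    (fun a s => by simp [Commute, SemiconjBy]) hq (triMat_isQMat (t := t) hq) h
  simp only [Algebra.TensorProduct.includeLeft_apply, Algebra.TensorProduct.includeRight_apply,
    Algebra.TensorProduct.tmul_mul_tmul, mul_one, one_mul] at h1
  exact eq_of_sum_triMat hq (r := id) (c := fun _ => L) (fun i => hL i) (fun a b hab => by
    have := congrFun hab ((), a)
    by_contra hne
    simp [Pi.single_apply, hne] at this) h1 j

theorem spread_row (hq : q ≠ 0) {C : Fin t → Fin v} (hC : StrictMono C) {j : Fin v} {a : Fin t}
    (ha : ∀ i, a ≤ i) {e : K}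
    (h : Xg K q a j * qMinor K q id C = e • (qMinor K q id C * Xg K q a j)) (i : Fin t) :
    Xg K q i j * qMinor K q id C = e • (qMinor K q id C * Xg K q i j) := by
  have h1 := row_relation (T := OqM K q t v ⊗[K] Module.End K ((Unit × Fin t → ℤ) →₀ K))
    Algebra.TensorProduct.includeLeft Algebra.TensorProduct.includeRight
    (fun a s => by simp [Commute, SemiconjBy]) hq (triMat_isQMat (t := t) hq) hC h
  simp only [Algebra.TensorProduct.includeLeft_apply, Algebra.TensorProduct.includeRight_apply,
    Algebra.TensorProduct.tmul_mul_tmul, mul_one, one_mul] at h1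
  exact eq_of_sum_triMat hq (r := fun _ => a) (c := id) (fun i => ha i) (fun b c hbc => by
    have := congrFun hbc ((), b)
    by_contra hne
    simp [Pi.single_apply, hne] at this) h1 i

theorem qMinor_id_central (hq : q ≠ 0) (i j : Fin t) :
    Xg K q i j * qMinor K q (id : Fin t → Fin t) (id : Fin t → Fin t) =
      (1 : K) • (qMinor K q id id * Xg K q i j) := by
  obtain ⟨t, rfl⟩ : ∃ m, t = m + 1 := ⟨t - 1, by have := i.2; omega⟩
  refine spread_row hq strictMono_id (a := 0) Fin.zero_le (spread_column hq (L := Fin.last t)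
    Fin.le_last ?_ j) i
  exact corner_commute_qdet hq isQMat_Xg Fin.zero_le Fin.le_last

theorem submatrix_central (hq : q ≠ 0) {x : Fin t → Fin t → E} (hx : IsQMat q x) (i j : Fin t) :
    x i j * qdet q x id id = (1 : K) • (qdet q x id id * x i j) := by
  have := congrArg (qmLift hx) (qMinor_id_central hq i j)
  rw [map_smul, map_mul, map_mul, qMinor_eq_qdet, map_qdet] at this
  simpa using this

theorem rowTop_strictMono {n t : ℕ} (h : t ≤ n) : StrictMono (rowTop n t h) := fun a b hab => by
  rw [Fin.lt_def] at hab ⊢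
  simp only [rowTop]; omega

theorem colLeft_strictMono {n t : ℕ} (h : t ≤ n) : StrictMono (colLeft n t h) := fun _ _ hab => hab

theorem dY_normal (hq : q ≠ 0) {n t : ℕ} (h : t ≤ n) (i : Fin n) (k : Fin t) :
    ∃ e : K, Xg K q i k * dY K q n t h = e • (dY K q n t h * Xg K q i k) := by
  by_cases hi : i.val < n - t
  · obtain ⟨t, rfl⟩ : ∃ m, t = m + 1 := ⟨t - 1, by have := k.2; omega⟩
    refine ⟨q, spread_column hq (L := Fin.last t) Fin.le_last ?_ k⟩
    rw [qMinor_eq_qdet]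
    refine mul_qdet_eq (fun σ p => if σ p = Fin.last t then q else 1) (fun σ p => ?_) fun σ => ?_
    · have hlt : i < rowTop n (t + 1) h p := by rw [Fin.lt_def]; simp only [rowTop]; omega
      dsimp only [id]
      split_ifs with hs
      · rw [hs]; exact isQMat_Xg.col hlt
      · rw [one_smul]
        exact isQMat_Xg.comm hlt (lt_of_le_of_ne (Fin.le_last _) hs)
    · have h1 : ∀ i, σ i = Fin.last t ↔ i = σ.symm (Fin.last t) :=
        fun i => by rw [Equiv.eq_symm_apply]
      simp [h1]
  · obtain ⟨p, rfl⟩ : ∃ p, i = rowTop n t h p :=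
      ⟨⟨i - (n - t), by omega⟩, by ext; simp only [rowTop]; omega⟩
    exact ⟨1, submatrix_central hq (isQMat_Xg.submatrix (rowTop_strictMono h) strictMono_id) p k⟩

theorem dZ_normal (hq : q ≠ 0) {n t : ℕ} (h : t ≤ n) (k : Fin t) (j : Fin n) :
    ∃ e : K, Xg K q k j * dZ K q n t h = e • (dZ K q n t h * Xg K q k j) := by
  by_cases hj : t ≤ j.val
  · obtain ⟨t, rfl⟩ : ∃ m, t = m + 1 := ⟨t - 1, by have := k.2; omega⟩
    refine ⟨q⁻¹, spread_row hq (colLeft_strictMono h) (a := 0) Fin.zero_le ?_ k⟩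
    rw [qMinor_eq_qdet]
    refine mul_qdet_eq (fun σ p => if p = 0 then q⁻¹ else 1) (fun σ p => ?_) fun σ => by simp
    have hlt : colLeft n (t + 1) h (σ p) < j := by rw [Fin.lt_def]; simp only [colLeft]; omega
    dsimp only [id]
    split_ifs with hs
    · rw [hs]; exact isQMat_Xg.row_inv hq (by rw [← hs]; exact hlt)
    · rw [one_smul]
      exact isQMat_Xg.comm (Fin.pos_of_ne_zero hs) hlt
  · obtain ⟨p, rfl⟩ : ∃ p, j = colLeft n t h p := ⟨⟨j, by omega⟩, rfl⟩
    exact ⟨1, submatrix_central hq (isQMat_Xg.submatrix strictMono_id (colLeft_strictMono h)) k p⟩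

end Normal

section Growth

/-- The growth diagram (Fomin's local rules) of a matrix of natural numbers: `growth A i j k` is
the `k`-th part of the partition at position `(i, j)`. -/
def growth (A : ℕ → ℕ → ℕ) : ℕ → ℕ → ℕ → ℕ
  | 0, _, _ => 0
  | _ + 1, 0, _ => 0
  | i + 1, j + 1, 0 => max (growth A i (j + 1) 0) (growth A (i + 1) j 0) + A i j
  | i + 1, j + 1, k + 1 => max (growth A i (j + 1) (k + 1)) (growth A (i + 1) j (k + 1)) +
      (min (growth A i (j + 1) k) (growth A (i + 1) j k) - growth A i j k)

variable {A : ℕ → ℕ → ℕ}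

@[simp] theorem growth_zero_left (j k : ℕ) : growth A 0 j k = 0 := by simp [growth]

@[simp] theorem growth_zero_right (i k : ℕ) : growth A i 0 k = 0 := by cases i <;> simp [growth]

theorem growth_succ_zero (i j : ℕ) : growth A (i + 1) (j + 1) 0 =
    max (growth A i (j + 1) 0) (growth A (i + 1) j 0) + A i j := by
  rw [growth]

theorem growth_succ_succ (i j k : ℕ) : growth A (i + 1) (j + 1) (k + 1) =
    max (growth A i (j + 1) (k + 1)) (growth A (i + 1) j (k + 1)) +
      (min (growth A i (j + 1) k) (growth A (i + 1) j k) - growth A i j k) := by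
  rw [growth]

/-- Successive partitions differ by horizontal strips. -/
structure IsStripChain (c : ℕ → ℕ → ℕ) : Prop where
  zero : ∀ k, c 0 k = 0
  mono : ∀ i k, c i k ≤ c (i + 1) k
  inter : ∀ i k, c (i + 1) (k + 1) ≤ c i k

theorem growth_strip (i j : ℕ) : (∀ k, growth A i j k ≤ growth A (i + 1) j k ∧
      growth A (i + 1) j (k + 1) ≤ growth A i j k) ∧
    ∀ k, growth A i j k ≤ growth A i (j + 1) k ∧
      growth A i (j + 1) (k + 1) ≤ growth A i j k := by
  have step : ∀ i j, (∀ k, growth A i j k ≤ growth A (i + 1) j k ∧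
      growth A (i + 1) j (k + 1) ≤ growth A i j k) →
      (∀ k, growth A i j k ≤ growth A i (j + 1) k ∧
        growth A i (j + 1) (k + 1) ≤ growth A i j k) →
      (∀ k, growth A i (j + 1) k ≤ growth A (i + 1) (j + 1) k ∧
        growth A (i + 1) (j + 1) (k + 1) ≤ growth A i (j + 1) k) ∧
      ∀ k, growth A (i + 1) j k ≤ growth A (i + 1) (j + 1) k ∧
        growth A (i + 1) (j + 1) (k + 1) ≤ growth A (i + 1) j k := by
    intro i j h1 h2
    refine ⟨fun k => ⟨?_, ?_⟩, fun k => ⟨?_, ?_⟩⟩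
    · cases k with
      | zero => rw [growth_succ_zero]; omega
      | succ k => rw [growth_succ_succ]; omega
    · have := h1 k; have := h2 k
      rw [growth_succ_succ]; omega
    · cases k with
      | zero => rw [growth_succ_zero]; omega
      | succ k => rw [growth_succ_succ]; omega
    · have := h1 k; have := h2 k
      rw [growth_succ_succ]; omega
  induction i generalizing j with
  | zero =>
    have h2 : ∀ j k, growth A 0 j k ≤ growth A 0 (j + 1) k ∧
        growth A 0 (j + 1) (k + 1) ≤ growth A 0 j k := by simp
    refine ⟨?_, h2 j⟩
    induction j with
    | zero => simp
    | succ j ih => exact (step 0 j ih (h2 j)).1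
  | succ i ih =>
    have h2 : ∀ j k, growth A (i + 1) j k ≤ growth A (i + 1) (j + 1) k ∧
        growth A (i + 1) (j + 1) (k + 1) ≤ growth A (i + 1) j k :=
      fun j => (step i j (ih j).1 (ih j).2).2
    refine ⟨?_, h2 j⟩
    induction j with
    | zero => simp
    | succ j ih' => exact (step (i + 1) j ih' (h2 j)).1

theorem growth_isStripChain_left (j : ℕ) : IsStripChain fun i k => growth A i j k :=
  ⟨fun k => growth_zero_left j k, fun i k => ((growth_strip i j).1 k).1,
    fun i k => ((growth_strip i j).1 k).2⟩

theorem growth_isStripChain_right (i : ℕ) : IsStripChain fun j k => growth A i j k :=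
  ⟨fun k => growth_zero_right i k, fun j k => ((growth_strip i j).2 k).1,
    fun j k => ((growth_strip i j).2 k).2⟩

theorem IsStripChain.eq_zero {c : ℕ → ℕ → ℕ} (hc : IsStripChain c) {i k : ℕ} (h : i ≤ k) :
    c i k = 0 := by
  induction i generalizing k with
  | zero => exact hc.zero k
  | succ i ih =>
    obtain ⟨k, rfl⟩ : ∃ k', k = k' + 1 := ⟨k - 1, by omega⟩
    have := hc.inter i k
    rw [ih (by omega)] at this
    omega

theorem IsStripChain.monotone {c : ℕ → ℕ → ℕ} (hc : IsStripChain c) (k : ℕ) :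
    Monotone fun i => c i k :=
  monotone_nat_of_le_succ fun i => hc.mono i k

theorem IsStripChain.antitone {c : ℕ → ℕ → ℕ} (hc : IsStripChain c) (i : ℕ) : Antitone (c i) :=
  antitone_nat_of_succ_le fun k => (hc.mono i _).trans (hc.inter i k)

theorem sum_growth_square {i j n : ℕ} (hi : i < n) :
    ∑ k ∈ Finset.range n, growth A (i + 1) (j + 1) k + ∑ k ∈ Finset.range n, growth A i j k =
      ∑ k ∈ Finset.range n, growth A i (j + 1) k +
        ∑ k ∈ Finset.range n, growth A (i + 1) j k + A i j := by
  obtain ⟨N, rfl⟩ : ∃ N, n = N + 1 := ⟨n - 1, by omega⟩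
  rw [Finset.sum_range_succ' (fun k => growth A (i + 1) (j + 1) k)]
  rw [Finset.sum_range_succ' (fun k => growth A i (j + 1) k),
    Finset.sum_range_succ' (fun k => growth A (i + 1) j k), growth_succ_zero]
  have h1 : growth A i j N = 0 := (growth_isStripChain_left j).eq_zero (by omega)
  have h2 : growth A i (j + 1) N = 0 := (growth_isStripChain_left (j + 1)).eq_zero (by omega)
  have h3 : ∀ N, ∑ k ∈ Finset.range N, growth A (i + 1) (j + 1) (k + 1) +
      ∑ k ∈ Finset.range N, growth A i j k +
      max (growth A i (j + 1) 0) (growth A (i + 1) j 0) +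
      min (growth A i (j + 1) N) (growth A (i + 1) j N) =
      (∑ k ∈ Finset.range N, growth A i (j + 1) (k + 1) + growth A i (j + 1) 0) +
        (∑ k ∈ Finset.range N, growth A (i + 1) j (k + 1) + growth A (i + 1) j 0) := by
    intro N
    induction N with
    | zero => simp
    | succ N ih =>
      simp only [Finset.sum_range_succ, growth_succ_succ] at ih ⊢
      have := ((growth_strip (A := A) i j).1 N).1
      have := ((growth_strip (A := A) i j).2 N).1
      omega
  have := h3 N
  rw [Finset.sum_range_succ, h1]
  rw [h2] at this
  omega

theorem sum_growth {n : ℕ} {i j : ℕ} (hi : i ≤ n) : ∑ k ∈ Finset.range n, growth A i j k =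
    ∑ i' ∈ Finset.range i, ∑ j' ∈ Finset.range j, A i' j' := by
  induction i with
  | zero => simp
  | succ i ih =>
    rw [Finset.sum_range_succ, ← ih (by omega)]
    clear ih
    induction j with
    | zero => simp
    | succ j ih =>
      have := sum_growth_square (A := A) (j := j) (show i < n by omega)
      rw [Finset.sum_range_succ]
      omega

theorem growth_local_inverse {A' : ℕ → ℕ → ℕ} {i j : ℕ}
    (h1 : ∀ k, growth A (i + 1) (j + 1) k = growth A' (i + 1) (j + 1) k)
    (h2 : ∀ k, growth A i (j + 1) k = growth A' i (j + 1) k)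
    (h3 : ∀ k, growth A (i + 1) j k = growth A' (i + 1) j k) :
    (∀ k, growth A i j k = growth A' i j k) ∧ A i j = A' i j := by
  constructor
  · intro k
    have e1 := growth_succ_succ (A := A) i j k
    have e2 := growth_succ_succ (A := A') i j k
    have := ((growth_strip (A := A) i j).1 k).1
    have := ((growth_strip (A := A) i j).2 k).1
    have := ((growth_strip (A := A') i j).1 k).1
    have := ((growth_strip (A := A') i j).2 k).1
    simp only [h1, h2, h3] at *
    omega
  · have e1 := growth_succ_zero (A := A) i j
    have e2 := growth_succ_zero (A := A') i j
    rw [h1, h2, h3] at e1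
    omega

theorem eq_of_growth_eq {A' : ℕ → ℕ → ℕ} {n : ℕ}
    (h : ∀ i ≤ n, ∀ k, growth A i n k = growth A' i n k)
    (h' : ∀ j ≤ n, ∀ k, growth A n j k = growth A' n j k) {i j : ℕ} (hi : i < n) (hj : j < n) :
    A i j = A' i j := by
  have key : ∀ d ≤ n, ∀ e ≤ n, ∀ k, growth A (n - e) (n - d) k = growth A' (n - e) (n - d) k := by
    intro d
    induction d with
    | zero => intro _ e _ k; exact h _ (by omega) k
    | succ d ih =>
      intro hd e
      induction e with
      | zero => intro _ k; exact h' _ (by omega) k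
      | succ e ihe =>
        intro he
        have g1 := ih (by omega) e (by omega)
        have g2 := ih (by omega) (e + 1) he
        have g3 := ihe (by omega)
        rw [show n - e = n - (e + 1) + 1 by omega] at g1 g3
        rw [show n - d = n - (d + 1) + 1 by omega] at g1 g2
        exact (growth_local_inverse g1 g2 g3).1
  have key' : ∀ i ≤ n, ∀ j ≤ n, ∀ k, growth A i j k = growth A' i j k := by
    intro i hi j hj k
    have := key (n - j) (by omega) (n - i) (by omega) k
    rwa [show n - (n - i) = i by omega, show n - (n - j) = j by omega] at this
  exact (growth_local_inverse (key' (i + 1) hi (j + 1) hj) (key' i hi.le (j + 1) hj)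
    (key' (i + 1) hi j hj.le)).2

end Growth

section Rows

variable {c : ℕ → ℕ → ℕ} {n r : ℕ}

/-- The length of the `r`-th column of the partition `lam` with at most `n` parts. -/
def colLen (lam : ℕ → ℕ) (n r : ℕ) : ℕ := ((Finset.range n).filter fun k => r < lam k).card

theorem colLen_le (lam : ℕ → ℕ) (n r : ℕ) : colLen lam n r ≤ n :=
  (Finset.card_filter_le _ _).trans (Finset.card_range n).le

theorem lt_colLen_iff {lam : ℕ → ℕ} (h : Antitone lam) {k : ℕ} (hk : k < n) :
    k < colLen lam n r ↔ r < lam k := by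
  constructor
  · intro hlt
    by_contra hc
    have hsub : ((Finset.range n).filter fun k => r < lam k) ⊆ Finset.range k := fun k' hk' => by
      rw [Finset.mem_filter] at hk'
      rw [Finset.mem_range]
      by_contra h2
      exact hc (lt_of_lt_of_le hk'.2 (h (not_lt.1 h2)))
    have := Finset.card_le_card hsub
    rw [Finset.card_range] at this
    exact absurd hlt (not_lt.2 this)
  · intro hr
    have hsub : Finset.range (k + 1) ⊆ ((Finset.range n).filter fun k => r < lam k) :=
      fun k' hk' => by
        rw [Finset.mem_range] at hk'
        rw [Finset.mem_filter, Finset.mem_range]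
        exact ⟨by omega, lt_of_lt_of_le hr (h (by omega))⟩
    have := Finset.card_le_card hsub
    rw [Finset.card_range] at this
    exact this

theorem sum_colLen {lam : ℕ → ℕ} (h : Antitone lam) (n : ℕ) :
    ∑ r ∈ Finset.range (lam 0), colLen lam n r = ∑ k ∈ Finset.range n, lam k := by
  simp only [colLen, Finset.card_filter]
  rw [Finset.sum_comm]
  refine Finset.sum_congr rfl fun k _ => ?_
  rw [← Finset.card_filter]
  have : (Finset.range (lam 0)).filter (fun r => r < lam k) = Finset.range (lam k) := by
    ext r
    have := h (Nat.zero_le k)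
    simp only [Finset.mem_filter, Finset.mem_range]
    omega
  rw [this, Finset.card_range]

/-- The letter in box `(r, k)` of the tableau given by the chain `c`. -/
def letter (c : ℕ → ℕ → ℕ) (r k : ℕ) : ℕ := sInf {i | r < c (i + 1) k}

theorem IsStripChain.exists_lt (hc : IsStripChain c) {k : ℕ} (h : r < c n k) :
    ∃ i < n, r < c (i + 1) k := by
  cases n with
  | zero => rw [hc.zero] at h; omega
  | succ i => exact ⟨i, i.lt_succ_self, h⟩

theorem IsStripChain.letter_lt (hc : IsStripChain c) {k : ℕ} (h : r < c n k) :
    letter c r k < n := by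
  obtain ⟨i, hi, hr⟩ := hc.exists_lt h
  exact lt_of_le_of_lt (Nat.sInf_le hr) hi

theorem IsStripChain.lt_letter (hc : IsStripChain c) {k : ℕ} (h : r < c n k) :
    r < c (letter c r k + 1) k := by
  obtain ⟨i, -, hr⟩ := hc.exists_lt h
  exact Nat.sInf_mem (s := {i | r < c (i + 1) k}) ⟨i, hr⟩

theorem IsStripChain.letter_le (hc : IsStripChain c) (k : ℕ) : c (letter c r k) k ≤ r := by
  by_contra hcon
  obtain ⟨i, hi, hr⟩ := hc.exists_lt (not_le.1 hcon)
  exact Nat.notMem_of_lt_sInf hi hr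

theorem IsStripChain.letter_eq_iff (hc : IsStripChain c) {k i : ℕ} (h : r < c n k) :
    letter c r k = i ↔ c i k ≤ r ∧ r < c (i + 1) k := by
  constructor
  · rintro rfl
    exact ⟨hc.letter_le k, hc.lt_letter h⟩
  · rintro ⟨h1, h2⟩
    have h3 := hc.letter_le (r := r) k
    have h4 := hc.lt_letter h
    rcases lt_trichotomy (letter c r k) i with h5 | h5 | h5
    · have : c (letter c r k + 1) k ≤ c i k := hc.monotone k h5
      omega
    · exact h5
    · have : c (i + 1) k ≤ c (letter c r k) k := hc.monotone k h5
      omega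

theorem IsStripChain.letter_strict (hc : IsStripChain c) {k k' : ℕ} (hk : k < k') (h : r < c n k') :
    letter c r k < letter c r k' := by
  have step : ∀ k, r < c n (k + 1) → letter c r k < letter c r (k + 1) := by
    intro k h
    by_contra hcon
    have h1 : c (letter c r (k + 1) + 1) (k + 1) ≤ c (letter c r k + 1) (k + 1) :=
      hc.monotone (k + 1) (by omega)
    have h2 := hc.inter (letter c r k) k
    have h3 := hc.letter_le (r := r) k
    have h4 := hc.lt_letter h
    omega
  induction k', hk using Nat.le_induction with
  | base => exact step k h
  | succ k' hk ih =>
    exact (ih (lt_of_lt_of_le h (hc.antitone n k'.le_succ))).trans (step k' h)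

/-- The `r`-th row of the tableau given by the chain `c`, with letters in `Fin n`. -/
def rowFn (hc : IsStripChain c) (n r : ℕ) : Fin (colLen (c n) n r) → Fin n := fun k =>
  ⟨letter c r k, hc.letter_lt ((lt_colLen_iff (hc.antitone n)
    (lt_of_lt_of_le k.2 (colLen_le _ _ _))).1 k.2)⟩

theorem rowFn_strictMono (hc : IsStripChain c) : StrictMono (rowFn hc n r) := fun _ b hab =>
  hc.letter_strict hab ((lt_colLen_iff (hc.antitone n)
    (lt_of_lt_of_le b.2 (colLen_le _ _ _))).1 b.2)

theorem rowFn_eq_iff (hc : IsStripChain c) (k : Fin (colLen (c n) n r)) (i : Fin n) :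
    rowFn hc n r k = i ↔ c i k ≤ r ∧ r < c (i + 1) k := by
  rw [Fin.ext_iff]
  exact hc.letter_eq_iff ((lt_colLen_iff (hc.antitone n)
    (lt_of_lt_of_le k.2 (colLen_le _ _ _))).1 k.2)

/-- Conjugation of a sequence of indices by `fl b`. -/
def flConj (b : Bool) {l n : ℕ} (I : Fin l → Fin n) : Fin l → Fin n := fun x => fl b (I (fl b x))

theorem flConj_strictMono (b : Bool) {l n : ℕ} {I : Fin l → Fin n} (h : StrictMono I) :
    StrictMono (flConj b I) := by
  cases b
  · exact h
  · intro x y hxy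
    simp only [flConj, fl, if_true]
    exact Fin.rev_lt_rev.2 (h (Fin.rev_lt_rev.2 hxy))

theorem sum_expo_flConj (b : Bool) {l n t : ℕ} (h : l ≤ t) (I : Fin l → Fin n)
    {ι : Type} [DecidableEq ι] {f : Fin n → ι} (hf : Function.Injective f) (i : Fin n)
    (k : Fin t) : (∑ x, expo (f (flConj b I x)) (topIdx b h x)) (f (fl b i), fl b k) =
      if ∃ h : k < l, I ⟨k, h⟩ = i then 1 else 0 := by
  rw [Finset.sum_apply, ← Equiv.sum_comp (flEquiv b l)]
  have : ∀ x : Fin l, (expo (f (flConj b I (flEquiv b l x))) (topIdx b h (flEquiv b l x)) :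
      ι × Fin t → ℤ) (f (fl b i), fl b k) = if I x = i ∧ Fin.castLE h x = k then 1 else 0 := by
    intro x
    have e : flEquiv b l x = fl b x := rfl
    simp only [Pi.single_apply, Prod.mk.injEq, flConj, topIdx, e, fl_fl, hf.eq_iff,
      (fl_injective b _).eq_iff, eq_comm]
  rw [Finset.sum_congr rfl fun x _ => this x]
  split_ifs with hk
  · obtain ⟨hk, hI⟩ := hk
    rw [Finset.sum_eq_single ⟨k, hk⟩]
    · rw [if_pos ⟨hI, rfl⟩]
    · intro x _ hx
      exact if_neg fun h' => hx (Fin.ext (by simpa using congrArg Fin.val h'.2))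
    · simp
  · refine Finset.sum_eq_zero fun x _ => if_neg ?_
    rintro ⟨h1, rfl⟩
    exact hk ⟨x.2, h1⟩

theorem sum_rows_expo (b : Bool) {n t : ℕ} (hc : IsStripChain c)
    (h : ∀ r : Fin (c n 0), colLen (c n) n r ≤ t) (htn : t ≤ n)
    {ι : Type} [DecidableEq ι] {f : Fin n → ι} (hf : Function.Injective f) (i : Fin n)
    (k : Fin t) : (∑ r : Fin (c n 0), ∑ x, expo (f (flConj b (rowFn hc n r) x))
      (topIdx b (h r) x)) (f (fl b i), fl b k) = (c (i + 1) k : ℤ) - c i k := by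
  rw [Finset.sum_apply]
  have h1 : ∀ r : Fin (c n 0), (∑ x, expo (f (flConj b (rowFn hc n r) x)) (topIdx b (h r) x))
      (f (fl b i), fl b k) = if c i k ≤ r ∧ r < c (i + 1) k then 1 else 0 := by
    intro r
    rw [sum_expo_flConj b (h r) _ hf]
    refine if_congr ⟨?_, fun h' => ?_⟩ rfl rfl
    · rintro ⟨hk, hI⟩
      exact (rowFn_eq_iff hc _ i).1 hI
    · have hk : (k : ℕ) < colLen (c n) n r := (lt_colLen_iff (hc.antitone n)
        (lt_of_lt_of_le k.2 htn)).2 (lt_of_lt_of_le h'.2 (hc.monotone k i.2))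
      exact ⟨hk, (rowFn_eq_iff hc ⟨k, hk⟩ i).2 h'⟩
  rw [Finset.sum_congr rfl fun r _ => h1 r]
  have h2 : c (i + 1) k ≤ c n 0 := (hc.monotone k i.2).trans (hc.antitone n (Nat.zero_le _))
  have h3 := Fin.sum_univ_eq_sum_range (fun r => if c i k ≤ r ∧ r < c (i + 1) k then (1 : ℤ) else 0)
    (c n 0)
  rw [h3, ← Finset.sum_filter, Finset.sum_const, nsmul_one]
  have h4 : (Finset.range (c n 0)).filter (fun r => c i k ≤ r ∧ r < c (i + 1) k) =
      Finset.Ico (c i k) (c (i + 1) k) := by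
    ext r
    simp only [Finset.mem_filter, Finset.mem_range, Finset.mem_Ico]
    omega
  rw [h4, Nat.card_Ico, Nat.cast_sub (hc.mono _ _)]

end Rows

section Straightening

variable {K : Type} [Field K] {q : K} {E : Type} [Ring E] [Algebra K E] {u v : ℕ}

/-- The product of the entries of `x` along a word of positions. -/
def wordProd (x : Fin u → Fin v → E) (w : List (Fin u × Fin v)) : E :=
  (w.map fun p => x p.1 p.2).prod

@[simp] theorem wordProd_nil (x : Fin u → Fin v → E) : wordProd x [] = 1 := rfl

@[simp] theorem wordProd_cons (x : Fin u → Fin v → E) (p : Fin u × Fin v) (w) :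
    wordProd x (p :: w) = x p.1 p.2 * wordProd x w := by simp [wordProd]

theorem wordProd_append (x : Fin u → Fin v → E) (w w') :
    wordProd x (w ++ w') = wordProd x w * wordProd x w' := by simp [wordProd]

/-- The sum of the products `i * j` over the positions `(i, j)` of a word. -/
def wordWt (w : List (Fin u × Fin v)) : ℕ := (w.map fun p => (p.1 : ℕ) * p.2).sum

@[simp] theorem wordWt_cons (p : Fin u × Fin v) (w) :
    wordWt (p :: w) = (p.1 : ℕ) * p.2 + wordWt w := by simp [wordWt]

theorem wordWt_perm {w w' : List (Fin u × Fin v)} (h : w.Perm w') : wordWt w = wordWt w' :=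
  (h.map _).sum_eq

/-- The span of the words of length `d` and weight less than `c`. -/
def lowerWords (K : Type) [Field K] {E : Type} [Ring E] [Algebra K E] (x : Fin u → Fin v → E)
    (d c : ℕ) : Submodule K E :=
  Submodule.span K {y | ∃ w : List (Fin u × Fin v), w.length = d ∧ wordWt w < c ∧
    y = wordProd x w}

theorem cons_mul_mem_lowerWords {x : Fin u → Fin v → E} {d c : ℕ} (p : Fin u × Fin v) {y : E}
    (h : y ∈ lowerWords K x d c) :
    x p.1 p.2 * y ∈ lowerWords K x (d + 1) ((p.1 : ℕ) * p.2 + c) := by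
  induction h using Submodule.span_induction with
  | mem y hy =>
    obtain ⟨w, rfl, hw, rfl⟩ := hy
    exact Submodule.subset_span ⟨p :: w, rfl, by rw [wordWt_cons]; omega,
      (wordProd_cons _ _ _).symm⟩
  | zero => rw [mul_zero]; exact zero_mem _
  | add y z _ _ hy hz => rw [mul_add]; exact add_mem hy hz
  | smul a y _ hy => rw [mul_smul_comm]; exact Submodule.smul_mem _ _ hy

theorem mul_word_mem_lowerWords {x : Fin u → Fin v → E} {d c : ℕ} (w : List (Fin u × Fin v))
    {y : E} (h : y ∈ lowerWords K x d c) :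
    y * wordProd x w ∈ lowerWords K x (d + w.length) (c + wordWt w) := by
  induction h using Submodule.span_induction with
  | mem y hy =>
    obtain ⟨w', rfl, hw, rfl⟩ := hy
    refine Submodule.subset_span ⟨w' ++ w, List.length_append, ?_, (wordProd_append _ _ _).symm⟩
    rw [wordWt, List.map_append, List.sum_append]
    exact Nat.add_lt_add_right hw _
  | zero => rw [zero_mul]; exact zero_mem _
  | add y z _ _ hy hz => rw [add_mul]; exact add_mem hy hz
  | smul a y _ hy => rw [smul_mul_assoc]; exact Submodule.smul_mem _ _ hy

theorem swap_mem_lowerWords (hq : q ≠ 0) {x : Fin u → Fin v → E} (hx : IsQMat q x)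
    (a b : Fin u × Fin v) : ∃ e : K, x a.1 a.2 * x b.1 b.2 - e • (x b.1 b.2 * x a.1 a.2) ∈
      lowerWords K x 2 (wordWt [a, b]) := by
  obtain ⟨i, j⟩ := a
  obtain ⟨k, l⟩ := b
  simp only
  have hlow : ∀ {i k : Fin u} {j l : Fin v} {c : ℕ}, i < k → j < l →
      c = (i : ℕ) * j + k * l → x i l * x k j ∈ lowerWords K x 2 c := by
    intro i k j l c h h' hc
    refine Submodule.subset_span ⟨[(i, l), (k, j)], rfl, ?_, by simp⟩
    rw [hc, wordWt_cons, wordWt_cons, wordWt, List.map_nil, List.sum_nil, add_zero]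
    simp only
    rw [Fin.lt_def] at h h'
    obtain ⟨s, hs⟩ := Nat.exists_eq_add_of_lt h
    obtain ⟨r, hr⟩ := Nat.exists_eq_add_of_lt h'
    rw [hs, hr]
    nlinarith
  have hcomm : ∀ {i k : Fin u} {j l : Fin v}, x i j * x k l = x k l * x i j →
      ∃ e : K, x i j * x k l - e • (x k l * x i j) ∈ lowerWords K x 2 (wordWt [(i, j), (k, l)]) :=
    fun h => ⟨1, by rw [h, one_smul, sub_self]; exact zero_mem _⟩
  rcases lt_trichotomy i k with h | rfl | h <;> rcases lt_trichotomy j l with h' | rfl | h'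
  · refine ⟨1, ?_⟩
    rw [hx.quantum h h', one_smul, add_sub_cancel_left]
    exact Submodule.smul_mem _ _ (hlow h h' (by simp [wordWt]))
  · exact ⟨q, by rw [hx.col h, sub_self]; exact zero_mem _⟩
  · exact hcomm (hx.comm h h')
  · exact ⟨q, by rw [hx.row h', sub_self]; exact zero_mem _⟩
  · exact hcomm rfl
  · exact ⟨q⁻¹, by rw [hx.row_inv hq h', sub_self]; exact zero_mem _⟩
  · exact hcomm (hx.comm h h').symm
  · refine ⟨q⁻¹, ?_⟩
    rw [hx.col h, smul_smul, inv_mul_cancel₀ hq, one_smul, sub_self]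
    exact zero_mem _
  · refine ⟨1, ?_⟩
    rw [hx.quantum h h', one_smul, sub_add_cancel_left]
    exact neg_mem (Submodule.smul_mem _ _ (hlow h h' (by simp [wordWt, add_comm])))

theorem wordProd_perm (hq : q ≠ 0) {x : Fin u → Fin v → E} (hx : IsQMat q x)
    {w w' : List (Fin u × Fin v)} (h : w.Perm w') :
    ∃ e : K, wordProd x w - e • wordProd x w' ∈ lowerWords K x w.length (wordWt w) := by
  induction h with
  | nil => exact ⟨1, by simp⟩
  | cons p h ih =>
    obtain ⟨e, he⟩ := ih
    refine ⟨e, ?_⟩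
    have := cons_mul_mem_lowerWords p he
    rw [mul_sub, mul_smul_comm] at this
    simpa using this
  | swap a b l =>
    obtain ⟨e, he⟩ := swap_mem_lowerWords hq hx b a
    refine ⟨e, ?_⟩
    have := mul_word_mem_lowerWords l he
    rw [sub_mul, smul_mul_assoc, mul_assoc, mul_assoc] at this
    rw [show 2 + l.length = (b :: a :: l).length by simp only [List.length_cons]; omega,
      show wordWt [b, a] + wordWt l = wordWt (b :: a :: l) by
        simp only [wordWt, List.map_cons, List.map_nil, List.sum_cons, List.sum_nil]; omega] at this
    simpa only [wordProd_cons] using this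
  | trans h1 h2 ih1 ih2 =>
    obtain ⟨e1, he1⟩ := ih1
    obtain ⟨e2, he2⟩ := ih2
    refine ⟨e1 * e2, ?_⟩
    rw [← wordWt_perm h1, ← h1.length_eq] at he2
    have := add_mem he1 (Submodule.smul_mem _ e1 he2)
    rwa [smul_sub, smul_smul, sub_add_sub_cancel] at this

/-- The span of all words of length `d`. -/
def degSpan (K : Type) [Field K] {E : Type} [Ring E] [Algebra K E] (x : Fin u → Fin v → E)
    (d : ℕ) : Submodule K E :=
  Submodule.span K {y | ∃ w : List (Fin u × Fin v), w.length = d ∧ y = wordProd x w}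

theorem degSpan_le_span_sym (hq : q ≠ 0) {x : Fin u → Fin v → E} (hx : IsQMat q x) (d : ℕ) :
    degSpan K x d ≤ Submodule.span K
      (Set.range fun m : Sym (Fin u × Fin v) d => wordProd x m.1.toList) := by
  refine Submodule.span_le.2 ?_
  rintro _ ⟨w, hw, rfl⟩
  induction hc : wordWt w using Nat.strong_induction_on generalizing w with
  | _ c ih =>
    have hcard : Multiset.card (w : Multiset (Fin u × Fin v)) = d := by simpa using hw
    have hp : w.Perm (w : Multiset (Fin u × Fin v)).toList := by
      rw [← Multiset.coe_eq_coe, Multiset.coe_toList]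
    obtain ⟨e, he⟩ := wordProd_perm hq hx hp
    have h1 : lowerWords K x w.length (wordWt w) ≤ Submodule.span K
        (Set.range fun m : Sym (Fin u × Fin v) d => wordProd x m.1.toList) := by
      refine Submodule.span_le.2 ?_
      rintro _ ⟨w', hw', hlt, rfl⟩
      exact ih _ (hc ▸ hlt) w' (hw'.trans hw) rfl
    have h2 := add_mem (h1 he) (Submodule.smul_mem _ e
      (Submodule.subset_span (Set.mem_range_self (f := fun m : Sym (Fin u × Fin v) d =>
        wordProd x m.1.toList) ⟨(w : Multiset (Fin u × Fin v)), hcard⟩)))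
    simpa using h2

theorem mul_mem_degSpan {x : Fin u → Fin v → E} {d d' : ℕ} {y z : E} (hy : y ∈ degSpan K x d)
    (hz : z ∈ degSpan K x d') : y * z ∈ degSpan K x (d + d') := by
  have h1 : degSpan K x d * degSpan K x d' ≤ degSpan K x (d + d') := by
    rw [degSpan, degSpan, Submodule.span_mul_span]
    refine Submodule.span_mono ?_
    rintro _ ⟨_, ⟨w, rfl, rfl⟩, _, ⟨w', rfl, rfl⟩, rfl⟩
    exact ⟨w ++ w', List.length_append.symm ▸ rfl, (wordProd_append _ _ _).symm⟩
  exact h1 (Submodule.mul_mem_mul hy hz)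

theorem prod_ofFn_mem_degSpan {x : Fin u → Fin v → E} {l : ℕ} {f : Fin l → E} {d : Fin l → ℕ}
    (h : ∀ i, f i ∈ degSpan K x (d i)) : (List.ofFn f).prod ∈ degSpan K x (∑ i, d i) := by
  induction l with
  | zero => exact Submodule.subset_span ⟨[], by simp, by simp⟩
  | succ l ih =>
    rw [List.ofFn_succ, List.prod_cons, Fin.sum_univ_succ]
    exact mul_mem_degSpan (h 0) (ih fun i => h _)

theorem qdet_mem_degSpan {x : Fin u → Fin v → E} {l : ℕ} (R : Fin l → Fin u) (C : Fin l → Fin v) :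
    qdet q x R C ∈ degSpan K x l := by
  refine sum_mem fun σ _ => Submodule.smul_mem _ _ ?_
  have := prod_ofFn_mem_degSpan (K := K) (x := x) (f := fun i => x (R i) (C (σ i)))
    (d := fun _ => 1) fun i => Submodule.subset_span ⟨[(R i, C (σ i))], rfl, by simp⟩
  simpa using this

theorem iSup_degSpan_eq_top : ⨆ d, degSpan K (Xg K q : Fin u → Fin v → OqM K q u v) d = ⊤ := by
  have h1 : ⨆ d, degSpan K (Xg K q : Fin u → Fin v → OqM K q u v) d = Submodule.span K
      {y | ∃ w : List (Fin u × Fin v), y = wordProd (Xg K q) w} := by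
    simp only [degSpan]
    rw [← Submodule.span_iUnion]
    congr 1
    ext y
    simp
  rw [h1, eq_top_iff]
  rintro y -
  induction y using oqM_induction with
  | hs c =>
    rw [Algebra.algebraMap_eq_smul_one]
    exact Submodule.smul_mem _ _ (Submodule.subset_span ⟨[], by simp⟩)
  | hX i j => exact Submodule.subset_span ⟨[(i, j)], by simp⟩
  | hm a b ha hb =>
    refine Submodule.span_mono ?_ ((Submodule.span_mul_span K _ _).le (Submodule.mul_mem_mul ha hb))
    rintro _ ⟨_, ⟨w, rfl⟩, _, ⟨w', rfl⟩, rfl⟩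
    exact ⟨w ++ w', (wordProd_append _ _ _).symm⟩
  | ha a b ha hb => exact add_mem ha hb

theorem span_wordProd_toList_eq_top (hq : q ≠ 0) :
    Submodule.span K (Set.range fun m : Multiset (Fin u × Fin v) =>
      wordProd (Xg K q : Fin u → Fin v → OqM K q u v) m.toList) = ⊤ := by
  rw [eq_top_iff, ← iSup_degSpan_eq_top]
  refine iSup_le fun d => (degSpan_le_span_sym hq isQMat_Xg d).trans (Submodule.span_mono ?_)
  rintro _ ⟨m, rfl⟩
  exact ⟨m.1, rfl⟩

theorem span_eq_top_of_linearIndependent (hq : q ≠ 0)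
    {T : Multiset (Fin u × Fin v) → OqM K q u v} (hT : LinearIndependent K T)
    (hmem : ∀ m, T m ∈ degSpan K (Xg K q) (Multiset.card m)) :
    Submodule.span K (Set.range T) = ⊤ := by
  rw [eq_top_iff, ← iSup_degSpan_eq_top]
  refine iSup_le fun d => ?_
  have hli : LinearIndependent K fun m : Sym (Fin u × Fin v) d => T m.1 :=
    hT.comp _ Subtype.val_injective
  have h1 := degSpan_le_span_sym (K := K) hq
    (isQMat_Xg (K := K) (q := q) (u := u) (v := v)) d
  have h2 : Submodule.span K (Set.range fun m : Sym (Fin u × Fin v) d => T m.1) ≤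
      degSpan K (Xg K q) d := by
    refine Submodule.span_le.2 ?_
    rintro _ ⟨m, rfl⟩
    have := hmem m.1
    rwa [m.2] at this
  have hfin : FiniteDimensional K (Submodule.span K (Set.range fun m : Sym (Fin u × Fin v) d =>
      wordProd (Xg K q : Fin u → Fin v → OqM K q u v) m.1.toList)) :=
    FiniteDimensional.span_of_finite K (Set.finite_range _)
  have h3 := Submodule.eq_of_le_of_finrank_le (h2.trans h1)
    ((finrank_range_le_card _).trans (finrank_span_eq_card hli).ge)
  refine h1.trans (h3.ge.trans (Submodule.span_mono ?_))
  rintro _ ⟨m, rfl⟩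
  exact ⟨m.1, rfl⟩

end Straightening

section StandardProducts

variable {K : Type} [Field K] {q : K} {E : Type} [Ring E] [Algebra K E] {n t : ℕ}

/-- The matrix of multiplicities of a multiset of positions. -/
def countMat (m : Multiset (Fin n × Fin n)) : ℕ → ℕ → ℕ := fun i j =>
  if h : i < n ∧ j < n then m.count (⟨i, h.1⟩, ⟨j, h.2⟩) else 0

theorem countMat_apply (m : Multiset (Fin n × Fin n)) (i j : Fin n) :
    countMat m i j = m.count (i, j) := dif_pos ⟨i.2, j.2⟩

theorem sum_countMat (m : Multiset (Fin n × Fin n)) :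
    ∑ i ∈ Finset.range n, ∑ j ∈ Finset.range n, countMat m i j = Multiset.card m := by
  rw [Finset.sum_range, ← Multiset.sum_count_eq_card (s := Finset.univ) (by simp),
    Fintype.sum_prod_type]
  refine Finset.sum_congr rfl fun i _ => ?_
  rw [Finset.sum_range]
  exact Finset.sum_congr rfl fun j _ => countMat_apply m i j

/-- The shape associated with a multiset of positions by the Robinson–Schensted–Knuth
correspondence. -/
def shape (m : Multiset (Fin n × Fin n)) : ℕ → ℕ := growth (countMat m) n n

theorem shape_antitone (m : Multiset (Fin n × Fin n)) : Antitone (shape m) :=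
  (growth_isStripChain_left (A := countMat m) n).antitone n

/-- The rows of the first tableau. -/
def rowI (m : Multiset (Fin n × Fin n)) (r : ℕ) : Fin (colLen (shape m) n r) → Fin n :=
  rowFn (growth_isStripChain_left (A := countMat m) n) n r

/-- The rows of the second tableau. -/
def rowJ (m : Multiset (Fin n × Fin n)) (r : ℕ) : Fin (colLen (shape m) n r) → Fin n :=
  rowFn (growth_isStripChain_right (A := countMat m) n) n r

theorem rowI_strictMono (m : Multiset (Fin n × Fin n)) (r : ℕ) : StrictMono (rowI m r) :=
  rowFn_strictMono _

theorem rowJ_strictMono (m : Multiset (Fin n × Fin n)) (r : ℕ) : StrictMono (rowJ m r) :=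
  rowFn_strictMono _

/-- The minor given by the `r`-th rows of the two tableaux. -/
def stdMinor (q : K) (b : Bool) (x : Fin n → Fin n → E) (m : Multiset (Fin n × Fin n)) (r : ℕ) :
    E := qdet q x (flConj b (rowI m r)) (flConj b (rowJ m r))

/-- The product of minors given by the pair of tableaux. -/
def stdProd (q : K) (b : Bool) (x : Fin n → Fin n → E) (m : Multiset (Fin n × Fin n)) : E :=
  (List.ofFn fun r : Fin (shape m 0) => stdMinor q b x m r).prod

theorem map_stdProd {E' : Type} [Ring E'] [Algebra K E'] (f : E →ₐ[K] E') (b : Bool)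
    (x : Fin n → Fin n → E) (m : Multiset (Fin n × Fin n)) :
    f (stdProd q b x m) = stdProd q b (fun i j => f (x i j)) m := by
  rw [stdProd, stdProd, map_list_prod, List.map_ofFn]
  congr 2
  funext r
  exact map_qdet f x _ _

theorem stdProd_mem_degSpan (b : Bool) (x : Fin n → Fin n → E) (m : Multiset (Fin n × Fin n)) :
    stdProd q b x m ∈ degSpan K x (Multiset.card m) := by
  have h1 : ∑ r : Fin (shape m 0), colLen (shape m) n r = Multiset.card m := by
    rw [← Finset.sum_range (fun r => colLen (shape m) n r), sum_colLen (shape_antitone m),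
      ← sum_countMat, ← sum_growth le_rfl]
    rfl
  rw [← h1]
  exact prod_ofFn_mem_degSpan fun r => qdet_mem_degSpan _ _

theorem colLen_shape_le {m : Multiset (Fin n × Fin n)} (htn : t ≤ n) (h : shape m t = 0) (r : ℕ) :
    colLen (shape m) n r ≤ t := by
  rcases htn.lt_or_eq with hlt | rfl
  · refine not_lt.1 fun hc => ?_
    have := (lt_colLen_iff (shape_antitone m) hlt).1 hc
    omega
  · exact colLen_le _ _ _

/-- The leading exponent of a standard product. -/
def stdExpo (b : Bool) (t : ℕ) (htn : t ≤ n) (m : {m : Multiset (Fin n × Fin n) // shape m t = 0}) :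
    (Fin n ⊕ Fin n) × Fin t → ℤ :=
  ∑ r : Fin (shape m.1 0), minorExpo b (colLen_shape_le htn m.2 r) (flConj b (rowI m.1 r))
    (flConj b (rowJ m.1 r))

theorem stdProd_isLead (hq : q ≠ 0) (b : Bool) (htn : t ≤ n)
    (m : {m : Multiset (Fin n × Fin n) // shape m t = 0}) : IsLead (torWt b n t)
      (stdProd q b (fun i j => ∑ k, repY q n t i k * repZ q n t k j) m.1) (stdExpo b t htn m) :=
  IsLead.prod_ofFn fun r => qdet_rep_isLead hq b _ (flConj_strictMono b (rowI_strictMono m.1 r))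
    (flConj_strictMono b (rowJ_strictMono m.1 r))

theorem sum_expo_apply_of_ne {ι : Type} [DecidableEq ι] {l : ℕ} (f : Fin l → ι)
    (g : Fin l → Fin t) {i : ι} (h : ∀ x, f x ≠ i) (k : Fin t) :
    (∑ x, expo (f x) (g x)) (i, k) = 0 := by
  rw [Finset.sum_apply]
  refine Finset.sum_eq_zero fun x _ => ?_
  exact Pi.single_eq_of_ne (fun h' => h x (congrArg Prod.fst h').symm) _

theorem stdExpo_inl (b : Bool) (htn : t ≤ n) (m : {m : Multiset (Fin n × Fin n) // shape m t = 0})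
    (i : Fin n) (k : Fin t) : stdExpo b t htn m (Sum.inl (fl b i), fl b k) =
      (growth (countMat m.1) (i + 1) n k : ℤ) - growth (countMat m.1) i n k := by
  rw [← sum_rows_expo b (growth_isStripChain_left (A := countMat m.1) n)
    (fun r => colLen_shape_le htn m.2 r) htn (Sum.inl_injective (β := Fin n)) i k, stdExpo,
    Finset.sum_apply, Finset.sum_apply]
  refine Finset.sum_congr rfl fun r _ => ?_
  rw [minorExpo, Pi.add_apply, sum_expo_apply_of_ne (fun x => Sum.inr _) _ (by simp), add_zero]
  rfl

theorem stdExpo_inr (b : Bool) (htn : t ≤ n) (m : {m : Multiset (Fin n × Fin n) // shape m t = 0})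
    (j : Fin n) (k : Fin t) : stdExpo b t htn m (Sum.inr (fl b j), fl b k) =
      (growth (countMat m.1) n (j + 1) k : ℤ) - growth (countMat m.1) n j k := by
  rw [← sum_rows_expo b (growth_isStripChain_right (A := countMat m.1) n)
    (fun r => colLen_shape_le htn m.2 r) htn (Sum.inr_injective (α := Fin n)) j k, stdExpo,
    Finset.sum_apply, Finset.sum_apply]
  refine Finset.sum_congr rfl fun r _ => ?_
  rw [minorExpo, Pi.add_apply, sum_expo_apply_of_ne (fun x => Sum.inl _) _ (by simp), zero_add]
  rfl

theorem IsStripChain.eq_of_sub_eq {c c' : ℕ → ℕ → ℕ} (hc : IsStripChain c) (hc' : IsStripChain c')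
    (ht : c n t = 0) (ht' : c' n t = 0) (h : ∀ (i : Fin n) (k : Fin t),
      (c (i + 1) k : ℤ) - c i k = c' (i + 1) k - c' i k) : ∀ i ≤ n, ∀ k, c i k = c' i k := by
  intro i hi k
  by_cases hk : k < t
  · induction i with
    | zero => rw [hc.zero, hc'.zero]
    | succ i ih =>
      have := h ⟨i, hi⟩ ⟨k, hk⟩
      rw [ih (by omega)] at this
      simp only at this
      omega
  · have h1 : c i k ≤ c n k := hc.monotone k hi
    have h2 : c' i k ≤ c' n k := hc'.monotone k hi
    have h3 := hc.antitone n (not_lt.1 hk)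
    have h4 := hc'.antitone n (not_lt.1 hk)
    omega

theorem stdExpo_injective (b : Bool) (htn : t ≤ n) :
    Function.Injective (stdExpo (n := n) b t htn) := by
  intro m m' h
  apply Subtype.ext
  rw [Multiset.ext]
  rintro ⟨i, j⟩
  rw [← countMat_apply, ← countMat_apply]
  refine eq_of_growth_eq ?_ ?_ i.2 j.2
  · exact (growth_isStripChain_left n).eq_of_sub_eq (growth_isStripChain_left n) m.2 m'.2
      fun i k => by rw [← stdExpo_inl b htn, h, stdExpo_inl]
  · exact (growth_isStripChain_right n).eq_of_sub_eq (growth_isStripChain_right n) m.2 m'.2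
      fun i k => by rw [← stdExpo_inr b htn, h, stdExpo_inr]

/-- The algebra map to the torus induced by the product of the representing matrices. -/
def repX (hq : q ≠ 0) (n t : ℕ) :
    OqM K q n n →ₐ[K] Module.End K (((Fin n ⊕ Fin n) × Fin t → ℤ) →₀ K) :=
  qmLift ((repY_isQMat hq).mul hq (repZ_isQMat hq) (repY_commute_repZ (n := n) (t := t) hq))

theorem repX_stdProd (hq : q ≠ 0) (b : Bool) (m : Multiset (Fin n × Fin n)) :
    repX hq n t (stdProd q b (Xg K q) m) =
      stdProd q b (fun i j => ∑ k, repY q n t i k * repZ q n t k j) m := by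
  refine (map_stdProd (E := OqM K q n n)
    (E' := Module.End K (((Fin n ⊕ Fin n) × Fin t → ℤ) →₀ K)) (repX hq n t) b (Xg K q) m).trans ?_
  simp only [repX, qmLift_Xg]

theorem repX_stdProd_apply (hq : q ≠ 0) (b : Bool) (htn : t ≤ n)
    (m : {m : Multiset (Fin n × Fin n) // shape m t = 0}) : ∃ c : K, c ≠ 0 ∧
      repX hq n t (stdProd q b (Xg K q) m.1) (Finsupp.single 0 1) -
        Finsupp.single (stdExpo b t htn m) c ∈
          filtLT K (torWt b n t) (torWt b n t (stdExpo b t htn m)) := by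
  rw [repX_stdProd]
  exact (stdProd_isLead hq b htn m).apply_zero

theorem span_stdProd_eq_top (hq : q ≠ 0) (b : Bool) (n : ℕ) :
    Submodule.span K (Set.range (stdProd q b (Xg K q : Fin n → Fin n → OqM K q n n))) = ⊤ := by
  refine span_eq_top_of_linearIndependent hq ?_ (stdProd_mem_degSpan (E := OqM K q n n) b _)
  have h0 : ∀ m : Multiset (Fin n × Fin n), shape m n = 0 := fun m =>
    (growth_isStripChain_left n).eq_zero le_rfl
  have h1 : LinearIndependent K fun m : Multiset (Fin n × Fin n) =>
      repX hq n n (stdProd q b (Xg K q) m) (Finsupp.single 0 1) :=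
    triangular_linearIndependent (wt := torWt b n n)
      (v := fun m => stdExpo b n le_rfl ⟨m, h0 m⟩)
      (fun m m' h => congrArg Subtype.val (stdExpo_injective b le_rfl h))
      fun m => repX_stdProd_apply hq b le_rfl ⟨m, h0 m⟩
  exact LinearIndependent.of_comp
    ((LinearMap.applyₗ (Finsupp.single 0 1)).comp (repX hq n n).toLinearMap) h1

theorem mkle_stdProd_eq_zero (b : Bool) (htn : t < n) {m : Multiset (Fin n × Fin n)}
    (h : shape m t ≠ 0) : mkle K q n n t (stdProd q b (Xg K q) m) = 0 := by
  have h0 : 0 < shape m 0 := lt_of_lt_of_le (Nat.pos_of_ne_zero h) (shape_antitone m t.zero_le)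
  rw [stdProd, map_list_prod, List.map_ofFn]
  refine List.prod_eq_zero (List.mem_ofFn.2 ⟨⟨0, h0⟩, ?_⟩)
  have hl : t + 1 ≤ colLen (shape m) n 0 :=
    (lt_colLen_iff (shape_antitone m) htn).2 (Nat.pos_of_ne_zero h)
  have key : ∀ (l : ℕ) (R C : Fin l → Fin n), t + 1 ≤ l → StrictMono R → StrictMono C →
      mkle K q n n t (qMinor K q R C) = 0 := by
    intro l R C hl hR hC
    obtain ⟨d, rfl⟩ := Nat.exists_eq_add_of_le hl
    exact mkle_qMinor_eq_zero d R C hR hC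
  exact key _ _ _ hl (flConj_strictMono b (rowI_strictMono m 0))
    (flConj_strictMono b (rowJ_strictMono m 0))

end StandardProducts

section Ideals

variable {K : Type} [Field K] {R : Type} [Ring R] [Algebra K R]

/-- The set `P` is a two-sided ideal, regarded as a subset of the `K`-algebra `R`. -/
structure IsTwoSided (K : Type) [Field K] {R : Type} [Ring R] [Algebra K R] (P : Set R) :
    Prop where
  exists_submodule : ∃ S : Submodule K R, (S : Set R) = P
  mul_left : ∀ a, ∀ x ∈ P, a * x ∈ P
  mul_right : ∀ a, ∀ x ∈ P, x * a ∈ P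

theorem IsTwoSided.sum_smul_mem {P : Set R} (hP : IsTwoSided K P) {α : Type} (s : Finset α)
    (c : α → K) {f : α → R} (h : ∀ i ∈ s, f i ∈ P) : ∑ i ∈ s, c i • f i ∈ P := by
  obtain ⟨S, rfl⟩ := hP.exists_submodule
  exact sum_mem fun i hi => Submodule.smul_mem _ _ (h i hi)

theorem isTwoSided_tsSpan (S : Set R) : IsTwoSided K (tsSpan K R S) where
  exists_submodule := ⟨_, rfl⟩
  mul_left r x hx := by
    refine Submodule.span_induction (p := fun x _ => r * x ∈ tsSpan K R S) ?_ ?_ ?_ ?_ hx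
    · rintro _ ⟨a, b, s, hs, rfl⟩
      exact Submodule.subset_span ⟨r * a, b, s, hs, by simp only [mul_assoc]⟩
    · rw [mul_zero]; exact zero_mem (Submodule.span K _)
    · intro x y _ _ hx hy
      rw [mul_add]; exact Submodule.add_mem (Submodule.span K _) hx hy
    · intro c x _ hx
      rw [mul_smul_comm]; exact Submodule.smul_mem (Submodule.span K _) c hx
  mul_right r x hx := by
    refine Submodule.span_induction (p := fun x _ => x * r ∈ tsSpan K R S) ?_ ?_ ?_ ?_ hx
    · rintro _ ⟨a, b, s, hs, rfl⟩
      exact Submodule.subset_span ⟨a, b * r, s, hs, by simp only [mul_assoc]⟩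
    · rw [zero_mul]; exact zero_mem (Submodule.span K _)
    · intro x y _ _ hx hy
      rw [add_mul]; exact Submodule.add_mem (Submodule.span K _) hx hy
    · intro c x _ hx
      rw [smul_mul_assoc]; exact Submodule.smul_mem (Submodule.span K _) c hx

theorem IsTwoSided.mulSet {P Q : Set R} (hP : IsTwoSided K P) (hQ : IsTwoSided K Q) :
    IsTwoSided K (mulSet K R P Q) where
  exists_submodule := ⟨_, rfl⟩
  mul_left r x hx := by
    refine Submodule.span_induction (p := fun x _ => r * x ∈ _root_.mulSet K R P Q) ?_ ?_ ?_ ?_ hx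
    · rintro _ ⟨a, ha, b, hb, rfl⟩
      exact Submodule.subset_span ⟨r * a, hP.mul_left r a ha, b, hb, (mul_assoc _ _ _).symm⟩
    · rw [mul_zero]; exact zero_mem (Submodule.span K _)
    · intro x y _ _ hx hy
      rw [mul_add]; exact Submodule.add_mem (Submodule.span K _) hx hy
    · intro c x _ hx
      rw [mul_smul_comm]; exact Submodule.smul_mem (Submodule.span K _) c hx
  mul_right r x hx := by
    refine Submodule.span_induction (p := fun x _ => x * r ∈ _root_.mulSet K R P Q) ?_ ?_ ?_ ?_ hx
    · rintro _ ⟨a, ha, b, hb, rfl⟩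
      exact Submodule.subset_span ⟨a, ha, b * r, hQ.mul_right r b hb, mul_assoc _ _ _⟩
    · rw [zero_mul]; exact zero_mem (Submodule.span K _)
    · intro x y _ _ hx hy
      rw [add_mul]; exact Submodule.add_mem (Submodule.span K _) hx hy
    · intro c x _ hx
      rw [smul_mul_assoc]; exact Submodule.smul_mem (Submodule.span K _) c hx

theorem IsTwoSided.idealPow {P : Set R} (hP : IsTwoSided K P) (s : ℕ) :
    IsTwoSided K (idealPow K R P s) := by
  induction s with
  | zero => exact ⟨⟨⊤, rfl⟩, fun _ _ _ => trivial, fun _ _ _ => trivial⟩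
  | succ s ih => exact ih.mulSet hP

theorem IsTwoSided.prod_mem_idealPow {P : Set R} (hP : IsTwoSided K P) {g : ℕ → R} {s m : ℕ}
    (hsm : s ≤ m) (h : ∀ r < s, g r ∈ P) :
    (List.ofFn fun r : Fin m => g r).prod ∈ _root_.idealPow K R P s := by
  induction m, hsm using Nat.le_induction with
  | base =>
    induction s with
    | zero => trivial
    | succ s ih =>
      rw [List.ofFn_succ', List.concat_eq_append, List.prod_append, List.prod_singleton]
      exact Submodule.subset_span ⟨_, ih fun r hr => h r (by omega), _, h s (by omega), rfl⟩
  | succ m _ ih =>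
    rw [List.ofFn_succ', List.concat_eq_append, List.prod_append, List.prod_singleton]
    exact (hP.idealPow s).mul_right _ _ ih

theorem pow_normal {d : R} (hd : ∀ a, ∃ a', a * d = d * a') (s : ℕ) (a : R) :
    ∃ a', a * d ^ s = d ^ s * a' := by
  induction s generalizing a with
  | zero => exact ⟨a, by simp⟩
  | succ s ih =>
    obtain ⟨a', ha'⟩ := ih a
    obtain ⟨a'', ha''⟩ := hd a'
    exact ⟨a'', by rw [pow_succ, ← mul_assoc, ha', mul_assoc, ha'', mul_assoc]⟩

theorem mem_tsSpan_singleton_iff {d : R} (hd : ∀ a, ∃ a', a * d = d * a') {x : R} :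
    x ∈ tsSpan K R {d} ↔ ∃ y, x = d * y := by
  constructor
  · intro hx
    refine Submodule.span_induction (p := fun x _ => ∃ y, x = d * y) ?_ ?_ ?_ ?_ hx
    · rintro _ ⟨a, b, _, rfl, rfl⟩
      obtain ⟨a', ha'⟩ := hd a
      exact ⟨a' * b, by rw [ha', mul_assoc]⟩
    · exact ⟨0, (mul_zero d).symm⟩
    · rintro x y _ _ ⟨x, rfl⟩ ⟨y, rfl⟩
      exact ⟨x + y, (mul_add _ _ _).symm⟩
    · rintro c x _ ⟨x, rfl⟩
      exact ⟨c • x, (mul_smul_comm _ _ _).symm⟩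
  · rintro ⟨y, rfl⟩
    exact Submodule.subset_span ⟨1, y, d, rfl, by rw [one_mul]⟩

theorem map_mem_of_mem_idealPow {B : Type} [Ring B] [Algebra K B] (f : R →ₐ[K] B) {d : B}
    (hd : ∀ a, ∃ a', a * d = d * a') {G : Set R} (hG : ∀ g ∈ G, ∃ y, f g = d * y) {s : ℕ} {x : R}
    (hx : x ∈ idealPow K R (tsSpan K R G) s) : ∃ y, f x = d ^ s * y := by
  have h1 : ∀ x ∈ tsSpan K R G, ∃ y, f x = d * y := by
    intro x hx
    refine Submodule.span_induction (p := fun x _ => ∃ y, f x = d * y) ?_ ?_ ?_ ?_ hx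
    · rintro _ ⟨a, b, g, hg, rfl⟩
      obtain ⟨y, hy⟩ := hG g hg
      obtain ⟨a', ha'⟩ := hd (f a)
      exact ⟨a' * y * f b, by rw [map_mul, map_mul, hy, ← mul_assoc, ha']; simp only [mul_assoc]⟩
    · exact ⟨0, by simp⟩
    · rintro x y _ _ ⟨x', hx'⟩ ⟨y', hy'⟩
      exact ⟨x' + y', by rw [map_add, hx', hy', mul_add]⟩
    · rintro c x _ ⟨x', hx'⟩
      exact ⟨c • x', by rw [map_smul, hx', mul_smul_comm]⟩
  induction s generalizing x with
  | zero => exact ⟨f x, by simp⟩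
  | succ s ih =>
    refine Submodule.span_induction (p := fun x _ => ∃ y, f x = d ^ (s + 1) * y) ?_ ?_ ?_ ?_ hx
    · rintro _ ⟨a, ha, b, hb, rfl⟩
      obtain ⟨y, hy⟩ := ih ha
      obtain ⟨z, hz⟩ := h1 b hb
      obtain ⟨y', hy'⟩ := hd y
      exact ⟨y' * z, by rw [map_mul, hy, hz, pow_succ, mul_assoc, ← mul_assoc y, hy']
                        simp only [mul_assoc]⟩
    · exact ⟨0, by simp⟩
    · rintro x y _ _ ⟨x', hx'⟩ ⟨y', hy'⟩
      exact ⟨x' + y', by rw [map_add, hx', hy', mul_add]⟩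
    · rintro c x _ ⟨x', hx'⟩
      exact ⟨c • x', by rw [map_smul, hx', mul_smul_comm]⟩

end Ideals

section MinorSets

variable {K : Type} [Field K] {q : K} {u v n t l : ℕ}

theorem qMinorF_eq_orderEmbOfFin {I : Finset (Fin u)} {J : Finset (Fin v)} (hI : I.card = l)
    (hJ : J.card = l) :
    qMinorF K q I J = qMinor K q (I.orderEmbOfFin hI) (J.orderEmbOfFin hJ) := by
  subst hI
  rw [qMinorF, dif_pos hJ.symm]
  rfl

theorem qMinorF_image {R : Fin l → Fin u} {C : Fin l → Fin v} (hR : StrictMono R)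
    (hC : StrictMono C) :
    qMinorF K q (Finset.univ.image R) (Finset.univ.image C) = qMinor K q R C := by
  have hI : (Finset.univ.image R).card = l := by
    rw [Finset.card_image_of_injective _ hR.injective, Finset.card_univ, Fintype.card_fin]
  have hJ : (Finset.univ.image C).card = l := by
    rw [Finset.card_image_of_injective _ hC.injective, Finset.card_univ, Fintype.card_fin]
  rw [qMinorF_eq_orderEmbOfFin hI hJ, ← Finset.orderEmbOfFin_unique hI (fun x => by simp) hR,
    ← Finset.orderEmbOfFin_unique hJ (fun x => by simp) hC]

theorem exists_strictMono_image {J : Finset (Fin v)} (hJ : J.card = l) :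
    ∃ C : Fin l → Fin v, StrictMono C ∧ Finset.univ.image C = J :=
  ⟨J.orderEmbOfFin hJ, (J.orderEmbOfFin hJ).strictMono, by simp⟩

theorem mul_normal_of_generators {d : OqM K q u v}
    (h : ∀ i j, ∃ e : K, Xg K q i j * d = e • (d * Xg K q i j)) (a : OqM K q u v) :
    ∃ a', a * d = d * a' := by
  induction a using oqM_induction with
  | hs c => exact ⟨algebraMap K _ c, Algebra.commutes c _⟩
  | hX i k =>
    obtain ⟨e, he⟩ := h i k
    exact ⟨e • Xg K q i k, by rw [he, mul_smul_comm]⟩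
  | hm a b ha hb =>
    obtain ⟨a', ha⟩ := ha
    obtain ⟨b', hb⟩ := hb
    exact ⟨a' * b', by rw [mul_assoc, hb, ← mul_assoc, ha, mul_assoc]⟩
  | ha a b ha hb =>
    obtain ⟨a', ha⟩ := ha
    obtain ⟨b', hb⟩ := hb
    exact ⟨a' + b', by rw [add_mul, ha, hb, mul_add]⟩

theorem tmul_one_normal {A B : Type} [Ring A] [Algebra K A] [Ring B] [Algebra K B] {d : A}
    (hd : ∀ a, ∃ a', a * d = d * a') (x : A ⊗[K] B) :
    ∃ x', x * (d ⊗ₜ[K] 1) = (d ⊗ₜ[K] 1) * x' := by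
  induction x with
  | zero => exact ⟨0, by simp⟩
  | tmul a b =>
    obtain ⟨a', ha⟩ := hd a
    exact ⟨a' ⊗ₜ b, by simp [ha]⟩
  | add x y hx hy =>
    obtain ⟨x', hx⟩ := hx
    obtain ⟨y', hy⟩ := hy
    exact ⟨x' + y', by rw [add_mul, hx, hy, mul_add]⟩

theorem one_tmul_normal {A B : Type} [Ring A] [Algebra K A] [Ring B] [Algebra K B] {d : B}
    (hd : ∀ a, ∃ a', a * d = d * a') (x : A ⊗[K] B) :
    ∃ x', x * ((1 : A) ⊗ₜ[K] d) = ((1 : A) ⊗ₜ[K] d) * x' := by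
  induction x with
  | zero => exact ⟨0, by simp⟩
  | tmul a b =>
    obtain ⟨b', hb⟩ := hd b
    exact ⟨a ⊗ₜ b', by simp [hb]⟩
  | add x y hx hy =>
    obtain ⟨x', hx⟩ := hx
    obtain ⟨y', hy⟩ := hy
    exact ⟨x' + y', by rw [add_mul, hx, hy, mul_add]⟩

end MinorSets

section TensorRepresentation

variable {K : Type} [Field K] {q : K} {n t : ℕ}

theorem qmLift_commute {E : Type} [Ring E] [Algebra K E] {u v u' v' : ℕ} {x : Fin u → Fin v → E}
    {y : Fin u' → Fin v' → E} (hx : IsQMat q x) (hy : IsQMat q y)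
    (h : ∀ i j k l, Commute (x i j) (y k l)) (a : OqM K q u v) (b : OqM K q u' v') :
    Commute (qmLift hx a) (qmLift hy b) := by
  induction a using oqM_induction with
  | hs c => rw [AlgHom.commutes]; exact Algebra.commutes _ _
  | hm a a' ha ha' => rw [map_mul]; exact ha.mul_left ha'
  | ha a a' ha ha' => rw [map_add]; exact ha.add_left ha'
  | hX i j =>
    induction b using oqM_induction with
    | hs c => rw [AlgHom.commutes]; exact (Algebra.commutes _ _).symm
    | hm a a' ha ha' => rw [map_mul]; exact ha.mul_right ha'
    | ha a a' ha ha' => rw [map_add]; exact ha.add_right ha'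
    | hX k l => rw [qmLift_Xg, qmLift_Xg]; exact h i j k l

/-- The torus representation of the coordinate ring of pairs of quantum matrices. -/
def repV (hq : q ≠ 0) (n t : ℕ) : OqM K q n t ⊗[K] OqM K q t n →ₐ[K]
    Module.End K (((Fin n ⊕ Fin n) × Fin t → ℤ) →₀ K) :=
  Algebra.TensorProduct.lift (qmLift (repY_isQMat hq)) (qmLift (repZ_isQMat hq))
    (qmLift_commute _ _ (repY_commute_repZ hq))

theorem repV_tmul (hq : q ≠ 0) (a : OqM K q n t) (b : OqM K q t n) :
    repV hq n t (a ⊗ₜ b) = qmLift (repY_isQMat hq) a * qmLift (repZ_isQMat hq) b :=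
  Algebra.TensorProduct.lift_tmul (qmLift (repY_isQMat hq)) (qmLift (repZ_isQMat hq))
    (qmLift_commute _ _ (repY_commute_repZ hq)) a b

theorem repV_comp (hq : q ≠ 0) {μ : OqMle K q n n t →ₐ[K] OqM K q n t ⊗[K] OqM K q t n}
    (hμ : ∀ (i j : Fin n),
      μ (mkle K q n n t (Xg K q i j)) = ∑ k : Fin t, Xg K q i k ⊗ₜ[K] Xg K q k j)
    (x : OqM K q n n) : repV hq n t (μ (mkle K q n n t x)) = repX hq n t x := by
  have h : ((repV hq n t).comp μ).comp (mkle K q n n t) = repX hq n t := by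
    refine oqM_hom_ext (E := Module.End K (((Fin n ⊕ Fin n) × Fin t → ℤ) →₀ K)) fun i j => ?_
    simp only [AlgHom.comp_apply, hμ, map_sum, repV_tmul, qmLift_Xg, repX]
  exact DFunLike.congr_fun h x

theorem map_wordProd {E : Type} [Ring E] [Algebra K E] {u v : ℕ} (f : OqM K q u v →ₐ[K] E)
    (w : List (Fin u × Fin v)) :
    f (wordProd (Xg K q) w) = wordProd (fun i j => f (Xg K q i j)) w := by
  rw [wordProd, map_list_prod, List.map_map]
  rfl

/-- The exponent with the given multiplicities. -/
def countExpo (p : Multiset (Fin n × Fin t) × Multiset (Fin t × Fin n)) :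
    (Fin n ⊕ Fin n) × Fin t → ℤ :=
  fun a => Sum.elim (fun i => (p.1.count (i, a.2) : ℤ)) (fun j => (p.2.count (a.2, j) : ℤ)) a.1

theorem countExpo_injective : Function.Injective (countExpo (n := n) (t := t)) := by
  rintro ⟨m, m'⟩ ⟨l, l'⟩ h
  refine Prod.ext (Multiset.ext.2 fun a => ?_) (Multiset.ext.2 fun a => ?_)
  · exact Int.natCast_inj.1 (congrFun h (Sum.inl a.1, a.2))
  · exact Int.natCast_inj.1 (congrFun h (Sum.inr a.2, a.1))

theorem countExpo_nonneg (p : Multiset (Fin n × Fin t) × Multiset (Fin t × Fin n)) (a) :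
    0 ≤ countExpo p a := by
  rcases a with ⟨i | j, k⟩ <;> exact Int.natCast_nonneg _

theorem wordProd_isLead (hq : q ≠ 0) (b : Bool) (w : List (Fin n × Fin t))
    (w' : List (Fin t × Fin n)) : IsLead (torWt b n t)
      (wordProd (repY q n t) w * wordProd (repZ q n t) w') (countExpo (↑w, ↑w')) := by
  have h1 : ∀ w : List (Fin n × Fin t),
      IsLead (torWt b n t) (wordProd (repY q n t) w) (countExpo (↑w, 0)) := by
    intro w
    induction w with
    | nil =>
      rw [wordProd_nil]
      convert IsLead.one using 1
      ext ⟨i | j, k⟩ <;> simp [countExpo]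
    | cons p w ih =>
      rw [wordProd_cons]
      convert (repY_isLead hq b p.1 p.2).mul ih using 1
      ext ⟨i | j, k⟩
      · by_cases h : (i, k) = p
        · subst h; simp [countExpo, add_comm]
        · have h' : ¬ (i = p.1 ∧ k = p.2) := fun h' => h (Prod.ext h'.1 h'.2)
          simp [countExpo, h', List.count_cons, Ne.symm h]
      · simp [countExpo]
  have h2 : ∀ w' : List (Fin t × Fin n),
      IsLead (torWt b n t) (wordProd (repZ q n t) w') (countExpo (0, ↑w')) := by
    intro w
    induction w with
    | nil =>
      rw [wordProd_nil]
      convert IsLead.one using 1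
      ext ⟨i | j, k⟩ <;> simp [countExpo]
    | cons p w ih =>
      rw [wordProd_cons]
      convert (repZ_isLead hq b p.1 p.2).mul ih using 1
      ext ⟨i | j, k⟩
      · simp [countExpo]
      · by_cases h : (k, j) = p
        · subst h; simp [countExpo, add_comm]
        · have h' : ¬ (j = p.2 ∧ k = p.1) := fun h' => h (Prod.ext h'.2 h'.1)
          simp [countExpo, h', List.count_cons, Ne.symm h]
  convert (h1 w).mul (h2 w') using 1
  ext ⟨i | j, k⟩ <;> simp [countExpo]

/-- The ordered monomials of the coordinate ring of pairs of quantum matrices. -/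
def pairWord (q : K) (p : Multiset (Fin n × Fin t) × Multiset (Fin t × Fin n)) :
    OqM K q n t ⊗[K] OqM K q t n :=
  wordProd (Xg K q) p.1.toList ⊗ₜ wordProd (Xg K q) p.2.toList

theorem repV_pairWord_isLead (hq : q ≠ 0) (b : Bool)
    (p : Multiset (Fin n × Fin t) × Multiset (Fin t × Fin n)) :
    IsLead (torWt b n t) (repV hq n t (pairWord q p)) (countExpo p) := by
  have h1 : qmLift (repY_isQMat hq) (wordProd (Xg K q) p.1.toList) =
      wordProd (repY q n t) p.1.toList :=
    (map_wordProd (E := Module.End K (((Fin n ⊕ Fin n) × Fin t → ℤ) →₀ K)) _ _).trans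
      (by simp only [qmLift_Xg])
  have h2 : qmLift (repZ_isQMat hq) (wordProd (Xg K q) p.2.toList) =
      wordProd (repZ q n t) p.2.toList :=
    (map_wordProd (E := Module.End K (((Fin n ⊕ Fin n) × Fin t → ℤ) →₀ K)) _ _).trans
      (by simp only [qmLift_Xg])
  rw [pairWord, repV_tmul, h1, h2]
  have := wordProd_isLead hq b p.1.toList p.2.toList
  rwa [Multiset.coe_toList, Multiset.coe_toList] at this

theorem span_pairWord_eq_top (hq : q ≠ 0) (n t : ℕ) :
    Submodule.span K (Set.range (pairWord (n := n) (t := t) q)) = ⊤ := by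
  have h := TensorProduct.map₂_mk_top_top_eq_top K (OqM K q n t) (OqM K q t n)
  rw [← span_wordProd_toList_eq_top hq, ← span_wordProd_toList_eq_top hq,
    Submodule.map₂_span_span] at h
  rw [eq_top_iff, ← h]
  refine Submodule.span_mono ?_
  rintro _ ⟨_, ⟨m, rfl⟩, _, ⟨m', rfl⟩, rfl⟩
  exact ⟨(m, m'), rfl⟩

end TensorRepresentation

section Preimage

variable {K : Type} [Field K] {q : K} {n t : ℕ}

/-- A nonzero combination of standard products mapping into the ideal generated by `d ^ s` has a
term whose leading exponent is divisible by the one of `d ^ s`. -/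
theorem exists_le_stdExpo (hq : q ≠ 0) (b : Bool) (htn : t ≤ n)
    {μ : OqMle K q n n t →ₐ[K] OqM K q n t ⊗[K] OqM K q t n}
    (hμ : ∀ (i j : Fin n),
      μ (mkle K q n n t (Xg K q i j)) = ∑ k : Fin t, Xg K q i k ⊗ₜ[K] Xg K q k j)
    {d : OqM K q n t ⊗[K] OqM K q t n} {v : (Fin n ⊕ Fin n) × Fin t → ℤ}
    (hd : IsLead (torWt b n t) (repV hq n t d) v) {p : (Fin n ⊕ Fin n) × Fin t} (hp : v p = 1)
    {s : ℕ} (F : Finset {m : Multiset (Fin n × Fin n) // shape m t = 0}) (hF : F.Nonempty)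
    {c : {m : Multiset (Fin n × Fin n) // shape m t = 0} → K} (hc : ∀ m ∈ F, c m ≠ 0)
    {y : OqM K q n t ⊗[K] OqM K q t n}
    (h : μ (mkle K q n n t (∑ m ∈ F, c m • stdProd q b (Xg K q) m.1)) = d ^ s * y) :
    ∃ m ∈ F, (s : ℤ) ≤ stdExpo b t htn m p := by
  classical
  obtain ⟨β, hβ⟩ := (Finsupp.mem_span_range_iff_exists_finsupp).1
    (span_pairWord_eq_top (K := K) hq n t ▸ Submodule.mem_top : y ∈ _)
  set z := repV hq n t (d ^ s * y) (Finsupp.single 0 1) with hz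
  have hz1 : z = ∑ m ∈ F, c m • repX hq n t (stdProd q b (Xg K q) m.1) (Finsupp.single 0 1) := by
    rw [hz, ← h, repV_comp hq hμ, map_sum, LinearMap.sum_apply]
    simp only [map_smul, LinearMap.smul_apply]
  have hz2 : z = ∑ a ∈ β.support, β a • repV hq n t (d ^ s * pairWord q a)
      (Finsupp.single 0 1) := by
    rw [hz, ← hβ, Finsupp.sum, Finset.mul_sum, map_sum, LinearMap.sum_apply]
    simp only [mul_smul_comm, map_smul, LinearMap.smul_apply]
  choose κ hκ hg using fun m => repX_stdProd_apply (n := n) (t := t) hq b htn m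
  obtain ⟨m, hm, hne, hmax⟩ := triangular_support (wt := torWt b n t) F (fun j _ => hκ j)
    (stdExpo_injective b htn).injOn (fun j _ => hg j) hc hF
  rw [← hz1] at hne hmax
  have hlead : ∀ a, IsLead (torWt b n t) (repV hq n t (d ^ s * pairWord q a))
      (s • v + countExpo a) := fun a => by
    rw [map_mul, map_pow]
    exact (hd.pow s).mul (repV_pairWord_isLead hq b a)
  choose κ' hκ' hg' using fun a => (hlead a).apply_zero
  have hs : β.support.Nonempty := by
    by_contra hc
    rw [Finset.not_nonempty_iff_eq_empty] at hc
    rw [hz2, hc, Finset.sum_empty] at hne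
    exact hne rfl
  obtain ⟨a, -, hne', hmax'⟩ := triangular_support (wt := torWt b n t) β.support
    (fun j _ => hκ' j) (fun x _ y _ hxy => countExpo_injective (add_left_cancel hxy))
    (fun j _ => hg' j) (fun j hj => Finsupp.mem_support_iff.1 hj) hs
  rw [← hz2] at hne' hmax'
  obtain ⟨a', -, ha'⟩ := (hmax' _ hne).2 (le_antisymm (hmax' _ hne).1 (hmax _ hne').1)
  refine ⟨m, hm, ?_⟩
  have := countExpo_nonneg a' p
  rw [ha', Pi.add_apply, Pi.smul_apply, hp, nsmul_eq_mul, mul_one]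
  omega

theorem preimage_eq_idealPow (hq : q ≠ 0) (b : Bool) (htn : t < n)
    {μ : OqMle K q n n t →ₐ[K] OqM K q n t ⊗[K] OqM K q t n}
    (hμ : ∀ (i j : Fin n),
      μ (mkle K q n n t (Xg K q i j)) = ∑ k : Fin t, Xg K q i k ⊗ₜ[K] Xg K q k j)
    {d : OqM K q n t ⊗[K] OqM K q t n} (hnormal : ∀ a, ∃ a', a * d = d * a')
    {v : (Fin n ⊕ Fin n) × Fin t → ℤ} (hd : IsLead (torWt b n t) (repV hq n t d) v)
    {p : (Fin n ⊕ Fin n) × Fin t} (hp : v p = 1) {G : Set (OqMle K q n n t)}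
    (hG : ∀ g ∈ G, ∃ y, μ g = d * y) {s : ℕ}
    (hstd : ∀ m : {m : Multiset (Fin n × Fin n) // shape m t = 0},
      (s : ℤ) ≤ stdExpo b t htn.le m p → mkle K q n n t (stdProd q b (Xg K q) m.1) ∈
        idealPow K (OqMle K q n n t) (tsSpan K (OqMle K q n n t) G) s) (x : OqMle K q n n t) :
    μ x ∈ tsSpan K (OqM K q n t ⊗[K] OqM K q t n) {d ^ s} ↔
      x ∈ idealPow K (OqMle K q n n t) (tsSpan K (OqMle K q n n t) G) s := by
  classical
  rw [mem_tsSpan_singleton_iff (pow_normal hnormal s)]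
  refine ⟨?_, map_mem_of_mem_idealPow (R := OqMle K q n n t)
    (B := OqM K q n t ⊗[K] OqM K q t n) μ hnormal hG⟩
  rintro ⟨y, hy⟩
  have hI := (isTwoSided_tsSpan (K := K) G).idealPow s
  obtain ⟨x, rfl⟩ := RingQuot.mkAlgHom_surjective K (DetRel K q n n t) x
  change μ (mkle K q n n t x) = _ at hy
  change mkle K q n n t x ∈ _
  obtain ⟨c, rfl⟩ := (Finsupp.mem_span_range_iff_exists_finsupp).1
    (span_stdProd_eq_top (K := K) hq b n ▸ Submodule.mem_top : x ∈ _)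
  have h1 : mkle K q n n t (c.sum fun m a => a • stdProd q b (Xg K q) m) =
      mkle K q n n t (∑ m ∈ c.support.subtype (fun m => shape m t = 0),
        c m.1 • stdProd q b (Xg K q) m.1) := by
    rw [Finset.sum_subtype_eq_sum_filter (f := fun m => c m • stdProd q b (Xg K q) m), Finsupp.sum,
      map_sum, map_sum, Finset.sum_filter_of_ne]
    intro m _ hne
    by_contra hm
    exact hne (by rw [map_smul, mkle_stdProd_eq_zero b htn hm, smul_zero])
  rw [h1] at hy ⊢
  set F := c.support.subtype (fun m => shape m t = 0) with hF
  rw [← Finset.sum_filter_add_sum_filter_not F (fun m => (s : ℤ) ≤ stdExpo b t htn.le m p),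
    map_add] at hy ⊢
  have h2 : mkle K q n n t (∑ m ∈ F.filter fun m => (s : ℤ) ≤ stdExpo b t htn.le m p,
      c m.1 • stdProd q b (Xg K q) m.1) ∈
        idealPow K (OqMle K q n n t) (tsSpan K (OqMle K q n n t) G) s := by
    rw [map_sum]
    simp only [map_smul]
    exact hI.sum_smul_mem _ _ fun m hm => hstd m (Finset.mem_filter.1 hm).2
  obtain ⟨y', hy'⟩ := map_mem_of_mem_idealPow (R := OqMle K q n n t)
    (B := OqM K q n t ⊗[K] OqM K q t n) μ hnormal hG h2
  rw [map_add, hy'] at hy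
  replace hy := (eq_sub_of_add_eq' (G := OqM K q n t ⊗[K] OqM K q t n) hy).trans
    (mul_sub (d ^ s) y y').symm
  have h3 : F.filter (fun m => ¬ (s : ℤ) ≤ stdExpo b t htn.le m p) = ∅ := by
    by_contra hne
    obtain ⟨m, hm, hle⟩ := exists_le_stdExpo hq b htn.le hμ hd hp _
      (Finset.nonempty_iff_ne_empty.2 hne) (c := fun m => c m.1)
      (fun m hm => Finsupp.mem_support_iff.1
        (Finset.mem_subtype.1 (Finset.mem_filter.1 hm).1)) hy
    exact (Finset.mem_filter.1 hm).2 hle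
  rw [h3, Finset.sum_empty, map_zero, add_zero]
  exact h2

theorem IsStripChain.rowFn_lt {c : ℕ → ℕ → ℕ} (hc : IsStripChain c) (ht : 0 < t) (htn : t ≤ n)
    {r : ℕ} (hr : r < c t (t - 1)) (hlen : colLen (c n) n r ≤ t) :
    colLen (c n) n r = t ∧ ∀ x, (rowFn hc n r x : ℕ) < t := by
  have h1 : t - 1 < colLen (c n) n r := (lt_colLen_iff (hc.antitone n) (by omega)).2
    (lt_of_lt_of_le hr (hc.monotone (t - 1) htn))
  have h2 : rowFn hc n r ⟨t - 1, h1⟩ = ⟨t - 1, by omega⟩ := by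
    refine (rowFn_eq_iff hc _ _).2 ⟨?_, ?_⟩
    · rw [hc.eq_zero le_rfl]; exact Nat.zero_le _
    · simpa only [Nat.sub_add_cancel ht] using hr
  refine ⟨by omega, fun x => ?_⟩
  have h3 : rowFn hc n r x ≤ rowFn hc n r ⟨t - 1, h1⟩ :=
    (rowFn_strictMono hc).monotone (by rw [Fin.le_def]; simp only; omega)
  rw [h2, Fin.le_def] at h3
  simp only at h3
  omega

theorem image_flConj_rev {I : Fin t → Fin n} (hI : StrictMono I) (h : ∀ x, (I x : ℕ) < t)
    (htn : t ≤ n) : Finset.univ.image (flConj true I) = Itilde n t htn := by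
  refine Finset.eq_of_subset_of_card_le ?_ ?_
  · intro i hi
    obtain ⟨x, -, rfl⟩ := Finset.mem_image.1 hi
    have := h (fl true x)
    refine Finset.mem_image.2 ⟨⟨t - 1 - I (fl true x), by omega⟩, Finset.mem_univ _, ?_⟩
    ext
    simp only [rowTop, flConj, fl, if_true, Fin.val_rev] at this ⊢
    omega
  · rw [Finset.card_image_of_injective _ (flConj_strictMono true hI).injective]
    exact Finset.card_image_le

theorem image_flConj_id {I : Fin t → Fin n} (hI : StrictMono I) (h : ∀ x, (I x : ℕ) < t)
    (htn : t ≤ n) : Finset.univ.image (flConj false I) = Jtilde n t htn := by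
  refine Finset.eq_of_subset_of_card_le ?_ ?_
  · intro i hi
    obtain ⟨x, -, rfl⟩ := Finset.mem_image.1 hi
    exact Finset.mem_image.2 ⟨⟨I x, h x⟩, Finset.mem_univ _, rfl⟩
  · rw [Finset.card_image_of_injective _ (flConj_strictMono false hI).injective]
    exact Finset.card_image_le

theorem qMinorF_flConj (b : Bool) {l : ℕ} {I J : Fin l → Fin n} (hI : StrictMono I)
    (hJ : StrictMono J) : qMinorF K q (Finset.univ.image (flConj b I))
      (Finset.univ.image (flConj b J)) = qdet q (Xg K q) (flConj b I) (flConj b J) :=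
  qMinorF_image (flConj_strictMono b hI) (flConj_strictMono b hJ)

theorem card_image_flConj (b : Bool) {l : ℕ} {I : Fin l → Fin n} (hI : StrictMono I) :
    (Finset.univ.image (flConj b I)).card = l := by
  rw [Finset.card_image_of_injective _ (flConj_strictMono b hI).injective, Finset.card_univ,
    Fintype.card_fin]

theorem mkle_stdMinor_mem_Pone (ht : 0 < t) (htn : t ≤ n) {m : Multiset (Fin n × Fin n)}
    (hm : shape m t = 0) {r : ℕ} (hr : r < growth (countMat m) t n (t - 1)) :
    mkle K q n n t (stdMinor q true (Xg K q) m r) ∈ Pone K q n t htn := by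
  obtain ⟨hl, hlt⟩ := (growth_isStripChain_left (A := countMat m) n).rowFn_lt ht htn hr
    (colLen_shape_le htn hm r)
  have key : ∀ {l : ℕ} (I J : Fin l → Fin n), l = t → (∀ x, (I x : ℕ) < t) → StrictMono I →
      StrictMono J → mkle K q n n t (qdet q (Xg K q) (flConj true I) (flConj true J)) ∈
        Pone K q n t htn := by
    rintro l I J rfl hlt hI hJ
    rw [← qMinorF_flConj true hI hJ, image_flConj_rev hI hlt htn]
    exact Submodule.subset_span ⟨1, 1, _, ⟨_, card_image_flConj true hJ, rfl⟩, by simp⟩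
  exact key (rowI m r) (rowJ m r) hl hlt (rowI_strictMono m r) (rowJ_strictMono m r)

theorem mkle_stdMinor_mem_Ptwo (ht : 0 < t) (htn : t ≤ n) {m : Multiset (Fin n × Fin n)}
    (hm : shape m t = 0) {r : ℕ} (hr : r < growth (countMat m) n t (t - 1)) :
    mkle K q n n t (stdMinor q false (Xg K q) m r) ∈ Ptwo K q n t htn := by
  obtain ⟨hl, hlt⟩ := (growth_isStripChain_right (A := countMat m) n).rowFn_lt ht htn hr
    (colLen_shape_le htn hm r)
  have key : ∀ {l : ℕ} (I J : Fin l → Fin n), l = t → (∀ x, (J x : ℕ) < t) → StrictMono I →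
      StrictMono J → mkle K q n n t (qdet q (Xg K q) (flConj false I) (flConj false J)) ∈
        Ptwo K q n t htn := by
    rintro l I J rfl hlt hI hJ
    rw [← qMinorF_flConj false hI hJ, image_flConj_id hJ hlt htn]
    exact Submodule.subset_span ⟨1, 1, _, ⟨_, card_image_flConj false hI, rfl⟩, by simp⟩
  exact key (rowI m r) (rowJ m r) hl hlt (rowI_strictMono m r) (rowJ_strictMono m r)

theorem mkle_stdProd_mem_idealPow (b : Bool) {P : Set (OqMle K q n n t)} (hP : IsTwoSided K P)
    {m : Multiset (Fin n × Fin n)} {s : ℕ} (hs : s ≤ shape m 0)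
    (h : ∀ r < s, mkle K q n n t (stdMinor q b (Xg K q) m r) ∈ P) :
    mkle K q n n t (stdProd q b (Xg K q) m) ∈ idealPow K (OqMle K q n n t) P s := by
  rw [stdProd, map_list_prod, List.map_ofFn]
  exact hP.prod_mem_idealPow hs h

theorem map_mkle_qMinor (hq : q ≠ 0)
    {μ : OqMle K q n n t →ₐ[K] OqM K q n t ⊗[K] OqM K q t n}
    (hμ : ∀ (i j : Fin n),
      μ (mkle K q n n t (Xg K q i j)) = ∑ k : Fin t, Xg K q i k ⊗ₜ[K] Xg K q k j)
    (R : Fin t → Fin n) {C : Fin t → Fin n} (hC : StrictMono C) :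
    μ (mkle K q n n t (qMinor K q R C)) = qMinor K q R id ⊗ₜ qMinor K q id C := by
  have h1 : μ (mkle K q n n t (qMinor K q R C)) = qdet q (fun i j => ∑ k : Fin t,
      (Xg K q i k ⊗ₜ[K] (1 : OqM K q t n)) * ((1 : OqM K q n t) ⊗ₜ[K] Xg K q k j)) R C := by
    refine (map_qMinor (E := OqM K q n t ⊗[K] OqM K q t n) (μ.comp (mkle K q n n t)) R C).trans ?_
    simp only [AlgHom.comp_apply, hμ, Algebra.TensorProduct.tmul_mul_tmul, mul_one, one_mul]
  have h2 : IsQMat q fun (k : Fin t) (j : Fin n) => (1 : OqM K q n t) ⊗ₜ[K] Xg K q k j :=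
    IsQMat.map (E := OqM K q t n) (E' := OqM K q n t ⊗[K] OqM K q t n) isQMat_Xg
      (Algebra.TensorProduct.includeRight : OqM K q t n →ₐ[K] OqM K q n t ⊗[K] OqM K q t n)
  have h3 : qdet q (fun (i : Fin n) (k : Fin t) => Xg K q i k ⊗ₜ[K] (1 : OqM K q t n)) R id =
      qMinor K q R id ⊗ₜ[K] (1 : OqM K q t n) :=
    (map_qMinor (E := OqM K q n t ⊗[K] OqM K q t n) Algebra.TensorProduct.includeLeft R id).symm
  have h4 : qdet q (fun (k : Fin t) (j : Fin n) => (1 : OqM K q n t) ⊗ₜ[K] Xg K q k j) id C =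
      (1 : OqM K q n t) ⊗ₜ[K] qMinor K q id C :=
    (map_qMinor (E := OqM K q n t ⊗[K] OqM K q t n) Algebra.TensorProduct.includeRight id C).symm
  rw [h1, qdet_matMul_square hq h2 (fun i k l j => by simp [Commute, SemiconjBy]) R hC, h3, h4,
    Algebra.TensorProduct.tmul_mul_tmul, mul_one, one_mul]

theorem exists_map_mkle_eq_dY_mul (hq : q ≠ 0) (htn : t ≤ n)
    {μ : OqMle K q n n t →ₐ[K] OqM K q n t ⊗[K] OqM K q t n}
    (hμ : ∀ (i j : Fin n),
      μ (mkle K q n n t (Xg K q i j)) = ∑ k : Fin t, Xg K q i k ⊗ₜ[K] Xg K q k j)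
    {J : Finset (Fin n)} (hJ : J.card = t) :
    ∃ y, μ (mkle K q n n t (qMinorF K q (Itilde n t htn) J)) =
      (dY K q n t htn ⊗ₜ[K] (1 : OqM K q t n)) * y := by
  obtain ⟨C, hC, rfl⟩ := exists_strictMono_image hJ
  refine ⟨1 ⊗ₜ qMinor K q id C, ?_⟩
  rw [Itilde, qMinorF_image (rowTop_strictMono htn) hC, map_mkle_qMinor hq hμ _ hC,
    Algebra.TensorProduct.tmul_mul_tmul, mul_one, one_mul]
  rfl

theorem exists_map_mkle_eq_dZ_mul (hq : q ≠ 0) (htn : t ≤ n)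
    {μ : OqMle K q n n t →ₐ[K] OqM K q n t ⊗[K] OqM K q t n}
    (hμ : ∀ (i j : Fin n),
      μ (mkle K q n n t (Xg K q i j)) = ∑ k : Fin t, Xg K q i k ⊗ₜ[K] Xg K q k j)
    {I : Finset (Fin n)} (hI : I.card = t) :
    ∃ y, μ (mkle K q n n t (qMinorF K q I (Jtilde n t htn))) =
      ((1 : OqM K q n t) ⊗ₜ[K] dZ K q n t htn) * y := by
  obtain ⟨R, hR, rfl⟩ := exists_strictMono_image hI
  refine ⟨qMinor K q R id ⊗ₜ 1, ?_⟩
  rw [Jtilde, qMinorF_image hR (colLeft_strictMono htn), map_mkle_qMinor hq hμ _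
    (colLeft_strictMono htn), Algebra.TensorProduct.tmul_mul_tmul, mul_one, one_mul]
  rfl

theorem repV_dY_isLead (hq : q ≠ 0) (b : Bool) (htn : t ≤ n) :
    IsLead (torWt b n t) (repV hq n t (dY K q n t htn ⊗ₜ 1))
      (∑ x, expo (Sum.inl (rowTop n t htn x)) x) := by
  have h : repV hq n t (dY K q n t htn ⊗ₜ 1) =
      qdet q (repY q n t) (rowTop n t htn) id := by
    rw [repV_tmul, map_one, mul_one]
    refine (map_qMinor (E := Module.End K (((Fin n ⊕ Fin n) × Fin t → ℤ) →₀ K)) _ _ _).trans ?_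
    simp only [qmLift_Xg]
  rw [h]
  exact qdet_repY_isLead hq b (rowTop_strictMono htn)

theorem repV_dZ_isLead (hq : q ≠ 0) (b : Bool) (htn : t ≤ n) :
    IsLead (torWt b n t) (repV hq n t (1 ⊗ₜ dZ K q n t htn))
      (∑ x, expo (Sum.inr (colLeft n t htn x)) x) := by
  have h : repV hq n t (1 ⊗ₜ dZ K q n t htn) =
      qdet q (repZ q n t) (topIdx b le_rfl) (colLeft n t htn) := by
    rw [repV_tmul, map_one, one_mul, topIdx_self]
    refine (map_qMinor (E := Module.End K (((Fin n ⊕ Fin n) × Fin t → ℤ) →₀ K)) _ _ _).trans ?_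
    simp only [qmLift_Xg]
  rw [h]
  simpa using qdet_repZ_isLead hq b le_rfl (colLeft_strictMono htn)

theorem sum_expo_apply_self {ι : Type} [DecidableEq ι] (f : Fin t → ι) (k : Fin t) :
    (∑ x, expo (f x) x) (f k, k) = 1 := by
  rw [Finset.sum_apply, Finset.sum_eq_single k]
  · exact Pi.single_eq_same _ _
  · exact fun x _ hx => Pi.single_eq_of_ne (fun h => hx (congrArg Prod.snd h).symm) _
  · simp

theorem preimage_dY_pow (hq : q ≠ 0) (ht : 0 < t) (htn : t < n)
    {μ : OqMle K q n n t →ₐ[K] OqM K q n t ⊗[K] OqM K q t n}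
    (hμ : ∀ (i j : Fin n),
      μ (mkle K q n n t (Xg K q i j)) = ∑ k : Fin t, Xg K q i k ⊗ₜ[K] Xg K q k j)
    (s : ℕ) (x : OqMle K q n n t) :
    μ x ∈ tsSpan K (OqM K q n t ⊗[K] OqM K q t n)
        {(dY K q n t htn.le ^ s) ⊗ₜ[K] (1 : OqM K q t n)} ↔
      x ∈ idealPow K (OqMle K q n n t) (Pone K q n t htn.le) s := by
  rw [← one_pow (M := OqM K q t n) s, ← Algebra.TensorProduct.tmul_pow]
  refine preimage_eq_idealPow hq true htn hμ
    (tmul_one_normal (mul_normal_of_generators (dY_normal hq htn.le)))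
    (repV_dY_isLead hq true htn.le)
    (p := (Sum.inl (rowTop n t htn.le ⟨0, ht⟩), ⟨0, ht⟩)) ?_ ?_ ?_ x
  · exact sum_expo_apply_self (fun x => Sum.inl (rowTop n t htn.le x)) ⟨0, ht⟩
  · rintro _ ⟨J, hJ, rfl⟩
    exact exists_map_mkle_eq_dY_mul hq htn.le hμ hJ
  · intro m hm
    have h1 : rowTop n t htn.le ⟨0, ht⟩ = fl true (⟨t - 1, by omega⟩ : Fin n) := by
      ext; simp only [rowTop, fl, if_true, Fin.val_rev]; omega
    have h2 : (⟨0, ht⟩ : Fin t) = fl true (⟨t - 1, by omega⟩ : Fin t) := by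
      ext; simp only [fl, if_true, Fin.val_rev]; omega
    have hc := growth_isStripChain_left (A := countMat m.1) n
    rw [h1, h2, stdExpo_inl, hc.eq_zero le_rfl] at hm
    simp only [Nat.sub_add_cancel ht] at hm
    have h3 : s ≤ growth (countMat m.1) t n (t - 1) := by omega
    refine mkle_stdProd_mem_idealPow true (isTwoSided_tsSpan _)
      (h3.trans ((hc.monotone (t - 1) htn.le).trans (hc.antitone n (Nat.zero_le _))))
      fun r hr => mkle_stdMinor_mem_Pone ht htn.le m.2 (lt_of_lt_of_le hr h3)

theorem preimage_dZ_pow (hq : q ≠ 0) (ht : 0 < t) (htn : t < n)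
    {μ : OqMle K q n n t →ₐ[K] OqM K q n t ⊗[K] OqM K q t n}
    (hμ : ∀ (i j : Fin n),
      μ (mkle K q n n t (Xg K q i j)) = ∑ k : Fin t, Xg K q i k ⊗ₜ[K] Xg K q k j)
    (s : ℕ) (x : OqMle K q n n t) :
    μ x ∈ tsSpan K (OqM K q n t ⊗[K] OqM K q t n)
        {(1 : OqM K q n t) ⊗ₜ[K] (dZ K q n t htn.le ^ s)} ↔
      x ∈ idealPow K (OqMle K q n n t) (Ptwo K q n t htn.le) s := by
  rw [← one_pow (M := OqM K q n t) s, ← Algebra.TensorProduct.tmul_pow]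
  refine preimage_eq_idealPow hq false htn hμ
    (one_tmul_normal (mul_normal_of_generators (dZ_normal hq htn.le)))
    (repV_dZ_isLead hq false htn.le)
    (p := (Sum.inr (colLeft n t htn.le ⟨t - 1, by omega⟩), ⟨t - 1, by omega⟩)) ?_ ?_ ?_ x
  · exact sum_expo_apply_self (fun x => Sum.inr (colLeft n t htn.le x)) ⟨t - 1, by omega⟩
  · rintro _ ⟨I, hI, rfl⟩
    exact exists_map_mkle_eq_dZ_mul hq htn.le hμ hI
  · intro m hm
    have hc := growth_isStripChain_right (A := countMat m.1) n
    have h1 := stdExpo_inr false htn.le m ⟨t - 1, by omega⟩ ⟨t - 1, by omega⟩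
    rw [hc.eq_zero le_rfl] at h1
    simp only [Nat.sub_add_cancel ht] at h1
    have h2 := hm.trans_eq h1
    have h3 : s ≤ growth (countMat m.1) n t (t - 1) := by omega
    refine mkle_stdProd_mem_idealPow false (isTwoSided_tsSpan _)
      (h3.trans ((hc.monotone (t - 1) htn.le).trans (hc.antitone n (Nat.zero_le _))))
      fun r hr => mkle_stdMinor_mem_Ptwo ht htn.le m.2 (lt_of_lt_of_le hr h3)

end Preimage

/-- (case `m = n > t`) for every `s ≥ 0`,
`(μ*_q)⁻¹(⟨d_Y^s ⊗ 1⟩) = P₁^s` and `(μ*_q)⁻¹(⟨1 ⊗ d_Z^s⟩) = P₂^s`. -/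
theorem stmt18 (K : Type) [Field K] (q : K) (hq : q ≠ 0) (n t : ℕ) (ht : 0 < t) (htn : t < n)
    -- `μ*_q`, induced by `X_{ij} ↦ Σ_k Y_{ik} ⊗ Z_{kj}`:
    (μ : OqMle K q n n t →ₐ[K] OqM K q n t ⊗[K] OqM K q t n)
    (hμ : ∀ (i j : Fin n),
      μ (mkle K q n n t (Xg K q i j)) = ∑ k : Fin t, Xg K q i k ⊗ₜ[K] Xg K q k j)
    (s : ℕ) :
    (∀ x : OqMle K q n n t,
        μ x ∈ tsSpan K (OqM K q n t ⊗[K] OqM K q t n)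
            {(dY K q n t htn.le ^ s) ⊗ₜ[K] (1 : OqM K q t n)} ↔
          x ∈ idealPow K (OqMle K q n n t) (Pone K q n t htn.le) s) ∧
    (∀ x : OqMle K q n n t,
        μ x ∈ tsSpan K (OqM K q n t ⊗[K] OqM K q t n)
            {(1 : OqM K q n t) ⊗ₜ[K] (dZ K q n t htn.le ^ s)} ↔
          x ∈ idealPow K (OqMle K q n n t) (Ptwo K q n t htn.le) s) := by
  exact ⟨preimage_dY_pow hq ht htn hμ s, preimage_dZ_pow hq ht htn hμ s⟩

end
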